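/- Let R = ℚ[λ₁,…,λ₈,μ₁,…,μ₈] and consider the polynomials f₁ = μ₅² + μ₆μ₁ + μ₇λ₅ + μ₈λ₁ - 1, f₁₀ = μ₁μ₆ + μ₂² + μ₃λ₆ + μ₄λ₂ - 1, f₁₉ = λ₅μ₇ + λ₆μ₃ + λ₇² + λ₈λ₃ - 1, and f₂₈ = λ₁μ₈ + λ₂μ₄ + λ₃λ₈ + λ₄² - 1. These four polynomials, together with the remaining polynomials f₂,…,f₁₂₈ listed in the appendix of the referenced paper, generate the unit ideal of R; in particular, the system of equations f₁ = … = f₁₂₈ = 0 has no solution in any field of characteristic zero. -/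

import Mathlib

open MvPolynomial in
/-- `L i` is the variable `λ_{i+1}`. -/
noncomputable def L (i : Fin 8) : MvPolynomial (Fin 16) ℚ := X (Fin.castLE (by omega) i)

open MvPolynomial in
/-- `M i` is the variable `μ_{i+1}`. -/
noncomputable def M (i : Fin 8) : MvPolynomial (Fin 16) ℚ := X (8 + Fin.castLE (by omega) i)

noncomputable def f1 : MvPolynomial (Fin 16) ℚ := M 4 * M 4 + M 5 * M 0 + M 6 * L 4 + M 7 * L 0 - 1

noncomputable def f2 : MvPolynomial (Fin 16) ℚ := M 4 * M 5 + M 5 * M 1 + M 6 * L 5 + M 7 * L 1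

noncomputable def f3 : MvPolynomial (Fin 16) ℚ := M 4 * M 6 + M 5 * M 2 + M 6 * L 6 + M 7 * L 2

noncomputable def f4 : MvPolynomial (Fin 16) ℚ := M 4 * M 7 + M 5 * M 3 + M 6 * L 7 + M 7 * L 3

noncomputable def f5 : MvPolynomial (Fin 16) ℚ := M 4 * M 0 + M 5 * M 4 + M 6 * L 0 + M 7 * L 4 + M 1

noncomputable def f6 : MvPolynomial (Fin 16) ℚ := M 4 * M 1 + M 5 * M 5 + M 6 * L 1 + M 7 * L 5 + M 0

noncomputable def f7 : MvPolynomial (Fin 16) ℚ := M 4 * M 2 + M 5 * M 6 + M 6 * L 2 + M 7 * L 6 + M 3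

noncomputable def f8 : MvPolynomial (Fin 16) ℚ := M 4 * M 3 + M 5 * M 7 + M 6 * L 3 + M 7 * L 7 + M 2

noncomputable def f9 : MvPolynomial (Fin 16) ℚ := M 0 * M 4 + M 1 * M 0 + M 2 * L 4 + M 3 * L 0

noncomputable def f10 : MvPolynomial (Fin 16) ℚ := M 0 * M 5 + M 1 * M 1 + M 2 * L 5 + M 3 * L 1 - 1

noncomputable def f11 : MvPolynomial (Fin 16) ℚ := M 0 * M 6 + M 1 * M 2 + M 2 * L 6 + M 3 * L 2

noncomputable def f12 : MvPolynomial (Fin 16) ℚ := M 0 * M 7 + M 1 * M 3 + M 2 * L 7 + M 3 * L 3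

noncomputable def f13 : MvPolynomial (Fin 16) ℚ := M 0 * M 0 + M 1 * M 4 + M 2 * L 0 + M 3 * L 4 + M 5

noncomputable def f14 : MvPolynomial (Fin 16) ℚ := M 0 * M 1 + M 1 * M 5 + M 2 * L 1 + M 3 * L 5 + M 4

noncomputable def f15 : MvPolynomial (Fin 16) ℚ := M 0 * M 2 + M 1 * M 6 + M 2 * L 2 + M 3 * L 6 + M 7

noncomputable def f16 : MvPolynomial (Fin 16) ℚ := M 0 * M 3 + M 1 * M 7 + M 2 * L 3 + M 3 * L 7 + M 6

noncomputable def f17 : MvPolynomial (Fin 16) ℚ := L 4 * M 4 + L 5 * M 0 + L 6 * L 4 + L 7 * L 0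

noncomputable def f18 : MvPolynomial (Fin 16) ℚ := L 4 * M 5 + L 5 * M 1 + L 6 * L 5 + L 7 * L 1

noncomputable def f19 : MvPolynomial (Fin 16) ℚ := L 4 * M 6 + L 5 * M 2 + L 6 * L 6 + L 7 * L 2 - 1

noncomputable def f20 : MvPolynomial (Fin 16) ℚ := L 4 * M 7 + L 5 * M 3 + L 6 * L 7 + L 7 * L 3

noncomputable def f21 : MvPolynomial (Fin 16) ℚ := L 4 * M 0 + L 5 * M 4 + L 6 * L 0 + L 7 * L 4 + L 1

noncomputable def f22 : MvPolynomial (Fin 16) ℚ := L 4 * M 1 + L 5 * M 5 + L 6 * L 1 + L 7 * L 5 + L 0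

noncomputable def f23 : MvPolynomial (Fin 16) ℚ := L 4 * M 2 + L 5 * M 6 + L 6 * L 2 + L 7 * L 6 + L 3

noncomputable def f24 : MvPolynomial (Fin 16) ℚ := L 4 * M 3 + L 5 * M 7 + L 6 * L 3 + L 7 * L 7 + L 2

noncomputable def f25 : MvPolynomial (Fin 16) ℚ := L 0 * M 4 + L 1 * M 0 + L 2 * L 4 + L 3 * L 0

noncomputable def f26 : MvPolynomial (Fin 16) ℚ := L 0 * M 5 + L 1 * M 1 + L 2 * L 5 + L 3 * L 1

noncomputable def f27 : MvPolynomial (Fin 16) ℚ := L 0 * M 6 + L 1 * M 2 + L 2 * L 6 + L 3 * L 2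

noncomputable def f28 : MvPolynomial (Fin 16) ℚ := L 0 * M 7 + L 1 * M 3 + L 2 * L 7 + L 3 * L 3 - 1

noncomputable def f29 : MvPolynomial (Fin 16) ℚ := L 0 * M 0 + L 1 * M 4 + L 2 * L 0 + L 3 * L 4 + L 5

noncomputable def f30 : MvPolynomial (Fin 16) ℚ := L 0 * M 1 + L 1 * M 5 + L 2 * L 1 + L 3 * L 5 + L 4

noncomputable def f31 : MvPolynomial (Fin 16) ℚ := L 0 * M 2 + L 1 * M 6 + L 2 * L 2 + L 3 * L 6 + L 7

noncomputable def f32 : MvPolynomial (Fin 16) ℚ := L 0 * M 3 + L 1 * M 7 + L 2 * L 3 + L 3 * L 7 + L 6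

noncomputable def f33 : MvPolynomial (Fin 16) ℚ := M 0 * M 0 * M 4 + M 1 * L 0 * M 4 + M 2 * M 0 * L 4 + M 3 * L 0 * L 4 + M 0 * M 2 * M 0 + M 1 * L 2 * M 0 + M 2 * M 2 * L 0 + M 3 * L 2 * L 0 + M 4 * M 4 * M 6 + M 5 * L 4 * M 6 + M 6 * M 4 * L 6 + M 7 * L 4 * L 6 + M 4 * M 6 * M 2 + M 5 * L 6 * M 2 + M 6 * M 6 * L 2 + M 7 * L 6 * L 2

noncomputable def f34 : MvPolynomial (Fin 16) ℚ := M 0 * M 0 * M 5 + M 1 * L 0 * M 5 + M 2 * M 0 * L 5 + M 3 * L 0 * L 5 + M 0 * M 2 * M 1 + M 1 * L 2 * M 1 + M 2 * M 2 * L 1 + M 3 * L 2 * L 1 + M 4 * M 5 * M 6 + M 5 * L 5 * M 6 + M 6 * M 5 * L 6 + M 7 * L 5 * L 6 + M 4 * M 7 * M 2 + M 5 * L 7 * M 2 + M 6 * M 7 * L 2 + M 7 * L 7 * L 2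

noncomputable def f35 : MvPolynomial (Fin 16) ℚ := M 0 * M 0 * M 6 + M 1 * L 0 * M 6 + M 2 * M 0 * L 6 + M 3 * L 0 * L 6 + M 0 * M 2 * M 2 + M 1 * L 2 * M 2 + M 2 * M 2 * L 2 + M 3 * L 2 * L 2 + M 4 * M 4 * M 4 + M 5 * L 4 * M 4 + M 6 * M 4 * L 4 + M 7 * L 4 * L 4 + M 4 * M 6 * M 0 + M 5 * L 6 * M 0 + M 6 * M 6 * L 0 + M 7 * L 6 * L 0

noncomputable def f36 : MvPolynomial (Fin 16) ℚ := M 0 * M 0 * M 7 + M 1 * L 0 * M 7 + M 2 * M 0 * L 7 + M 3 * L 0 * L 7 + M 0 * M 2 * M 3 + M 1 * L 2 * M 3 + M 2 * M 2 * L 3 + M 3 * L 2 * L 3 + M 4 * M 5 * M 4 + M 5 * L 5 * M 4 + M 6 * M 5 * L 4 + M 7 * L 5 * L 4 + M 4 * M 7 * M 0 + M 5 * L 7 * M 0 + M 6 * M 7 * L 0 + M 7 * L 7 * L 0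

noncomputable def f37 : MvPolynomial (Fin 16) ℚ := M 0 * M 1 * M 4 + M 1 * L 1 * M 4 + M 2 * M 1 * L 4 + M 3 * L 1 * L 4 + M 0 * M 3 * M 0 + M 1 * L 3 * M 0 + M 2 * M 3 * L 0 + M 3 * L 3 * L 0 + M 4 * M 4 * M 7 + M 5 * L 4 * M 7 + M 6 * M 4 * L 7 + M 7 * L 4 * L 7 + M 4 * M 6 * M 3 + M 5 * L 6 * M 3 + M 6 * M 6 * L 3 + M 7 * L 6 * L 3

noncomputable def f38 : MvPolynomial (Fin 16) ℚ := M 0 * M 1 * M 5 + M 1 * L 1 * M 5 + M 2 * M 1 * L 5 + M 3 * L 1 * L 5 + M 0 * M 3 * M 1 + M 1 * L 3 * M 1 + M 2 * M 3 * L 1 + M 3 * L 3 * L 1 + M 4 * M 5 * M 7 + M 5 * L 5 * M 7 + M 6 * M 5 * L 7 + M 7 * L 5 * L 7 + M 4 * M 7 * M 3 + M 5 * L 7 * M 3 + M 6 * M 7 * L 3 + M 7 * L 7 * L 3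

noncomputable def f39 : MvPolynomial (Fin 16) ℚ := M 0 * M 1 * M 6 + M 1 * L 1 * M 6 + M 2 * M 1 * L 6 + M 3 * L 1 * L 6 + M 0 * M 3 * M 2 + M 1 * L 3 * M 2 + M 2 * M 3 * L 2 + M 3 * L 3 * L 2 + M 4 * M 4 * M 5 + M 5 * L 4 * M 5 + M 6 * M 4 * L 5 + M 7 * L 4 * L 5 + M 4 * M 6 * M 1 + M 5 * L 6 * M 1 + M 6 * M 6 * L 1 + M 7 * L 6 * L 1

noncomputable def f40 : MvPolynomial (Fin 16) ℚ := M 0 * M 1 * M 7 + M 1 * L 1 * M 7 + M 2 * M 1 * L 7 + M 3 * L 1 * L 7 + M 0 * M 3 * M 3 + M 1 * L 3 * M 3 + M 2 * M 3 * L 3 + M 3 * L 3 * L 3 + M 4 * M 5 * M 5 + M 5 * L 5 * M 5 + M 6 * M 5 * L 5 + M 7 * L 5 * L 5 + M 4 * M 7 * M 1 + M 5 * L 7 * M 1 + M 6 * M 7 * L 1 + M 7 * L 7 * L 1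

noncomputable def f41 : MvPolynomial (Fin 16) ℚ := M 0 * M 4 * M 4 + M 1 * L 4 * M 4 + M 2 * M 4 * L 4 + M 3 * L 4 * L 4 + M 0 * M 6 * M 0 + M 1 * L 6 * M 0 + M 2 * M 6 * L 0 + M 3 * L 6 * L 0 + M 4 * M 0 * M 6 + M 5 * L 0 * M 6 + M 6 * M 0 * L 6 + M 7 * L 0 * L 6 + M 4 * M 2 * M 2 + M 5 * L 2 * M 2 + M 6 * M 2 * L 2 + M 7 * L 2 * L 2

noncomputable def f42 : MvPolynomial (Fin 16) ℚ := M 0 * M 4 * M 5 + M 1 * L 4 * M 5 + M 2 * M 4 * L 5 + M 3 * L 4 * L 5 + M 0 * M 6 * M 1 + M 1 * L 6 * M 1 + M 2 * M 6 * L 1 + M 3 * L 6 * L 1 + M 4 * M 1 * M 6 + M 5 * L 1 * M 6 + M 6 * M 1 * L 6 + M 7 * L 1 * L 6 + M 4 * M 3 * M 2 + M 5 * L 3 * M 2 + M 6 * M 3 * L 2 + M 7 * L 3 * L 2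

noncomputable def f43 : MvPolynomial (Fin 16) ℚ := M 0 * M 4 * M 6 + M 1 * L 4 * M 6 + M 2 * M 4 * L 6 + M 3 * L 4 * L 6 + M 0 * M 6 * M 2 + M 1 * L 6 * M 2 + M 2 * M 6 * L 2 + M 3 * L 6 * L 2 + M 4 * M 0 * M 4 + M 5 * L 0 * M 4 + M 6 * M 0 * L 4 + M 7 * L 0 * L 4 + M 4 * M 2 * M 0 + M 5 * L 2 * M 0 + M 6 * M 2 * L 0 + M 7 * L 2 * L 0

noncomputable def f44 : MvPolynomial (Fin 16) ℚ := M 0 * M 4 * M 7 + M 1 * L 4 * M 7 + M 2 * M 4 * L 7 + M 3 * L 4 * L 7 + M 0 * M 6 * M 3 + M 1 * L 6 * M 3 + M 2 * M 6 * L 3 + M 3 * L 6 * L 3 + M 4 * M 1 * M 4 + M 5 * L 1 * M 4 + M 6 * M 1 * L 4 + M 7 * L 1 * L 4 + M 4 * M 3 * M 0 + M 5 * L 3 * M 0 + M 6 * M 3 * L 0 + M 7 * L 3 * L 0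

noncomputable def f45 : MvPolynomial (Fin 16) ℚ := M 0 * M 5 * M 4 + M 1 * L 5 * M 4 + M 2 * M 5 * L 4 + M 3 * L 5 * L 4 + M 0 * M 7 * M 0 + M 1 * L 7 * M 0 + M 2 * M 7 * L 0 + M 3 * L 7 * L 0 + M 4 * M 0 * M 7 + M 5 * L 0 * M 7 + M 6 * M 0 * L 7 + M 7 * L 0 * L 7 + M 4 * M 2 * M 3 + M 5 * L 2 * M 3 + M 6 * M 2 * L 3 + M 7 * L 2 * L 3

noncomputable def f46 : MvPolynomial (Fin 16) ℚ := M 0 * M 5 * M 5 + M 1 * L 5 * M 5 + M 2 * M 5 * L 5 + M 3 * L 5 * L 5 + M 0 * M 7 * M 1 + M 1 * L 7 * M 1 + M 2 * M 7 * L 1 + M 3 * L 7 * L 1 + M 4 * M 1 * M 7 + M 5 * L 1 * M 7 + M 6 * M 1 * L 7 + M 7 * L 1 * L 7 + M 4 * M 3 * M 3 + M 5 * L 3 * M 3 + M 6 * M 3 * L 3 + M 7 * L 3 * L 3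

noncomputable def f47 : MvPolynomial (Fin 16) ℚ := M 0 * M 5 * M 6 + M 1 * L 5 * M 6 + M 2 * M 5 * L 6 + M 3 * L 5 * L 6 + M 0 * M 7 * M 2 + M 1 * L 7 * M 2 + M 2 * M 7 * L 2 + M 3 * L 7 * L 2 + M 4 * M 0 * M 5 + M 5 * L 0 * M 5 + M 6 * M 0 * L 5 + M 7 * L 0 * L 5 + M 4 * M 2 * M 1 + M 5 * L 2 * M 1 + M 6 * M 2 * L 1 + M 7 * L 2 * L 1

noncomputable def f48 : MvPolynomial (Fin 16) ℚ := M 0 * M 5 * M 7 + M 1 * L 5 * M 7 + M 2 * M 5 * L 7 + M 3 * L 5 * L 7 + M 0 * M 7 * M 3 + M 1 * L 7 * M 3 + M 2 * M 7 * L 3 + M 3 * L 7 * L 3 + M 4 * M 1 * M 5 + M 5 * L 1 * M 5 + M 6 * M 1 * L 5 + M 7 * L 1 * L 5 + M 4 * M 3 * M 1 + M 5 * L 3 * M 1 + M 6 * M 3 * L 1 + M 7 * L 3 * L 1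

noncomputable def f49 : MvPolynomial (Fin 16) ℚ := -L 0 * M 0 - L 1 * L 0 + M 0 * M 1 * M 1 + M 1 * L 1 * M 1 + M 2 * M 1 * L 1 + M 3 * L 1 * L 1 + M 0 * M 3 * M 5 + M 1 * L 3 * M 5 + M 2 * M 3 * L 5 + M 3 * L 3 * L 5

noncomputable def f50 : MvPolynomial (Fin 16) ℚ := -L 0 * M 1 - L 1 * L 1 + M 0 * M 0 * M 1 + M 1 * L 0 * M 1 + M 2 * M 0 * L 1 + M 3 * L 0 * L 1 + M 0 * M 2 * M 5 + M 1 * L 2 * M 5 + M 2 * M 2 * L 5 + M 3 * L 2 * L 5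

noncomputable def f51 : MvPolynomial (Fin 16) ℚ := -L 0 * M 2 - L 1 * L 2 + M 0 * M 1 * M 0 + M 1 * L 1 * M 0 + M 2 * M 1 * L 0 + M 3 * L 1 * L 0 + M 0 * M 3 * M 4 + M 1 * L 3 * M 4 + M 2 * M 3 * L 4 + M 3 * L 3 * L 4

noncomputable def f52 : MvPolynomial (Fin 16) ℚ := -L 0 * M 3 - L 1 * L 3 + M 0 * M 0 * M 0 + M 1 * L 0 * M 0 + M 2 * M 0 * L 0 + M 3 * L 0 * L 0 + M 0 * M 2 * M 4 + M 1 * L 2 * M 4 + M 2 * M 2 * L 4 + M 3 * L 2 * L 4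

noncomputable def f53 : MvPolynomial (Fin 16) ℚ := -L 0 * M 4 - L 1 * L 4 + M 4 * M 1 * M 1 + M 5 * L 1 * M 1 + M 6 * M 1 * L 1 + M 7 * L 1 * L 1 + M 4 * M 3 * M 5 + M 5 * L 3 * M 5 + M 6 * M 3 * L 5 + M 7 * L 3 * L 5

noncomputable def f54 : MvPolynomial (Fin 16) ℚ := -L 0 * M 5 - L 1 * L 5 + M 4 * M 0 * M 1 + M 5 * L 0 * M 1 + M 6 * M 0 * L 1 + M 7 * L 0 * L 1 + M 4 * M 2 * M 5 + M 5 * L 2 * M 5 + M 6 * M 2 * L 5 + M 7 * L 2 * L 5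

noncomputable def f55 : MvPolynomial (Fin 16) ℚ := -L 0 * M 6 - L 1 * L 6 + M 4 * M 1 * M 0 + M 5 * L 1 * M 0 + M 6 * M 1 * L 0 + M 7 * L 1 * L 0 + M 4 * M 3 * M 4 + M 5 * L 3 * M 4 + M 6 * M 3 * L 4 + M 7 * L 3 * L 4

noncomputable def f56 : MvPolynomial (Fin 16) ℚ := -L 0 * M 7 - L 1 * L 7 + M 4 * M 0 * M 0 + M 5 * L 0 * M 0 + M 6 * M 0 * L 0 + M 7 * L 0 * L 0 + M 4 * M 2 * M 4 + M 5 * L 2 * M 4 + M 6 * M 2 * L 4 + M 7 * L 2 * L 4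

noncomputable def f57 : MvPolynomial (Fin 16) ℚ := -L 2 * M 0 - L 3 * L 0 + M 0 * M 1 * M 3 + M 1 * L 1 * M 3 + M 2 * M 1 * L 3 + M 3 * L 1 * L 3 + M 0 * M 3 * M 7 + M 1 * L 3 * M 7 + M 2 * M 3 * L 7 + M 3 * L 3 * L 7

noncomputable def f58 : MvPolynomial (Fin 16) ℚ := -L 2 * M 1 - L 3 * L 1 + M 0 * M 0 * M 3 + M 1 * L 0 * M 3 + M 2 * M 0 * L 3 + M 3 * L 0 * L 3 + M 0 * M 2 * M 7 + M 1 * L 2 * M 7 + M 2 * M 2 * L 7 + M 3 * L 2 * L 7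

noncomputable def f59 : MvPolynomial (Fin 16) ℚ := -L 2 * M 2 - L 3 * L 2 + M 0 * M 1 * M 2 + M 1 * L 1 * M 2 + M 2 * M 1 * L 2 + M 3 * L 1 * L 2 + M 0 * M 3 * M 6 + M 1 * L 3 * M 6 + M 2 * M 3 * L 6 + M 3 * L 3 * L 6

noncomputable def f60 : MvPolynomial (Fin 16) ℚ := -L 2 * M 3 - L 3 * L 3 + M 0 * M 0 * M 2 + M 1 * L 0 * M 2 + M 2 * M 0 * L 2 + M 3 * L 0 * L 2 + M 0 * M 2 * M 6 + M 1 * L 2 * M 6 + M 2 * M 2 * L 6 + M 3 * L 2 * L 6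

noncomputable def f61 : MvPolynomial (Fin 16) ℚ := -L 2 * M 4 - L 3 * L 4 + M 4 * M 1 * M 3 + M 5 * L 1 * M 3 + M 6 * M 1 * L 3 + M 7 * L 1 * L 3 + M 4 * M 3 * M 7 + M 5 * L 3 * M 7 + M 6 * M 3 * L 7 + M 7 * L 3 * L 7

noncomputable def f62 : MvPolynomial (Fin 16) ℚ := -L 2 * M 5 - L 3 * L 5 + M 4 * M 0 * M 3 + M 5 * L 0 * M 3 + M 6 * M 0 * L 3 + M 7 * L 0 * L 3 + M 4 * M 2 * M 7 + M 5 * L 2 * M 7 + M 6 * M 2 * L 7 + M 7 * L 2 * L 7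

noncomputable def f63 : MvPolynomial (Fin 16) ℚ := -L 2 * M 6 - L 3 * L 6 + M 4 * M 1 * M 2 + M 5 * L 1 * M 2 + M 6 * M 1 * L 2 + M 7 * L 1 * L 2 + M 4 * M 3 * M 6 + M 5 * L 3 * M 6 + M 6 * M 3 * L 6 + M 7 * L 3 * L 6

noncomputable def f64 : MvPolynomial (Fin 16) ℚ := -L 2 * M 7 - L 3 * L 7 + M 4 * M 0 * M 2 + M 5 * L 0 * M 2 + M 6 * M 0 * L 2 + M 7 * L 0 * L 2 + M 4 * M 2 * M 6 + M 5 * L 2 * M 6 + M 6 * M 2 * L 6 + M 7 * L 2 * L 6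

noncomputable def f65 : MvPolynomial (Fin 16) ℚ := -L 4 * M 0 - L 5 * L 0 + M 0 * M 5 * M 1 + M 1 * L 5 * M 1 + M 2 * M 5 * L 1 + M 3 * L 5 * L 1 + M 0 * M 7 * M 5 + M 1 * L 7 * M 5 + M 2 * M 7 * L 5 + M 3 * L 7 * L 5

noncomputable def f66 : MvPolynomial (Fin 16) ℚ := -L 4 * M 1 - L 5 * L 1 + M 0 * M 4 * M 1 + M 1 * L 4 * M 1 + M 2 * M 4 * L 1 + M 3 * L 4 * L 1 + M 0 * M 6 * M 5 + M 1 * L 6 * M 5 + M 2 * M 6 * L 5 + M 3 * L 6 * L 5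

noncomputable def f67 : MvPolynomial (Fin 16) ℚ := -L 4 * M 2 - L 5 * L 2 + M 0 * M 5 * M 0 + M 1 * L 5 * M 0 + M 2 * M 5 * L 0 + M 3 * L 5 * L 0 + M 0 * M 7 * M 4 + M 1 * L 7 * M 4 + M 2 * M 7 * L 4 + M 3 * L 7 * L 4

noncomputable def f68 : MvPolynomial (Fin 16) ℚ := -L 4 * M 3 - L 5 * L 3 + M 0 * M 4 * M 0 + M 1 * L 4 * M 0 + M 2 * M 4 * L 0 + M 3 * L 4 * L 0 + M 0 * M 6 * M 4 + M 1 * L 6 * M 4 + M 2 * M 6 * L 4 + M 3 * L 6 * L 4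

noncomputable def f69 : MvPolynomial (Fin 16) ℚ := -L 4 * M 4 - L 5 * L 4 + M 4 * M 5 * M 1 + M 5 * L 5 * M 1 + M 6 * M 5 * L 1 + M 7 * L 5 * L 1 + M 4 * M 7 * M 5 + M 5 * L 7 * M 5 + M 6 * M 7 * L 5 + M 7 * L 7 * L 5

noncomputable def f70 : MvPolynomial (Fin 16) ℚ := -L 4 * M 5 - L 5 * L 5 + M 4 * M 4 * M 1 + M 5 * L 4 * M 1 + M 6 * M 4 * L 1 + M 7 * L 4 * L 1 + M 4 * M 6 * M 5 + M 5 * L 6 * M 5 + M 6 * M 6 * L 5 + M 7 * L 6 * L 5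

noncomputable def f71 : MvPolynomial (Fin 16) ℚ := -L 4 * M 6 - L 5 * L 6 + M 4 * M 5 * M 0 + M 5 * L 5 * M 0 + M 6 * M 5 * L 0 + M 7 * L 5 * L 0 + M 4 * M 7 * M 4 + M 5 * L 7 * M 4 + M 6 * M 7 * L 4 + M 7 * L 7 * L 4

noncomputable def f72 : MvPolynomial (Fin 16) ℚ := -L 4 * M 7 - L 5 * L 7 + M 4 * M 4 * M 0 + M 5 * L 4 * M 0 + M 6 * M 4 * L 0 + M 7 * L 4 * L 0 + M 4 * M 6 * M 4 + M 5 * L 6 * M 4 + M 6 * M 6 * L 4 + M 7 * L 6 * L 4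

noncomputable def f73 : MvPolynomial (Fin 16) ℚ := -L 6 * M 0 - L 7 * L 0 + M 0 * M 5 * M 3 + M 1 * L 5 * M 3 + M 2 * M 5 * L 3 + M 3 * L 5 * L 3 + M 0 * M 7 * M 7 + M 1 * L 7 * M 7 + M 2 * M 7 * L 7 + M 3 * L 7 * L 7

noncomputable def f74 : MvPolynomial (Fin 16) ℚ := -L 6 * M 1 - L 7 * L 1 + M 0 * M 4 * M 3 + M 1 * L 4 * M 3 + M 2 * M 4 * L 3 + M 3 * L 4 * L 3 + M 0 * M 6 * M 7 + M 1 * L 6 * M 7 + M 2 * M 6 * L 7 + M 3 * L 6 * L 7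

noncomputable def f75 : MvPolynomial (Fin 16) ℚ := -L 6 * M 2 - L 7 * L 2 + M 0 * M 5 * M 2 + M 1 * L 5 * M 2 + M 2 * M 5 * L 2 + M 3 * L 5 * L 2 + M 0 * M 7 * M 6 + M 1 * L 7 * M 6 + M 2 * M 7 * L 6 + M 3 * L 7 * L 6

noncomputable def f76 : MvPolynomial (Fin 16) ℚ := -L 6 * M 3 - L 7 * L 3 + M 0 * M 4 * M 2 + M 1 * L 4 * M 2 + M 2 * M 4 * L 2 + M 3 * L 4 * L 2 + M 0 * M 6 * M 6 + M 1 * L 6 * M 6 + M 2 * M 6 * L 6 + M 3 * L 6 * L 6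

noncomputable def f77 : MvPolynomial (Fin 16) ℚ := -L 6 * M 4 - L 7 * L 4 + M 4 * M 5 * M 3 + M 5 * L 5 * M 3 + M 6 * M 5 * L 3 + M 7 * L 5 * L 3 + M 4 * M 7 * M 7 + M 5 * L 7 * M 7 + M 6 * M 7 * L 7 + M 7 * L 7 * L 7

noncomputable def f78 : MvPolynomial (Fin 16) ℚ := -L 6 * M 5 - L 7 * L 5 + M 4 * M 4 * M 3 + M 5 * L 4 * M 3 + M 6 * M 4 * L 3 + M 7 * L 4 * L 3 + M 4 * M 6 * M 7 + M 5 * L 6 * M 7 + M 6 * M 6 * L 7 + M 7 * L 6 * L 7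

noncomputable def f79 : MvPolynomial (Fin 16) ℚ := -L 6 * M 6 - L 7 * L 6 + M 4 * M 5 * M 2 + M 5 * L 5 * M 2 + M 6 * M 5 * L 2 + M 7 * L 5 * L 2 + M 4 * M 7 * M 6 + M 5 * L 7 * M 6 + M 6 * M 7 * L 6 + M 7 * L 7 * L 6

noncomputable def f80 : MvPolynomial (Fin 16) ℚ := -L 6 * M 7 - L 7 * L 7 + M 4 * M 4 * M 2 + M 5 * L 4 * M 2 + M 6 * M 4 * L 2 + M 7 * L 4 * L 2 + M 4 * M 6 * M 6 + M 5 * L 6 * M 6 + M 6 * M 6 * L 6 + M 7 * L 6 * L 6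

noncomputable def f81 : MvPolynomial (Fin 16) ℚ := L 0 * M 0 * M 4 + L 1 * L 0 * M 4 + L 2 * M 0 * L 4 + L 3 * L 0 * L 4 + L 0 * M 2 * M 0 + L 1 * L 2 * M 0 + L 2 * M 2 * L 0 + L 3 * L 2 * L 0 + L 4 * M 4 * M 6 + L 5 * L 4 * M 6 + L 6 * M 4 * L 6 + L 7 * L 4 * L 6 + L 4 * M 6 * M 2 + L 5 * L 6 * M 2 + L 6 * M 6 * L 2 + L 7 * L 6 * L 2

noncomputable def f82 : MvPolynomial (Fin 16) ℚ := L 0 * M 0 * M 5 + L 1 * L 0 * M 5 + L 2 * M 0 * L 5 + L 3 * L 0 * L 5 + L 0 * M 2 * M 1 + L 1 * L 2 * M 1 + L 2 * M 2 * L 1 + L 3 * L 2 * L 1 + L 4 * M 5 * M 6 + L 5 * L 5 * M 6 + L 6 * M 5 * L 6 + L 7 * L 5 * L 6 + L 4 * M 7 * M 2 + L 5 * L 7 * M 2 + L 6 * M 7 * L 2 + L 7 * L 7 * L 2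

noncomputable def f83 : MvPolynomial (Fin 16) ℚ := L 0 * M 0 * M 6 + L 1 * L 0 * M 6 + L 2 * M 0 * L 6 + L 3 * L 0 * L 6 + L 0 * M 2 * M 2 + L 1 * L 2 * M 2 + L 2 * M 2 * L 2 + L 3 * L 2 * L 2 + L 4 * M 4 * M 4 + L 5 * L 4 * M 4 + L 6 * M 4 * L 4 + L 7 * L 4 * L 4 + L 4 * M 6 * M 0 + L 5 * L 6 * M 0 + L 6 * M 6 * L 0 + L 7 * L 6 * L 0

noncomputable def f84 : MvPolynomial (Fin 16) ℚ := L 0 * M 0 * M 7 + L 1 * L 0 * M 7 + L 2 * M 0 * L 7 + L 3 * L 0 * L 7 + L 0 * M 2 * M 3 + L 1 * L 2 * M 3 + L 2 * M 2 * L 3 + L 3 * L 2 * L 3 + L 4 * M 5 * M 4 + L 5 * L 5 * M 4 + L 6 * M 5 * L 4 + L 7 * L 5 * L 4 + L 4 * M 7 * M 0 + L 5 * L 7 * M 0 + L 6 * M 7 * L 0 + L 7 * L 7 * L 0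

noncomputable def f85 : MvPolynomial (Fin 16) ℚ := L 0 * M 1 * M 4 + L 1 * L 1 * M 4 + L 2 * M 1 * L 4 + L 3 * L 1 * L 4 + L 0 * M 3 * M 0 + L 1 * L 3 * M 0 + L 2 * M 3 * L 0 + L 3 * L 3 * L 0 + L 4 * M 4 * M 7 + L 5 * L 4 * M 7 + L 6 * M 4 * L 7 + L 7 * L 4 * L 7 + L 4 * M 6 * M 3 + L 5 * L 6 * M 3 + L 6 * M 6 * L 3 + L 7 * L 6 * L 3

noncomputable def f86 : MvPolynomial (Fin 16) ℚ := L 0 * M 1 * M 5 + L 1 * L 1 * M 5 + L 2 * M 1 * L 5 + L 3 * L 1 * L 5 + L 0 * M 3 * M 1 + L 1 * L 3 * M 1 + L 2 * M 3 * L 1 + L 3 * L 3 * L 1 + L 4 * M 5 * M 7 + L 5 * L 5 * M 7 + L 6 * M 5 * L 7 + L 7 * L 5 * L 7 + L 4 * M 7 * M 3 + L 5 * L 7 * M 3 + L 6 * M 7 * L 3 + L 7 * L 7 * L 3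

noncomputable def f87 : MvPolynomial (Fin 16) ℚ := L 0 * M 1 * M 6 + L 1 * L 1 * M 6 + L 2 * M 1 * L 6 + L 3 * L 1 * L 6 + L 0 * M 3 * M 2 + L 1 * L 3 * M 2 + L 2 * M 3 * L 2 + L 3 * L 3 * L 2 + L 4 * M 4 * M 5 + L 5 * L 4 * M 5 + L 6 * M 4 * L 5 + L 7 * L 4 * L 5 + L 4 * M 6 * M 1 + L 5 * L 6 * M 1 + L 6 * M 6 * L 1 + L 7 * L 6 * L 1

noncomputable def f88 : MvPolynomial (Fin 16) ℚ := L 0 * M 1 * M 7 + L 1 * L 1 * M 7 + L 2 * M 1 * L 7 + L 3 * L 1 * L 7 + L 0 * M 3 * M 3 + L 1 * L 3 * M 3 + L 2 * M 3 * L 3 + L 3 * L 3 * L 3 + L 4 * M 5 * M 5 + L 5 * L 5 * M 5 + L 6 * M 5 * L 5 + L 7 * L 5 * L 5 + L 4 * M 7 * M 1 + L 5 * L 7 * M 1 + L 6 * M 7 * L 1 + L 7 * L 7 * L 1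

noncomputable def f89 : MvPolynomial (Fin 16) ℚ := L 0 * M 4 * M 4 + L 1 * L 4 * M 4 + L 2 * M 4 * L 4 + L 3 * L 4 * L 4 + L 0 * M 6 * M 0 + L 1 * L 6 * M 0 + L 2 * M 6 * L 0 + L 3 * L 6 * L 0 + L 4 * M 0 * M 6 + L 5 * L 0 * M 6 + L 6 * M 0 * L 6 + L 7 * L 0 * L 6 + L 4 * M 2 * M 2 + L 5 * L 2 * M 2 + L 6 * M 2 * L 2 + L 7 * L 2 * L 2

noncomputable def f90 : MvPolynomial (Fin 16) ℚ := L 0 * M 4 * M 5 + L 1 * L 4 * M 5 + L 2 * M 4 * L 5 + L 3 * L 4 * L 5 + L 0 * M 6 * M 1 + L 1 * L 6 * M 1 + L 2 * M 6 * L 1 + L 3 * L 6 * L 1 + L 4 * M 1 * M 6 + L 5 * L 1 * M 6 + L 6 * M 1 * L 6 + L 7 * L 1 * L 6 + L 4 * M 3 * M 2 + L 5 * L 3 * M 2 + L 6 * M 3 * L 2 + L 7 * L 3 * L 2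

noncomputable def f91 : MvPolynomial (Fin 16) ℚ := L 0 * M 4 * M 6 + L 1 * L 4 * M 6 + L 2 * M 4 * L 6 + L 3 * L 4 * L 6 + L 0 * M 6 * M 2 + L 1 * L 6 * M 2 + L 2 * M 6 * L 2 + L 3 * L 6 * L 2 + L 4 * M 0 * M 4 + L 5 * L 0 * M 4 + L 6 * M 0 * L 4 + L 7 * L 0 * L 4 + L 4 * M 2 * M 0 + L 5 * L 2 * M 0 + L 6 * M 2 * L 0 + L 7 * L 2 * L 0

noncomputable def f92 : MvPolynomial (Fin 16) ℚ := L 0 * M 4 * M 7 + L 1 * L 4 * M 7 + L 2 * M 4 * L 7 + L 3 * L 4 * L 7 + L 0 * M 6 * M 3 + L 1 * L 6 * M 3 + L 2 * M 6 * L 3 + L 3 * L 6 * L 3 + L 4 * M 1 * M 4 + L 5 * L 1 * M 4 + L 6 * M 1 * L 4 + L 7 * L 1 * L 4 + L 4 * M 3 * M 0 + L 5 * L 3 * M 0 + L 6 * M 3 * L 0 + L 7 * L 3 * L 0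

noncomputable def f93 : MvPolynomial (Fin 16) ℚ := L 0 * M 5 * M 4 + L 1 * L 5 * M 4 + L 2 * M 5 * L 4 + L 3 * L 5 * L 4 + L 0 * M 7 * M 0 + L 1 * L 7 * M 0 + L 2 * M 7 * L 0 + L 3 * L 7 * L 0 + L 4 * M 0 * M 7 + L 5 * L 0 * M 7 + L 6 * M 0 * L 7 + L 7 * L 0 * L 7 + L 4 * M 2 * M 3 + L 5 * L 2 * M 3 + L 6 * M 2 * L 3 + L 7 * L 2 * L 3

noncomputable def f94 : MvPolynomial (Fin 16) ℚ := L 0 * M 5 * M 5 + L 1 * L 5 * M 5 + L 2 * M 5 * L 5 + L 3 * L 5 * L 5 + L 0 * M 7 * M 1 + L 1 * L 7 * M 1 + L 2 * M 7 * L 1 + L 3 * L 7 * L 1 + L 4 * M 1 * M 7 + L 5 * L 1 * M 7 + L 6 * M 1 * L 7 + L 7 * L 1 * L 7 + L 4 * M 3 * M 3 + L 5 * L 3 * M 3 + L 6 * M 3 * L 3 + L 7 * L 3 * L 3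

noncomputable def f95 : MvPolynomial (Fin 16) ℚ := L 0 * M 5 * M 6 + L 1 * L 5 * M 6 + L 2 * M 5 * L 6 + L 3 * L 5 * L 6 + L 0 * M 7 * M 2 + L 1 * L 7 * M 2 + L 2 * M 7 * L 2 + L 3 * L 7 * L 2 + L 4 * M 0 * M 5 + L 5 * L 0 * M 5 + L 6 * M 0 * L 5 + L 7 * L 0 * L 5 + L 4 * M 2 * M 1 + L 5 * L 2 * M 1 + L 6 * M 2 * L 1 + L 7 * L 2 * L 1

noncomputable def f96 : MvPolynomial (Fin 16) ℚ := L 0 * M 5 * M 7 + L 1 * L 5 * M 7 + L 2 * M 5 * L 7 + L 3 * L 5 * L 7 + L 0 * M 7 * M 3 + L 1 * L 7 * M 3 + L 2 * M 7 * L 3 + L 3 * L 7 * L 3 + L 4 * M 1 * M 5 + L 5 * L 1 * M 5 + L 6 * M 1 * L 5 + L 7 * L 1 * L 5 + L 4 * M 3 * M 1 + L 5 * L 3 * M 1 + L 6 * M 3 * L 1 + L 7 * L 3 * L 1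

noncomputable def f97 : MvPolynomial (Fin 16) ℚ := -M 0 * M 0 - M 1 * L 0 + L 0 * M 1 * M 1 + L 1 * L 1 * M 1 + L 2 * M 1 * L 1 + L 3 * L 1 * L 1 + L 0 * M 3 * M 5 + L 1 * L 3 * M 5 + L 2 * M 3 * L 5 + L 3 * L 3 * L 5

noncomputable def f98 : MvPolynomial (Fin 16) ℚ := -M 0 * M 1 - M 1 * L 1 + L 0 * M 0 * M 1 + L 1 * L 0 * M 1 + L 2 * M 0 * L 1 + L 3 * L 0 * L 1 + L 0 * M 2 * M 5 + L 1 * L 2 * M 5 + L 2 * M 2 * L 5 + L 3 * L 2 * L 5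

noncomputable def f99 : MvPolynomial (Fin 16) ℚ := -M 0 * M 2 - M 1 * L 2 + L 0 * M 1 * M 0 + L 1 * L 1 * M 0 + L 2 * M 1 * L 0 + L 3 * L 1 * L 0 + L 0 * M 3 * M 4 + L 1 * L 3 * M 4 + L 2 * M 3 * L 4 + L 3 * L 3 * L 4

noncomputable def f100 : MvPolynomial (Fin 16) ℚ := -M 0 * M 3 - M 1 * L 3 + L 0 * M 0 * M 0 + L 1 * L 0 * M 0 + L 2 * M 0 * L 0 + L 3 * L 0 * L 0 + L 0 * M 2 * M 4 + L 1 * L 2 * M 4 + L 2 * M 2 * L 4 + L 3 * L 2 * L 4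

noncomputable def f101 : MvPolynomial (Fin 16) ℚ := -M 0 * M 4 - M 1 * L 4 + L 4 * M 1 * M 1 + L 5 * L 1 * M 1 + L 6 * M 1 * L 1 + L 7 * L 1 * L 1 + L 4 * M 3 * M 5 + L 5 * L 3 * M 5 + L 6 * M 3 * L 5 + L 7 * L 3 * L 5

noncomputable def f102 : MvPolynomial (Fin 16) ℚ := -M 0 * M 5 - M 1 * L 5 + L 4 * M 0 * M 1 + L 5 * L 0 * M 1 + L 6 * M 0 * L 1 + L 7 * L 0 * L 1 + L 4 * M 2 * M 5 + L 5 * L 2 * M 5 + L 6 * M 2 * L 5 + L 7 * L 2 * L 5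

noncomputable def f103 : MvPolynomial (Fin 16) ℚ := -M 0 * M 6 - M 1 * L 6 + L 4 * M 1 * M 0 + L 5 * L 1 * M 0 + L 6 * M 1 * L 0 + L 7 * L 1 * L 0 + L 4 * M 3 * M 4 + L 5 * L 3 * M 4 + L 6 * M 3 * L 4 + L 7 * L 3 * L 4

noncomputable def f104 : MvPolynomial (Fin 16) ℚ := -M 0 * M 7 - M 1 * L 7 + L 4 * M 0 * M 0 + L 5 * L 0 * M 0 + L 6 * M 0 * L 0 + L 7 * L 0 * L 0 + L 4 * M 2 * M 4 + L 5 * L 2 * M 4 + L 6 * M 2 * L 4 + L 7 * L 2 * L 4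

noncomputable def f105 : MvPolynomial (Fin 16) ℚ := -M 2 * M 0 - M 3 * L 0 + L 0 * M 1 * M 3 + L 1 * L 1 * M 3 + L 2 * M 1 * L 3 + L 3 * L 1 * L 3 + L 0 * M 3 * M 7 + L 1 * L 3 * M 7 + L 2 * M 3 * L 7 + L 3 * L 3 * L 7

noncomputable def f106 : MvPolynomial (Fin 16) ℚ := -M 2 * M 1 - M 3 * L 1 + L 0 * M 0 * M 3 + L 1 * L 0 * M 3 + L 2 * M 0 * L 3 + L 3 * L 0 * L 3 + L 0 * M 2 * M 7 + L 1 * L 2 * M 7 + L 2 * M 2 * L 7 + L 3 * L 2 * L 7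

noncomputable def f107 : MvPolynomial (Fin 16) ℚ := -M 2 * M 2 - M 3 * L 2 + L 0 * M 1 * M 2 + L 1 * L 1 * M 2 + L 2 * M 1 * L 2 + L 3 * L 1 * L 2 + L 0 * M 3 * M 6 + L 1 * L 3 * M 6 + L 2 * M 3 * L 6 + L 3 * L 3 * L 6

noncomputable def f108 : MvPolynomial (Fin 16) ℚ := -M 2 * M 3 - M 3 * L 3 + L 0 * M 0 * M 2 + L 1 * L 0 * M 2 + L 2 * M 0 * L 2 + L 3 * L 0 * L 2 + L 0 * M 2 * M 6 + L 1 * L 2 * M 6 + L 2 * M 2 * L 6 + L 3 * L 2 * L 6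

noncomputable def f109 : MvPolynomial (Fin 16) ℚ := -M 2 * M 4 - M 3 * L 4 + L 4 * M 1 * M 3 + L 5 * L 1 * M 3 + L 6 * M 1 * L 3 + L 7 * L 1 * L 3 + L 4 * M 3 * M 7 + L 5 * L 3 * M 7 + L 6 * M 3 * L 7 + L 7 * L 3 * L 7

noncomputable def f110 : MvPolynomial (Fin 16) ℚ := -M 2 * M 5 - M 3 * L 5 + L 4 * M 0 * M 3 + L 5 * L 0 * M 3 + L 6 * M 0 * L 3 + L 7 * L 0 * L 3 + L 4 * M 2 * M 7 + L 5 * L 2 * M 7 + L 6 * M 2 * L 7 + L 7 * L 2 * L 7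

noncomputable def f111 : MvPolynomial (Fin 16) ℚ := -M 2 * M 6 - M 3 * L 6 + L 4 * M 1 * M 2 + L 5 * L 1 * M 2 + L 6 * M 1 * L 2 + L 7 * L 1 * L 2 + L 4 * M 3 * M 6 + L 5 * L 3 * M 6 + L 6 * M 3 * L 6 + L 7 * L 3 * L 6

noncomputable def f112 : MvPolynomial (Fin 16) ℚ := -M 2 * M 7 - M 3 * L 7 + L 4 * M 0 * M 2 + L 5 * L 0 * M 2 + L 6 * M 0 * L 2 + L 7 * L 0 * L 2 + L 4 * M 2 * M 6 + L 5 * L 2 * M 6 + L 6 * M 2 * L 6 + L 7 * L 2 * L 6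

noncomputable def f113 : MvPolynomial (Fin 16) ℚ := -M 4 * M 0 - M 5 * L 0 + L 0 * M 5 * M 1 + L 1 * L 5 * M 1 + L 2 * M 5 * L 1 + L 3 * L 5 * L 1 + L 0 * M 7 * M 5 + L 1 * L 7 * M 5 + L 2 * M 7 * L 5 + L 3 * L 7 * L 5

noncomputable def f114 : MvPolynomial (Fin 16) ℚ := -M 4 * M 1 - M 5 * L 1 + L 0 * M 4 * M 1 + L 1 * L 4 * M 1 + L 2 * M 4 * L 1 + L 3 * L 4 * L 1 + L 0 * M 6 * M 5 + L 1 * L 6 * M 5 + L 2 * M 6 * L 5 + L 3 * L 6 * L 5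

noncomputable def f115 : MvPolynomial (Fin 16) ℚ := -M 4 * M 2 - M 5 * L 2 + L 0 * M 5 * M 0 + L 1 * L 5 * M 0 + L 2 * M 5 * L 0 + L 3 * L 5 * L 0 + L 0 * M 7 * M 4 + L 1 * L 7 * M 4 + L 2 * M 7 * L 4 + L 3 * L 7 * L 4

noncomputable def f116 : MvPolynomial (Fin 16) ℚ := -M 4 * M 3 - M 5 * L 3 + L 0 * M 4 * M 0 + L 1 * L 4 * M 0 + L 2 * M 4 * L 0 + L 3 * L 4 * L 0 + L 0 * M 6 * M 4 + L 1 * L 6 * M 4 + L 2 * M 6 * L 4 + L 3 * L 6 * L 4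

noncomputable def f117 : MvPolynomial (Fin 16) ℚ := -M 4 * M 4 - M 5 * L 4 + L 4 * M 5 * M 1 + L 5 * L 5 * M 1 + L 6 * M 5 * L 1 + L 7 * L 5 * L 1 + L 4 * M 7 * M 5 + L 5 * L 7 * M 5 + L 6 * M 7 * L 5 + L 7 * L 7 * L 5

noncomputable def f118 : MvPolynomial (Fin 16) ℚ := -M 4 * M 5 - M 5 * L 5 + L 4 * M 4 * M 1 + L 5 * L 4 * M 1 + L 6 * M 4 * L 1 + L 7 * L 4 * L 1 + L 4 * M 6 * M 5 + L 5 * L 6 * M 5 + L 6 * M 6 * L 5 + L 7 * L 6 * L 5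

noncomputable def f119 : MvPolynomial (Fin 16) ℚ := -M 4 * M 6 - M 5 * L 6 + L 4 * M 5 * M 0 + L 5 * L 5 * M 0 + L 6 * M 5 * L 0 + L 7 * L 5 * L 0 + L 4 * M 7 * M 4 + L 5 * L 7 * M 4 + L 6 * M 7 * L 4 + L 7 * L 7 * L 4

noncomputable def f120 : MvPolynomial (Fin 16) ℚ := -M 4 * M 7 - M 5 * L 7 + L 4 * M 4 * M 0 + L 5 * L 4 * M 0 + L 6 * M 4 * L 0 + L 7 * L 4 * L 0 + L 4 * M 6 * M 4 + L 5 * L 6 * M 4 + L 6 * M 6 * L 4 + L 7 * L 6 * L 4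

noncomputable def f121 : MvPolynomial (Fin 16) ℚ := -M 6 * M 0 - M 7 * L 0 + L 0 * M 5 * M 3 + L 1 * L 5 * M 3 + L 2 * M 5 * L 3 + L 3 * L 5 * L 3 + L 0 * M 7 * M 7 + L 1 * L 7 * M 7 + L 2 * M 7 * L 7 + L 3 * L 7 * L 7

noncomputable def f122 : MvPolynomial (Fin 16) ℚ := -M 6 * M 1 - M 7 * L 1 + L 0 * M 4 * M 3 + L 1 * L 4 * M 3 + L 2 * M 4 * L 3 + L 3 * L 4 * L 3 + L 0 * M 6 * M 7 + L 1 * L 6 * M 7 + L 2 * M 6 * L 7 + L 3 * L 6 * L 7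

noncomputable def f123 : MvPolynomial (Fin 16) ℚ := -M 6 * M 2 - M 7 * L 2 + L 0 * M 5 * M 2 + L 1 * L 5 * M 2 + L 2 * M 5 * L 2 + L 3 * L 5 * L 2 + L 0 * M 7 * M 6 + L 1 * L 7 * M 6 + L 2 * M 7 * L 6 + L 3 * L 7 * L 6

noncomputable def f124 : MvPolynomial (Fin 16) ℚ := -M 6 * M 3 - M 7 * L 3 + L 0 * M 4 * M 2 + L 1 * L 4 * M 2 + L 2 * M 4 * L 2 + L 3 * L 4 * L 2 + L 0 * M 6 * M 6 + L 1 * L 6 * M 6 + L 2 * M 6 * L 6 + L 3 * L 6 * L 6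

noncomputable def f125 : MvPolynomial (Fin 16) ℚ := -M 6 * M 4 - M 7 * L 4 + L 4 * M 5 * M 3 + L 5 * L 5 * M 3 + L 6 * M 5 * L 3 + L 7 * L 5 * L 3 + L 4 * M 7 * M 7 + L 5 * L 7 * M 7 + L 6 * M 7 * L 7 + L 7 * L 7 * L 7

noncomputable def f126 : MvPolynomial (Fin 16) ℚ := -M 6 * M 5 - M 7 * L 5 + L 4 * M 4 * M 3 + L 5 * L 4 * M 3 + L 6 * M 4 * L 3 + L 7 * L 4 * L 3 + L 4 * M 6 * M 7 + L 5 * L 6 * M 7 + L 6 * M 6 * L 7 + L 7 * L 6 * L 7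

noncomputable def f127 : MvPolynomial (Fin 16) ℚ := -M 6 * M 6 - M 7 * L 6 + L 4 * M 5 * M 2 + L 5 * L 5 * M 2 + L 6 * M 5 * L 2 + L 7 * L 5 * L 2 + L 4 * M 7 * M 6 + L 5 * L 7 * M 6 + L 6 * M 7 * L 6 + L 7 * L 7 * L 6

noncomputable def f128 : MvPolynomial (Fin 16) ℚ := -M 6 * M 7 - M 7 * L 7 + L 4 * M 4 * M 2 + L 5 * L 4 * M 2 + L 6 * M 4 * L 2 + L 7 * L 4 * L 2 + L 4 * M 6 * M 6 + L 5 * L 6 * M 6 + L 6 * M 6 * L 6 + L 7 * L 6 * L 6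

noncomputable def f : Fin 128 → MvPolynomial (Fin 16) ℚ :=
  ![f1, f2, f3, f4, f5, f6, f7, f8, f9, f10, f11, f12, f13, f14, f15, f16, f17, f18, f19, f20, f21, f22, f23, f24, f25, f26, f27, f28, f29, f30, f31, f32, f33, f34, f35, f36, f37, f38, f39, f40, f41, f42, f43, f44, f45, f46, f47, f48, f49, f50, f51, f52, f53, f54, f55, f56, f57, f58, f59, f60, f61, f62, f63, f64, f65, f66, f67, f68, f69, f70, f71, f72, f73, f74, f75, f76, f77, f78, f79, f80, f81, f82, f83, f84, f85, f86, f87, f88, f89, f90, f91, f92, f93, f94, f95, f96, f97, f98, f99, f100, f101, f102, f103, f104, f105, f106, f107, f108, f109, f110, f111, f112, f113, f114, f115, f116, f117, f118, f119, f120, f121, f122, f123, f124, f125, f126, f127, f128]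

set_option linter.all false
set_option maxHeartbeats 4000000

/-- A common zero of the 128 polynomials, with the unknowns arranged as a 4 by 4 matrix. -/
structure Sol (K : Type) where
  (p11 p12 p13 p14 : K)
  (p21 p22 p23 p24 : K)
  (p31 p32 p33 p34 : K)
  (p41 p42 p43 p44 : K)

/-- The 128 equations. -/
structure Sol.Is {K : Type} [Field K] (s : Sol K) : Prop where
  e1 : s.p11 * s.p11 + s.p12 * s.p21 + s.p13 * s.p31 + s.p14 * s.p41 - 1 = 0
  e2 : s.p11 * s.p12 + s.p12 * s.p22 + s.p13 * s.p32 + s.p14 * s.p42 = 0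
  e3 : s.p11 * s.p13 + s.p12 * s.p23 + s.p13 * s.p33 + s.p14 * s.p43 = 0
  e4 : s.p11 * s.p14 + s.p12 * s.p24 + s.p13 * s.p34 + s.p14 * s.p44 = 0
  e5 : s.p11 * s.p21 + s.p12 * s.p11 + s.p13 * s.p41 + s.p14 * s.p31 + s.p22 = 0
  e6 : s.p11 * s.p22 + s.p12 * s.p12 + s.p13 * s.p42 + s.p14 * s.p32 + s.p21 = 0
  e7 : s.p11 * s.p23 + s.p12 * s.p13 + s.p13 * s.p43 + s.p14 * s.p33 + s.p24 = 0
  e8 : s.p11 * s.p24 + s.p12 * s.p14 + s.p13 * s.p44 + s.p14 * s.p34 + s.p23 = 0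
  e9 : s.p21 * s.p11 + s.p22 * s.p21 + s.p23 * s.p31 + s.p24 * s.p41 = 0
  e10 : s.p21 * s.p12 + s.p22 * s.p22 + s.p23 * s.p32 + s.p24 * s.p42 - 1 = 0
  e11 : s.p21 * s.p13 + s.p22 * s.p23 + s.p23 * s.p33 + s.p24 * s.p43 = 0
  e12 : s.p21 * s.p14 + s.p22 * s.p24 + s.p23 * s.p34 + s.p24 * s.p44 = 0
  e13 : s.p21 * s.p21 + s.p22 * s.p11 + s.p23 * s.p41 + s.p24 * s.p31 + s.p12 = 0
  e14 : s.p21 * s.p22 + s.p22 * s.p12 + s.p23 * s.p42 + s.p24 * s.p32 + s.p11 = 0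
  e15 : s.p21 * s.p23 + s.p22 * s.p13 + s.p23 * s.p43 + s.p24 * s.p33 + s.p14 = 0
  e16 : s.p21 * s.p24 + s.p22 * s.p14 + s.p23 * s.p44 + s.p24 * s.p34 + s.p13 = 0
  e17 : s.p31 * s.p11 + s.p32 * s.p21 + s.p33 * s.p31 + s.p34 * s.p41 = 0
  e18 : s.p31 * s.p12 + s.p32 * s.p22 + s.p33 * s.p32 + s.p34 * s.p42 = 0
  e19 : s.p31 * s.p13 + s.p32 * s.p23 + s.p33 * s.p33 + s.p34 * s.p43 - 1 = 0
  e20 : s.p31 * s.p14 + s.p32 * s.p24 + s.p33 * s.p34 + s.p34 * s.p44 = 0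
  e21 : s.p31 * s.p21 + s.p32 * s.p11 + s.p33 * s.p41 + s.p34 * s.p31 + s.p42 = 0
  e22 : s.p31 * s.p22 + s.p32 * s.p12 + s.p33 * s.p42 + s.p34 * s.p32 + s.p41 = 0
  e23 : s.p31 * s.p23 + s.p32 * s.p13 + s.p33 * s.p43 + s.p34 * s.p33 + s.p44 = 0
  e24 : s.p31 * s.p24 + s.p32 * s.p14 + s.p33 * s.p44 + s.p34 * s.p34 + s.p43 = 0
  e25 : s.p41 * s.p11 + s.p42 * s.p21 + s.p43 * s.p31 + s.p44 * s.p41 = 0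
  e26 : s.p41 * s.p12 + s.p42 * s.p22 + s.p43 * s.p32 + s.p44 * s.p42 = 0
  e27 : s.p41 * s.p13 + s.p42 * s.p23 + s.p43 * s.p33 + s.p44 * s.p43 = 0
  e28 : s.p41 * s.p14 + s.p42 * s.p24 + s.p43 * s.p34 + s.p44 * s.p44 - 1 = 0
  e29 : s.p41 * s.p21 + s.p42 * s.p11 + s.p43 * s.p41 + s.p44 * s.p31 + s.p32 = 0
  e30 : s.p41 * s.p22 + s.p42 * s.p12 + s.p43 * s.p42 + s.p44 * s.p32 + s.p31 = 0
  e31 : s.p41 * s.p23 + s.p42 * s.p13 + s.p43 * s.p43 + s.p44 * s.p33 + s.p34 = 0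
  e32 : s.p41 * s.p24 + s.p42 * s.p14 + s.p43 * s.p44 + s.p44 * s.p34 + s.p33 = 0
  e33 : s.p21 * s.p21 * s.p11 + s.p22 * s.p41 * s.p11 + s.p23 * s.p21 * s.p31 + s.p24 * s.p41 * s.p31 + s.p21 * s.p23 * s.p21 + s.p22 * s.p43 * s.p21 + s.p23 * s.p23 * s.p41 + s.p24 * s.p43 * s.p41 + s.p11 * s.p11 * s.p13 + s.p12 * s.p31 * s.p13 + s.p13 * s.p11 * s.p33 + s.p14 * s.p31 * s.p33 + s.p11 * s.p13 * s.p23 + s.p12 * s.p33 * s.p23 + s.p13 * s.p13 * s.p43 + s.p14 * s.p33 * s.p43 = 0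
  e34 : s.p21 * s.p21 * s.p12 + s.p22 * s.p41 * s.p12 + s.p23 * s.p21 * s.p32 + s.p24 * s.p41 * s.p32 + s.p21 * s.p23 * s.p22 + s.p22 * s.p43 * s.p22 + s.p23 * s.p23 * s.p42 + s.p24 * s.p43 * s.p42 + s.p11 * s.p12 * s.p13 + s.p12 * s.p32 * s.p13 + s.p13 * s.p12 * s.p33 + s.p14 * s.p32 * s.p33 + s.p11 * s.p14 * s.p23 + s.p12 * s.p34 * s.p23 + s.p13 * s.p14 * s.p43 + s.p14 * s.p34 * s.p43 = 0
  e35 : s.p21 * s.p21 * s.p13 + s.p22 * s.p41 * s.p13 + s.p23 * s.p21 * s.p33 + s.p24 * s.p41 * s.p33 + s.p21 * s.p23 * s.p23 + s.p22 * s.p43 * s.p23 + s.p23 * s.p23 * s.p43 + s.p24 * s.p43 * s.p43 + s.p11 * s.p11 * s.p11 + s.p12 * s.p31 * s.p11 + s.p13 * s.p11 * s.p31 + s.p14 * s.p31 * s.p31 + s.p11 * s.p13 * s.p21 + s.p12 * s.p33 * s.p21 + s.p13 * s.p13 * s.p41 + s.p14 * s.p33 * s.p41 = 0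
  e36 : s.p21 * s.p21 * s.p14 + s.p22 * s.p41 * s.p14 + s.p23 * s.p21 * s.p34 + s.p24 * s.p41 * s.p34 + s.p21 * s.p23 * s.p24 + s.p22 * s.p43 * s.p24 + s.p23 * s.p23 * s.p44 + s.p24 * s.p43 * s.p44 + s.p11 * s.p12 * s.p11 + s.p12 * s.p32 * s.p11 + s.p13 * s.p12 * s.p31 + s.p14 * s.p32 * s.p31 + s.p11 * s.p14 * s.p21 + s.p12 * s.p34 * s.p21 + s.p13 * s.p14 * s.p41 + s.p14 * s.p34 * s.p41 = 0
  e37 : s.p21 * s.p22 * s.p11 + s.p22 * s.p42 * s.p11 + s.p23 * s.p22 * s.p31 + s.p24 * s.p42 * s.p31 + s.p21 * s.p24 * s.p21 + s.p22 * s.p44 * s.p21 + s.p23 * s.p24 * s.p41 + s.p24 * s.p44 * s.p41 + s.p11 * s.p11 * s.p14 + s.p12 * s.p31 * s.p14 + s.p13 * s.p11 * s.p34 + s.p14 * s.p31 * s.p34 + s.p11 * s.p13 * s.p24 + s.p12 * s.p33 * s.p24 + s.p13 * s.p13 * s.p44 + s.p14 * s.p33 * s.p44 = 0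
  e38 : s.p21 * s.p22 * s.p12 + s.p22 * s.p42 * s.p12 + s.p23 * s.p22 * s.p32 + s.p24 * s.p42 * s.p32 + s.p21 * s.p24 * s.p22 + s.p22 * s.p44 * s.p22 + s.p23 * s.p24 * s.p42 + s.p24 * s.p44 * s.p42 + s.p11 * s.p12 * s.p14 + s.p12 * s.p32 * s.p14 + s.p13 * s.p12 * s.p34 + s.p14 * s.p32 * s.p34 + s.p11 * s.p14 * s.p24 + s.p12 * s.p34 * s.p24 + s.p13 * s.p14 * s.p44 + s.p14 * s.p34 * s.p44 = 0
  e39 : s.p21 * s.p22 * s.p13 + s.p22 * s.p42 * s.p13 + s.p23 * s.p22 * s.p33 + s.p24 * s.p42 * s.p33 + s.p21 * s.p24 * s.p23 + s.p22 * s.p44 * s.p23 + s.p23 * s.p24 * s.p43 + s.p24 * s.p44 * s.p43 + s.p11 * s.p11 * s.p12 + s.p12 * s.p31 * s.p12 + s.p13 * s.p11 * s.p32 + s.p14 * s.p31 * s.p32 + s.p11 * s.p13 * s.p22 + s.p12 * s.p33 * s.p22 + s.p13 * s.p13 * s.p42 + s.p14 * s.p33 * s.p42 = 0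
  e40 : s.p21 * s.p22 * s.p14 + s.p22 * s.p42 * s.p14 + s.p23 * s.p22 * s.p34 + s.p24 * s.p42 * s.p34 + s.p21 * s.p24 * s.p24 + s.p22 * s.p44 * s.p24 + s.p23 * s.p24 * s.p44 + s.p24 * s.p44 * s.p44 + s.p11 * s.p12 * s.p12 + s.p12 * s.p32 * s.p12 + s.p13 * s.p12 * s.p32 + s.p14 * s.p32 * s.p32 + s.p11 * s.p14 * s.p22 + s.p12 * s.p34 * s.p22 + s.p13 * s.p14 * s.p42 + s.p14 * s.p34 * s.p42 = 0
  e41 : s.p21 * s.p11 * s.p11 + s.p22 * s.p31 * s.p11 + s.p23 * s.p11 * s.p31 + s.p24 * s.p31 * s.p31 + s.p21 * s.p13 * s.p21 + s.p22 * s.p33 * s.p21 + s.p23 * s.p13 * s.p41 + s.p24 * s.p33 * s.p41 + s.p11 * s.p21 * s.p13 + s.p12 * s.p41 * s.p13 + s.p13 * s.p21 * s.p33 + s.p14 * s.p41 * s.p33 + s.p11 * s.p23 * s.p23 + s.p12 * s.p43 * s.p23 + s.p13 * s.p23 * s.p43 + s.p14 * s.p43 * s.p43 = 0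
  e42 : s.p21 * s.p11 * s.p12 + s.p22 * s.p31 * s.p12 + s.p23 * s.p11 * s.p32 + s.p24 * s.p31 * s.p32 + s.p21 * s.p13 * s.p22 + s.p22 * s.p33 * s.p22 + s.p23 * s.p13 * s.p42 + s.p24 * s.p33 * s.p42 + s.p11 * s.p22 * s.p13 + s.p12 * s.p42 * s.p13 + s.p13 * s.p22 * s.p33 + s.p14 * s.p42 * s.p33 + s.p11 * s.p24 * s.p23 + s.p12 * s.p44 * s.p23 + s.p13 * s.p24 * s.p43 + s.p14 * s.p44 * s.p43 = 0
  e43 : s.p21 * s.p11 * s.p13 + s.p22 * s.p31 * s.p13 + s.p23 * s.p11 * s.p33 + s.p24 * s.p31 * s.p33 + s.p21 * s.p13 * s.p23 + s.p22 * s.p33 * s.p23 + s.p23 * s.p13 * s.p43 + s.p24 * s.p33 * s.p43 + s.p11 * s.p21 * s.p11 + s.p12 * s.p41 * s.p11 + s.p13 * s.p21 * s.p31 + s.p14 * s.p41 * s.p31 + s.p11 * s.p23 * s.p21 + s.p12 * s.p43 * s.p21 + s.p13 * s.p23 * s.p41 + s.p14 * s.p43 * s.p41 = 0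
  e44 : s.p21 * s.p11 * s.p14 + s.p22 * s.p31 * s.p14 + s.p23 * s.p11 * s.p34 + s.p24 * s.p31 * s.p34 + s.p21 * s.p13 * s.p24 + s.p22 * s.p33 * s.p24 + s.p23 * s.p13 * s.p44 + s.p24 * s.p33 * s.p44 + s.p11 * s.p22 * s.p11 + s.p12 * s.p42 * s.p11 + s.p13 * s.p22 * s.p31 + s.p14 * s.p42 * s.p31 + s.p11 * s.p24 * s.p21 + s.p12 * s.p44 * s.p21 + s.p13 * s.p24 * s.p41 + s.p14 * s.p44 * s.p41 = 0
  e45 : s.p21 * s.p12 * s.p11 + s.p22 * s.p32 * s.p11 + s.p23 * s.p12 * s.p31 + s.p24 * s.p32 * s.p31 + s.p21 * s.p14 * s.p21 + s.p22 * s.p34 * s.p21 + s.p23 * s.p14 * s.p41 + s.p24 * s.p34 * s.p41 + s.p11 * s.p21 * s.p14 + s.p12 * s.p41 * s.p14 + s.p13 * s.p21 * s.p34 + s.p14 * s.p41 * s.p34 + s.p11 * s.p23 * s.p24 + s.p12 * s.p43 * s.p24 + s.p13 * s.p23 * s.p44 + s.p14 * s.p43 * s.p44 = 0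
  e46 : s.p21 * s.p12 * s.p12 + s.p22 * s.p32 * s.p12 + s.p23 * s.p12 * s.p32 + s.p24 * s.p32 * s.p32 + s.p21 * s.p14 * s.p22 + s.p22 * s.p34 * s.p22 + s.p23 * s.p14 * s.p42 + s.p24 * s.p34 * s.p42 + s.p11 * s.p22 * s.p14 + s.p12 * s.p42 * s.p14 + s.p13 * s.p22 * s.p34 + s.p14 * s.p42 * s.p34 + s.p11 * s.p24 * s.p24 + s.p12 * s.p44 * s.p24 + s.p13 * s.p24 * s.p44 + s.p14 * s.p44 * s.p44 = 0
  e47 : s.p21 * s.p12 * s.p13 + s.p22 * s.p32 * s.p13 + s.p23 * s.p12 * s.p33 + s.p24 * s.p32 * s.p33 + s.p21 * s.p14 * s.p23 + s.p22 * s.p34 * s.p23 + s.p23 * s.p14 * s.p43 + s.p24 * s.p34 * s.p43 + s.p11 * s.p21 * s.p12 + s.p12 * s.p41 * s.p12 + s.p13 * s.p21 * s.p32 + s.p14 * s.p41 * s.p32 + s.p11 * s.p23 * s.p22 + s.p12 * s.p43 * s.p22 + s.p13 * s.p23 * s.p42 + s.p14 * s.p43 * s.p42 = 0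
  e48 : s.p21 * s.p12 * s.p14 + s.p22 * s.p32 * s.p14 + s.p23 * s.p12 * s.p34 + s.p24 * s.p32 * s.p34 + s.p21 * s.p14 * s.p24 + s.p22 * s.p34 * s.p24 + s.p23 * s.p14 * s.p44 + s.p24 * s.p34 * s.p44 + s.p11 * s.p22 * s.p12 + s.p12 * s.p42 * s.p12 + s.p13 * s.p22 * s.p32 + s.p14 * s.p42 * s.p32 + s.p11 * s.p24 * s.p22 + s.p12 * s.p44 * s.p22 + s.p13 * s.p24 * s.p42 + s.p14 * s.p44 * s.p42 = 0
  e49 : -s.p41 * s.p21 - s.p42 * s.p41 + s.p21 * s.p22 * s.p22 + s.p22 * s.p42 * s.p22 + s.p23 * s.p22 * s.p42 + s.p24 * s.p42 * s.p42 + s.p21 * s.p24 * s.p12 + s.p22 * s.p44 * s.p12 + s.p23 * s.p24 * s.p32 + s.p24 * s.p44 * s.p32 = 0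
  e50 : -s.p41 * s.p22 - s.p42 * s.p42 + s.p21 * s.p21 * s.p22 + s.p22 * s.p41 * s.p22 + s.p23 * s.p21 * s.p42 + s.p24 * s.p41 * s.p42 + s.p21 * s.p23 * s.p12 + s.p22 * s.p43 * s.p12 + s.p23 * s.p23 * s.p32 + s.p24 * s.p43 * s.p32 = 0
  e51 : -s.p41 * s.p23 - s.p42 * s.p43 + s.p21 * s.p22 * s.p21 + s.p22 * s.p42 * s.p21 + s.p23 * s.p22 * s.p41 + s.p24 * s.p42 * s.p41 + s.p21 * s.p24 * s.p11 + s.p22 * s.p44 * s.p11 + s.p23 * s.p24 * s.p31 + s.p24 * s.p44 * s.p31 = 0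
  e52 : -s.p41 * s.p24 - s.p42 * s.p44 + s.p21 * s.p21 * s.p21 + s.p22 * s.p41 * s.p21 + s.p23 * s.p21 * s.p41 + s.p24 * s.p41 * s.p41 + s.p21 * s.p23 * s.p11 + s.p22 * s.p43 * s.p11 + s.p23 * s.p23 * s.p31 + s.p24 * s.p43 * s.p31 = 0
  e53 : -s.p41 * s.p11 - s.p42 * s.p31 + s.p11 * s.p22 * s.p22 + s.p12 * s.p42 * s.p22 + s.p13 * s.p22 * s.p42 + s.p14 * s.p42 * s.p42 + s.p11 * s.p24 * s.p12 + s.p12 * s.p44 * s.p12 + s.p13 * s.p24 * s.p32 + s.p14 * s.p44 * s.p32 = 0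
  e54 : -s.p41 * s.p12 - s.p42 * s.p32 + s.p11 * s.p21 * s.p22 + s.p12 * s.p41 * s.p22 + s.p13 * s.p21 * s.p42 + s.p14 * s.p41 * s.p42 + s.p11 * s.p23 * s.p12 + s.p12 * s.p43 * s.p12 + s.p13 * s.p23 * s.p32 + s.p14 * s.p43 * s.p32 = 0
  e55 : -s.p41 * s.p13 - s.p42 * s.p33 + s.p11 * s.p22 * s.p21 + s.p12 * s.p42 * s.p21 + s.p13 * s.p22 * s.p41 + s.p14 * s.p42 * s.p41 + s.p11 * s.p24 * s.p11 + s.p12 * s.p44 * s.p11 + s.p13 * s.p24 * s.p31 + s.p14 * s.p44 * s.p31 = 0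
  e56 : -s.p41 * s.p14 - s.p42 * s.p34 + s.p11 * s.p21 * s.p21 + s.p12 * s.p41 * s.p21 + s.p13 * s.p21 * s.p41 + s.p14 * s.p41 * s.p41 + s.p11 * s.p23 * s.p11 + s.p12 * s.p43 * s.p11 + s.p13 * s.p23 * s.p31 + s.p14 * s.p43 * s.p31 = 0
  e57 : -s.p43 * s.p21 - s.p44 * s.p41 + s.p21 * s.p22 * s.p24 + s.p22 * s.p42 * s.p24 + s.p23 * s.p22 * s.p44 + s.p24 * s.p42 * s.p44 + s.p21 * s.p24 * s.p14 + s.p22 * s.p44 * s.p14 + s.p23 * s.p24 * s.p34 + s.p24 * s.p44 * s.p34 = 0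
  e58 : -s.p43 * s.p22 - s.p44 * s.p42 + s.p21 * s.p21 * s.p24 + s.p22 * s.p41 * s.p24 + s.p23 * s.p21 * s.p44 + s.p24 * s.p41 * s.p44 + s.p21 * s.p23 * s.p14 + s.p22 * s.p43 * s.p14 + s.p23 * s.p23 * s.p34 + s.p24 * s.p43 * s.p34 = 0
  e59 : -s.p43 * s.p23 - s.p44 * s.p43 + s.p21 * s.p22 * s.p23 + s.p22 * s.p42 * s.p23 + s.p23 * s.p22 * s.p43 + s.p24 * s.p42 * s.p43 + s.p21 * s.p24 * s.p13 + s.p22 * s.p44 * s.p13 + s.p23 * s.p24 * s.p33 + s.p24 * s.p44 * s.p33 = 0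
  e60 : -s.p43 * s.p24 - s.p44 * s.p44 + s.p21 * s.p21 * s.p23 + s.p22 * s.p41 * s.p23 + s.p23 * s.p21 * s.p43 + s.p24 * s.p41 * s.p43 + s.p21 * s.p23 * s.p13 + s.p22 * s.p43 * s.p13 + s.p23 * s.p23 * s.p33 + s.p24 * s.p43 * s.p33 = 0
  e61 : -s.p43 * s.p11 - s.p44 * s.p31 + s.p11 * s.p22 * s.p24 + s.p12 * s.p42 * s.p24 + s.p13 * s.p22 * s.p44 + s.p14 * s.p42 * s.p44 + s.p11 * s.p24 * s.p14 + s.p12 * s.p44 * s.p14 + s.p13 * s.p24 * s.p34 + s.p14 * s.p44 * s.p34 = 0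
  e62 : -s.p43 * s.p12 - s.p44 * s.p32 + s.p11 * s.p21 * s.p24 + s.p12 * s.p41 * s.p24 + s.p13 * s.p21 * s.p44 + s.p14 * s.p41 * s.p44 + s.p11 * s.p23 * s.p14 + s.p12 * s.p43 * s.p14 + s.p13 * s.p23 * s.p34 + s.p14 * s.p43 * s.p34 = 0
  e63 : -s.p43 * s.p13 - s.p44 * s.p33 + s.p11 * s.p22 * s.p23 + s.p12 * s.p42 * s.p23 + s.p13 * s.p22 * s.p43 + s.p14 * s.p42 * s.p43 + s.p11 * s.p24 * s.p13 + s.p12 * s.p44 * s.p13 + s.p13 * s.p24 * s.p33 + s.p14 * s.p44 * s.p33 = 0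
  e64 : -s.p43 * s.p14 - s.p44 * s.p34 + s.p11 * s.p21 * s.p23 + s.p12 * s.p41 * s.p23 + s.p13 * s.p21 * s.p43 + s.p14 * s.p41 * s.p43 + s.p11 * s.p23 * s.p13 + s.p12 * s.p43 * s.p13 + s.p13 * s.p23 * s.p33 + s.p14 * s.p43 * s.p33 = 0
  e65 : -s.p31 * s.p21 - s.p32 * s.p41 + s.p21 * s.p12 * s.p22 + s.p22 * s.p32 * s.p22 + s.p23 * s.p12 * s.p42 + s.p24 * s.p32 * s.p42 + s.p21 * s.p14 * s.p12 + s.p22 * s.p34 * s.p12 + s.p23 * s.p14 * s.p32 + s.p24 * s.p34 * s.p32 = 0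
  e66 : -s.p31 * s.p22 - s.p32 * s.p42 + s.p21 * s.p11 * s.p22 + s.p22 * s.p31 * s.p22 + s.p23 * s.p11 * s.p42 + s.p24 * s.p31 * s.p42 + s.p21 * s.p13 * s.p12 + s.p22 * s.p33 * s.p12 + s.p23 * s.p13 * s.p32 + s.p24 * s.p33 * s.p32 = 0
  e67 : -s.p31 * s.p23 - s.p32 * s.p43 + s.p21 * s.p12 * s.p21 + s.p22 * s.p32 * s.p21 + s.p23 * s.p12 * s.p41 + s.p24 * s.p32 * s.p41 + s.p21 * s.p14 * s.p11 + s.p22 * s.p34 * s.p11 + s.p23 * s.p14 * s.p31 + s.p24 * s.p34 * s.p31 = 0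
  e68 : -s.p31 * s.p24 - s.p32 * s.p44 + s.p21 * s.p11 * s.p21 + s.p22 * s.p31 * s.p21 + s.p23 * s.p11 * s.p41 + s.p24 * s.p31 * s.p41 + s.p21 * s.p13 * s.p11 + s.p22 * s.p33 * s.p11 + s.p23 * s.p13 * s.p31 + s.p24 * s.p33 * s.p31 = 0
  e69 : -s.p31 * s.p11 - s.p32 * s.p31 + s.p11 * s.p12 * s.p22 + s.p12 * s.p32 * s.p22 + s.p13 * s.p12 * s.p42 + s.p14 * s.p32 * s.p42 + s.p11 * s.p14 * s.p12 + s.p12 * s.p34 * s.p12 + s.p13 * s.p14 * s.p32 + s.p14 * s.p34 * s.p32 = 0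
  e70 : -s.p31 * s.p12 - s.p32 * s.p32 + s.p11 * s.p11 * s.p22 + s.p12 * s.p31 * s.p22 + s.p13 * s.p11 * s.p42 + s.p14 * s.p31 * s.p42 + s.p11 * s.p13 * s.p12 + s.p12 * s.p33 * s.p12 + s.p13 * s.p13 * s.p32 + s.p14 * s.p33 * s.p32 = 0
  e71 : -s.p31 * s.p13 - s.p32 * s.p33 + s.p11 * s.p12 * s.p21 + s.p12 * s.p32 * s.p21 + s.p13 * s.p12 * s.p41 + s.p14 * s.p32 * s.p41 + s.p11 * s.p14 * s.p11 + s.p12 * s.p34 * s.p11 + s.p13 * s.p14 * s.p31 + s.p14 * s.p34 * s.p31 = 0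
  e72 : -s.p31 * s.p14 - s.p32 * s.p34 + s.p11 * s.p11 * s.p21 + s.p12 * s.p31 * s.p21 + s.p13 * s.p11 * s.p41 + s.p14 * s.p31 * s.p41 + s.p11 * s.p13 * s.p11 + s.p12 * s.p33 * s.p11 + s.p13 * s.p13 * s.p31 + s.p14 * s.p33 * s.p31 = 0
  e73 : -s.p33 * s.p21 - s.p34 * s.p41 + s.p21 * s.p12 * s.p24 + s.p22 * s.p32 * s.p24 + s.p23 * s.p12 * s.p44 + s.p24 * s.p32 * s.p44 + s.p21 * s.p14 * s.p14 + s.p22 * s.p34 * s.p14 + s.p23 * s.p14 * s.p34 + s.p24 * s.p34 * s.p34 = 0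
  e74 : -s.p33 * s.p22 - s.p34 * s.p42 + s.p21 * s.p11 * s.p24 + s.p22 * s.p31 * s.p24 + s.p23 * s.p11 * s.p44 + s.p24 * s.p31 * s.p44 + s.p21 * s.p13 * s.p14 + s.p22 * s.p33 * s.p14 + s.p23 * s.p13 * s.p34 + s.p24 * s.p33 * s.p34 = 0
  e75 : -s.p33 * s.p23 - s.p34 * s.p43 + s.p21 * s.p12 * s.p23 + s.p22 * s.p32 * s.p23 + s.p23 * s.p12 * s.p43 + s.p24 * s.p32 * s.p43 + s.p21 * s.p14 * s.p13 + s.p22 * s.p34 * s.p13 + s.p23 * s.p14 * s.p33 + s.p24 * s.p34 * s.p33 = 0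
  e76 : -s.p33 * s.p24 - s.p34 * s.p44 + s.p21 * s.p11 * s.p23 + s.p22 * s.p31 * s.p23 + s.p23 * s.p11 * s.p43 + s.p24 * s.p31 * s.p43 + s.p21 * s.p13 * s.p13 + s.p22 * s.p33 * s.p13 + s.p23 * s.p13 * s.p33 + s.p24 * s.p33 * s.p33 = 0
  e77 : -s.p33 * s.p11 - s.p34 * s.p31 + s.p11 * s.p12 * s.p24 + s.p12 * s.p32 * s.p24 + s.p13 * s.p12 * s.p44 + s.p14 * s.p32 * s.p44 + s.p11 * s.p14 * s.p14 + s.p12 * s.p34 * s.p14 + s.p13 * s.p14 * s.p34 + s.p14 * s.p34 * s.p34 = 0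
  e78 : -s.p33 * s.p12 - s.p34 * s.p32 + s.p11 * s.p11 * s.p24 + s.p12 * s.p31 * s.p24 + s.p13 * s.p11 * s.p44 + s.p14 * s.p31 * s.p44 + s.p11 * s.p13 * s.p14 + s.p12 * s.p33 * s.p14 + s.p13 * s.p13 * s.p34 + s.p14 * s.p33 * s.p34 = 0
  e79 : -s.p33 * s.p13 - s.p34 * s.p33 + s.p11 * s.p12 * s.p23 + s.p12 * s.p32 * s.p23 + s.p13 * s.p12 * s.p43 + s.p14 * s.p32 * s.p43 + s.p11 * s.p14 * s.p13 + s.p12 * s.p34 * s.p13 + s.p13 * s.p14 * s.p33 + s.p14 * s.p34 * s.p33 = 0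
  e80 : -s.p33 * s.p14 - s.p34 * s.p34 + s.p11 * s.p11 * s.p23 + s.p12 * s.p31 * s.p23 + s.p13 * s.p11 * s.p43 + s.p14 * s.p31 * s.p43 + s.p11 * s.p13 * s.p13 + s.p12 * s.p33 * s.p13 + s.p13 * s.p13 * s.p33 + s.p14 * s.p33 * s.p33 = 0
  e81 : s.p41 * s.p21 * s.p11 + s.p42 * s.p41 * s.p11 + s.p43 * s.p21 * s.p31 + s.p44 * s.p41 * s.p31 + s.p41 * s.p23 * s.p21 + s.p42 * s.p43 * s.p21 + s.p43 * s.p23 * s.p41 + s.p44 * s.p43 * s.p41 + s.p31 * s.p11 * s.p13 + s.p32 * s.p31 * s.p13 + s.p33 * s.p11 * s.p33 + s.p34 * s.p31 * s.p33 + s.p31 * s.p13 * s.p23 + s.p32 * s.p33 * s.p23 + s.p33 * s.p13 * s.p43 + s.p34 * s.p33 * s.p43 = 0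
  e82 : s.p41 * s.p21 * s.p12 + s.p42 * s.p41 * s.p12 + s.p43 * s.p21 * s.p32 + s.p44 * s.p41 * s.p32 + s.p41 * s.p23 * s.p22 + s.p42 * s.p43 * s.p22 + s.p43 * s.p23 * s.p42 + s.p44 * s.p43 * s.p42 + s.p31 * s.p12 * s.p13 + s.p32 * s.p32 * s.p13 + s.p33 * s.p12 * s.p33 + s.p34 * s.p32 * s.p33 + s.p31 * s.p14 * s.p23 + s.p32 * s.p34 * s.p23 + s.p33 * s.p14 * s.p43 + s.p34 * s.p34 * s.p43 = 0
  e83 : s.p41 * s.p21 * s.p13 + s.p42 * s.p41 * s.p13 + s.p43 * s.p21 * s.p33 + s.p44 * s.p41 * s.p33 + s.p41 * s.p23 * s.p23 + s.p42 * s.p43 * s.p23 + s.p43 * s.p23 * s.p43 + s.p44 * s.p43 * s.p43 + s.p31 * s.p11 * s.p11 + s.p32 * s.p31 * s.p11 + s.p33 * s.p11 * s.p31 + s.p34 * s.p31 * s.p31 + s.p31 * s.p13 * s.p21 + s.p32 * s.p33 * s.p21 + s.p33 * s.p13 * s.p41 + s.p34 * s.p33 * s.p41 = 0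
  e84 : s.p41 * s.p21 * s.p14 + s.p42 * s.p41 * s.p14 + s.p43 * s.p21 * s.p34 + s.p44 * s.p41 * s.p34 + s.p41 * s.p23 * s.p24 + s.p42 * s.p43 * s.p24 + s.p43 * s.p23 * s.p44 + s.p44 * s.p43 * s.p44 + s.p31 * s.p12 * s.p11 + s.p32 * s.p32 * s.p11 + s.p33 * s.p12 * s.p31 + s.p34 * s.p32 * s.p31 + s.p31 * s.p14 * s.p21 + s.p32 * s.p34 * s.p21 + s.p33 * s.p14 * s.p41 + s.p34 * s.p34 * s.p41 = 0
  e85 : s.p41 * s.p22 * s.p11 + s.p42 * s.p42 * s.p11 + s.p43 * s.p22 * s.p31 + s.p44 * s.p42 * s.p31 + s.p41 * s.p24 * s.p21 + s.p42 * s.p44 * s.p21 + s.p43 * s.p24 * s.p41 + s.p44 * s.p44 * s.p41 + s.p31 * s.p11 * s.p14 + s.p32 * s.p31 * s.p14 + s.p33 * s.p11 * s.p34 + s.p34 * s.p31 * s.p34 + s.p31 * s.p13 * s.p24 + s.p32 * s.p33 * s.p24 + s.p33 * s.p13 * s.p44 + s.p34 * s.p33 * s.p44 = 0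
  e86 : s.p41 * s.p22 * s.p12 + s.p42 * s.p42 * s.p12 + s.p43 * s.p22 * s.p32 + s.p44 * s.p42 * s.p32 + s.p41 * s.p24 * s.p22 + s.p42 * s.p44 * s.p22 + s.p43 * s.p24 * s.p42 + s.p44 * s.p44 * s.p42 + s.p31 * s.p12 * s.p14 + s.p32 * s.p32 * s.p14 + s.p33 * s.p12 * s.p34 + s.p34 * s.p32 * s.p34 + s.p31 * s.p14 * s.p24 + s.p32 * s.p34 * s.p24 + s.p33 * s.p14 * s.p44 + s.p34 * s.p34 * s.p44 = 0
  e87 : s.p41 * s.p22 * s.p13 + s.p42 * s.p42 * s.p13 + s.p43 * s.p22 * s.p33 + s.p44 * s.p42 * s.p33 + s.p41 * s.p24 * s.p23 + s.p42 * s.p44 * s.p23 + s.p43 * s.p24 * s.p43 + s.p44 * s.p44 * s.p43 + s.p31 * s.p11 * s.p12 + s.p32 * s.p31 * s.p12 + s.p33 * s.p11 * s.p32 + s.p34 * s.p31 * s.p32 + s.p31 * s.p13 * s.p22 + s.p32 * s.p33 * s.p22 + s.p33 * s.p13 * s.p42 + s.p34 * s.p33 * s.p42 = 0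
  e88 : s.p41 * s.p22 * s.p14 + s.p42 * s.p42 * s.p14 + s.p43 * s.p22 * s.p34 + s.p44 * s.p42 * s.p34 + s.p41 * s.p24 * s.p24 + s.p42 * s.p44 * s.p24 + s.p43 * s.p24 * s.p44 + s.p44 * s.p44 * s.p44 + s.p31 * s.p12 * s.p12 + s.p32 * s.p32 * s.p12 + s.p33 * s.p12 * s.p32 + s.p34 * s.p32 * s.p32 + s.p31 * s.p14 * s.p22 + s.p32 * s.p34 * s.p22 + s.p33 * s.p14 * s.p42 + s.p34 * s.p34 * s.p42 = 0
  e89 : s.p41 * s.p11 * s.p11 + s.p42 * s.p31 * s.p11 + s.p43 * s.p11 * s.p31 + s.p44 * s.p31 * s.p31 + s.p41 * s.p13 * s.p21 + s.p42 * s.p33 * s.p21 + s.p43 * s.p13 * s.p41 + s.p44 * s.p33 * s.p41 + s.p31 * s.p21 * s.p13 + s.p32 * s.p41 * s.p13 + s.p33 * s.p21 * s.p33 + s.p34 * s.p41 * s.p33 + s.p31 * s.p23 * s.p23 + s.p32 * s.p43 * s.p23 + s.p33 * s.p23 * s.p43 + s.p34 * s.p43 * s.p43 = 0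
  e90 : s.p41 * s.p11 * s.p12 + s.p42 * s.p31 * s.p12 + s.p43 * s.p11 * s.p32 + s.p44 * s.p31 * s.p32 + s.p41 * s.p13 * s.p22 + s.p42 * s.p33 * s.p22 + s.p43 * s.p13 * s.p42 + s.p44 * s.p33 * s.p42 + s.p31 * s.p22 * s.p13 + s.p32 * s.p42 * s.p13 + s.p33 * s.p22 * s.p33 + s.p34 * s.p42 * s.p33 + s.p31 * s.p24 * s.p23 + s.p32 * s.p44 * s.p23 + s.p33 * s.p24 * s.p43 + s.p34 * s.p44 * s.p43 = 0
  e91 : s.p41 * s.p11 * s.p13 + s.p42 * s.p31 * s.p13 + s.p43 * s.p11 * s.p33 + s.p44 * s.p31 * s.p33 + s.p41 * s.p13 * s.p23 + s.p42 * s.p33 * s.p23 + s.p43 * s.p13 * s.p43 + s.p44 * s.p33 * s.p43 + s.p31 * s.p21 * s.p11 + s.p32 * s.p41 * s.p11 + s.p33 * s.p21 * s.p31 + s.p34 * s.p41 * s.p31 + s.p31 * s.p23 * s.p21 + s.p32 * s.p43 * s.p21 + s.p33 * s.p23 * s.p41 + s.p34 * s.p43 * s.p41 = 0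
  e92 : s.p41 * s.p11 * s.p14 + s.p42 * s.p31 * s.p14 + s.p43 * s.p11 * s.p34 + s.p44 * s.p31 * s.p34 + s.p41 * s.p13 * s.p24 + s.p42 * s.p33 * s.p24 + s.p43 * s.p13 * s.p44 + s.p44 * s.p33 * s.p44 + s.p31 * s.p22 * s.p11 + s.p32 * s.p42 * s.p11 + s.p33 * s.p22 * s.p31 + s.p34 * s.p42 * s.p31 + s.p31 * s.p24 * s.p21 + s.p32 * s.p44 * s.p21 + s.p33 * s.p24 * s.p41 + s.p34 * s.p44 * s.p41 = 0
  e93 : s.p41 * s.p12 * s.p11 + s.p42 * s.p32 * s.p11 + s.p43 * s.p12 * s.p31 + s.p44 * s.p32 * s.p31 + s.p41 * s.p14 * s.p21 + s.p42 * s.p34 * s.p21 + s.p43 * s.p14 * s.p41 + s.p44 * s.p34 * s.p41 + s.p31 * s.p21 * s.p14 + s.p32 * s.p41 * s.p14 + s.p33 * s.p21 * s.p34 + s.p34 * s.p41 * s.p34 + s.p31 * s.p23 * s.p24 + s.p32 * s.p43 * s.p24 + s.p33 * s.p23 * s.p44 + s.p34 * s.p43 * s.p44 = 0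
  e94 : s.p41 * s.p12 * s.p12 + s.p42 * s.p32 * s.p12 + s.p43 * s.p12 * s.p32 + s.p44 * s.p32 * s.p32 + s.p41 * s.p14 * s.p22 + s.p42 * s.p34 * s.p22 + s.p43 * s.p14 * s.p42 + s.p44 * s.p34 * s.p42 + s.p31 * s.p22 * s.p14 + s.p32 * s.p42 * s.p14 + s.p33 * s.p22 * s.p34 + s.p34 * s.p42 * s.p34 + s.p31 * s.p24 * s.p24 + s.p32 * s.p44 * s.p24 + s.p33 * s.p24 * s.p44 + s.p34 * s.p44 * s.p44 = 0
  e95 : s.p41 * s.p12 * s.p13 + s.p42 * s.p32 * s.p13 + s.p43 * s.p12 * s.p33 + s.p44 * s.p32 * s.p33 + s.p41 * s.p14 * s.p23 + s.p42 * s.p34 * s.p23 + s.p43 * s.p14 * s.p43 + s.p44 * s.p34 * s.p43 + s.p31 * s.p21 * s.p12 + s.p32 * s.p41 * s.p12 + s.p33 * s.p21 * s.p32 + s.p34 * s.p41 * s.p32 + s.p31 * s.p23 * s.p22 + s.p32 * s.p43 * s.p22 + s.p33 * s.p23 * s.p42 + s.p34 * s.p43 * s.p42 = 0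
  e96 : s.p41 * s.p12 * s.p14 + s.p42 * s.p32 * s.p14 + s.p43 * s.p12 * s.p34 + s.p44 * s.p32 * s.p34 + s.p41 * s.p14 * s.p24 + s.p42 * s.p34 * s.p24 + s.p43 * s.p14 * s.p44 + s.p44 * s.p34 * s.p44 + s.p31 * s.p22 * s.p12 + s.p32 * s.p42 * s.p12 + s.p33 * s.p22 * s.p32 + s.p34 * s.p42 * s.p32 + s.p31 * s.p24 * s.p22 + s.p32 * s.p44 * s.p22 + s.p33 * s.p24 * s.p42 + s.p34 * s.p44 * s.p42 = 0
  e97 : -s.p21 * s.p21 - s.p22 * s.p41 + s.p41 * s.p22 * s.p22 + s.p42 * s.p42 * s.p22 + s.p43 * s.p22 * s.p42 + s.p44 * s.p42 * s.p42 + s.p41 * s.p24 * s.p12 + s.p42 * s.p44 * s.p12 + s.p43 * s.p24 * s.p32 + s.p44 * s.p44 * s.p32 = 0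
  e98 : -s.p21 * s.p22 - s.p22 * s.p42 + s.p41 * s.p21 * s.p22 + s.p42 * s.p41 * s.p22 + s.p43 * s.p21 * s.p42 + s.p44 * s.p41 * s.p42 + s.p41 * s.p23 * s.p12 + s.p42 * s.p43 * s.p12 + s.p43 * s.p23 * s.p32 + s.p44 * s.p43 * s.p32 = 0
  e99 : -s.p21 * s.p23 - s.p22 * s.p43 + s.p41 * s.p22 * s.p21 + s.p42 * s.p42 * s.p21 + s.p43 * s.p22 * s.p41 + s.p44 * s.p42 * s.p41 + s.p41 * s.p24 * s.p11 + s.p42 * s.p44 * s.p11 + s.p43 * s.p24 * s.p31 + s.p44 * s.p44 * s.p31 = 0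
  e100 : -s.p21 * s.p24 - s.p22 * s.p44 + s.p41 * s.p21 * s.p21 + s.p42 * s.p41 * s.p21 + s.p43 * s.p21 * s.p41 + s.p44 * s.p41 * s.p41 + s.p41 * s.p23 * s.p11 + s.p42 * s.p43 * s.p11 + s.p43 * s.p23 * s.p31 + s.p44 * s.p43 * s.p31 = 0
  e101 : -s.p21 * s.p11 - s.p22 * s.p31 + s.p31 * s.p22 * s.p22 + s.p32 * s.p42 * s.p22 + s.p33 * s.p22 * s.p42 + s.p34 * s.p42 * s.p42 + s.p31 * s.p24 * s.p12 + s.p32 * s.p44 * s.p12 + s.p33 * s.p24 * s.p32 + s.p34 * s.p44 * s.p32 = 0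
  e102 : -s.p21 * s.p12 - s.p22 * s.p32 + s.p31 * s.p21 * s.p22 + s.p32 * s.p41 * s.p22 + s.p33 * s.p21 * s.p42 + s.p34 * s.p41 * s.p42 + s.p31 * s.p23 * s.p12 + s.p32 * s.p43 * s.p12 + s.p33 * s.p23 * s.p32 + s.p34 * s.p43 * s.p32 = 0
  e103 : -s.p21 * s.p13 - s.p22 * s.p33 + s.p31 * s.p22 * s.p21 + s.p32 * s.p42 * s.p21 + s.p33 * s.p22 * s.p41 + s.p34 * s.p42 * s.p41 + s.p31 * s.p24 * s.p11 + s.p32 * s.p44 * s.p11 + s.p33 * s.p24 * s.p31 + s.p34 * s.p44 * s.p31 = 0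
  e104 : -s.p21 * s.p14 - s.p22 * s.p34 + s.p31 * s.p21 * s.p21 + s.p32 * s.p41 * s.p21 + s.p33 * s.p21 * s.p41 + s.p34 * s.p41 * s.p41 + s.p31 * s.p23 * s.p11 + s.p32 * s.p43 * s.p11 + s.p33 * s.p23 * s.p31 + s.p34 * s.p43 * s.p31 = 0
  e105 : -s.p23 * s.p21 - s.p24 * s.p41 + s.p41 * s.p22 * s.p24 + s.p42 * s.p42 * s.p24 + s.p43 * s.p22 * s.p44 + s.p44 * s.p42 * s.p44 + s.p41 * s.p24 * s.p14 + s.p42 * s.p44 * s.p14 + s.p43 * s.p24 * s.p34 + s.p44 * s.p44 * s.p34 = 0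
  e106 : -s.p23 * s.p22 - s.p24 * s.p42 + s.p41 * s.p21 * s.p24 + s.p42 * s.p41 * s.p24 + s.p43 * s.p21 * s.p44 + s.p44 * s.p41 * s.p44 + s.p41 * s.p23 * s.p14 + s.p42 * s.p43 * s.p14 + s.p43 * s.p23 * s.p34 + s.p44 * s.p43 * s.p34 = 0
  e107 : -s.p23 * s.p23 - s.p24 * s.p43 + s.p41 * s.p22 * s.p23 + s.p42 * s.p42 * s.p23 + s.p43 * s.p22 * s.p43 + s.p44 * s.p42 * s.p43 + s.p41 * s.p24 * s.p13 + s.p42 * s.p44 * s.p13 + s.p43 * s.p24 * s.p33 + s.p44 * s.p44 * s.p33 = 0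
  e108 : -s.p23 * s.p24 - s.p24 * s.p44 + s.p41 * s.p21 * s.p23 + s.p42 * s.p41 * s.p23 + s.p43 * s.p21 * s.p43 + s.p44 * s.p41 * s.p43 + s.p41 * s.p23 * s.p13 + s.p42 * s.p43 * s.p13 + s.p43 * s.p23 * s.p33 + s.p44 * s.p43 * s.p33 = 0
  e109 : -s.p23 * s.p11 - s.p24 * s.p31 + s.p31 * s.p22 * s.p24 + s.p32 * s.p42 * s.p24 + s.p33 * s.p22 * s.p44 + s.p34 * s.p42 * s.p44 + s.p31 * s.p24 * s.p14 + s.p32 * s.p44 * s.p14 + s.p33 * s.p24 * s.p34 + s.p34 * s.p44 * s.p34 = 0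
  e110 : -s.p23 * s.p12 - s.p24 * s.p32 + s.p31 * s.p21 * s.p24 + s.p32 * s.p41 * s.p24 + s.p33 * s.p21 * s.p44 + s.p34 * s.p41 * s.p44 + s.p31 * s.p23 * s.p14 + s.p32 * s.p43 * s.p14 + s.p33 * s.p23 * s.p34 + s.p34 * s.p43 * s.p34 = 0
  e111 : -s.p23 * s.p13 - s.p24 * s.p33 + s.p31 * s.p22 * s.p23 + s.p32 * s.p42 * s.p23 + s.p33 * s.p22 * s.p43 + s.p34 * s.p42 * s.p43 + s.p31 * s.p24 * s.p13 + s.p32 * s.p44 * s.p13 + s.p33 * s.p24 * s.p33 + s.p34 * s.p44 * s.p33 = 0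
  e112 : -s.p23 * s.p14 - s.p24 * s.p34 + s.p31 * s.p21 * s.p23 + s.p32 * s.p41 * s.p23 + s.p33 * s.p21 * s.p43 + s.p34 * s.p41 * s.p43 + s.p31 * s.p23 * s.p13 + s.p32 * s.p43 * s.p13 + s.p33 * s.p23 * s.p33 + s.p34 * s.p43 * s.p33 = 0
  e113 : -s.p11 * s.p21 - s.p12 * s.p41 + s.p41 * s.p12 * s.p22 + s.p42 * s.p32 * s.p22 + s.p43 * s.p12 * s.p42 + s.p44 * s.p32 * s.p42 + s.p41 * s.p14 * s.p12 + s.p42 * s.p34 * s.p12 + s.p43 * s.p14 * s.p32 + s.p44 * s.p34 * s.p32 = 0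
  e114 : -s.p11 * s.p22 - s.p12 * s.p42 + s.p41 * s.p11 * s.p22 + s.p42 * s.p31 * s.p22 + s.p43 * s.p11 * s.p42 + s.p44 * s.p31 * s.p42 + s.p41 * s.p13 * s.p12 + s.p42 * s.p33 * s.p12 + s.p43 * s.p13 * s.p32 + s.p44 * s.p33 * s.p32 = 0
  e115 : -s.p11 * s.p23 - s.p12 * s.p43 + s.p41 * s.p12 * s.p21 + s.p42 * s.p32 * s.p21 + s.p43 * s.p12 * s.p41 + s.p44 * s.p32 * s.p41 + s.p41 * s.p14 * s.p11 + s.p42 * s.p34 * s.p11 + s.p43 * s.p14 * s.p31 + s.p44 * s.p34 * s.p31 = 0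
  e116 : -s.p11 * s.p24 - s.p12 * s.p44 + s.p41 * s.p11 * s.p21 + s.p42 * s.p31 * s.p21 + s.p43 * s.p11 * s.p41 + s.p44 * s.p31 * s.p41 + s.p41 * s.p13 * s.p11 + s.p42 * s.p33 * s.p11 + s.p43 * s.p13 * s.p31 + s.p44 * s.p33 * s.p31 = 0
  e117 : -s.p11 * s.p11 - s.p12 * s.p31 + s.p31 * s.p12 * s.p22 + s.p32 * s.p32 * s.p22 + s.p33 * s.p12 * s.p42 + s.p34 * s.p32 * s.p42 + s.p31 * s.p14 * s.p12 + s.p32 * s.p34 * s.p12 + s.p33 * s.p14 * s.p32 + s.p34 * s.p34 * s.p32 = 0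
  e118 : -s.p11 * s.p12 - s.p12 * s.p32 + s.p31 * s.p11 * s.p22 + s.p32 * s.p31 * s.p22 + s.p33 * s.p11 * s.p42 + s.p34 * s.p31 * s.p42 + s.p31 * s.p13 * s.p12 + s.p32 * s.p33 * s.p12 + s.p33 * s.p13 * s.p32 + s.p34 * s.p33 * s.p32 = 0
  e119 : -s.p11 * s.p13 - s.p12 * s.p33 + s.p31 * s.p12 * s.p21 + s.p32 * s.p32 * s.p21 + s.p33 * s.p12 * s.p41 + s.p34 * s.p32 * s.p41 + s.p31 * s.p14 * s.p11 + s.p32 * s.p34 * s.p11 + s.p33 * s.p14 * s.p31 + s.p34 * s.p34 * s.p31 = 0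
  e120 : -s.p11 * s.p14 - s.p12 * s.p34 + s.p31 * s.p11 * s.p21 + s.p32 * s.p31 * s.p21 + s.p33 * s.p11 * s.p41 + s.p34 * s.p31 * s.p41 + s.p31 * s.p13 * s.p11 + s.p32 * s.p33 * s.p11 + s.p33 * s.p13 * s.p31 + s.p34 * s.p33 * s.p31 = 0
  e121 : -s.p13 * s.p21 - s.p14 * s.p41 + s.p41 * s.p12 * s.p24 + s.p42 * s.p32 * s.p24 + s.p43 * s.p12 * s.p44 + s.p44 * s.p32 * s.p44 + s.p41 * s.p14 * s.p14 + s.p42 * s.p34 * s.p14 + s.p43 * s.p14 * s.p34 + s.p44 * s.p34 * s.p34 = 0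
  e122 : -s.p13 * s.p22 - s.p14 * s.p42 + s.p41 * s.p11 * s.p24 + s.p42 * s.p31 * s.p24 + s.p43 * s.p11 * s.p44 + s.p44 * s.p31 * s.p44 + s.p41 * s.p13 * s.p14 + s.p42 * s.p33 * s.p14 + s.p43 * s.p13 * s.p34 + s.p44 * s.p33 * s.p34 = 0
  e123 : -s.p13 * s.p23 - s.p14 * s.p43 + s.p41 * s.p12 * s.p23 + s.p42 * s.p32 * s.p23 + s.p43 * s.p12 * s.p43 + s.p44 * s.p32 * s.p43 + s.p41 * s.p14 * s.p13 + s.p42 * s.p34 * s.p13 + s.p43 * s.p14 * s.p33 + s.p44 * s.p34 * s.p33 = 0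
  e124 : -s.p13 * s.p24 - s.p14 * s.p44 + s.p41 * s.p11 * s.p23 + s.p42 * s.p31 * s.p23 + s.p43 * s.p11 * s.p43 + s.p44 * s.p31 * s.p43 + s.p41 * s.p13 * s.p13 + s.p42 * s.p33 * s.p13 + s.p43 * s.p13 * s.p33 + s.p44 * s.p33 * s.p33 = 0
  e125 : -s.p13 * s.p11 - s.p14 * s.p31 + s.p31 * s.p12 * s.p24 + s.p32 * s.p32 * s.p24 + s.p33 * s.p12 * s.p44 + s.p34 * s.p32 * s.p44 + s.p31 * s.p14 * s.p14 + s.p32 * s.p34 * s.p14 + s.p33 * s.p14 * s.p34 + s.p34 * s.p34 * s.p34 = 0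
  e126 : -s.p13 * s.p12 - s.p14 * s.p32 + s.p31 * s.p11 * s.p24 + s.p32 * s.p31 * s.p24 + s.p33 * s.p11 * s.p44 + s.p34 * s.p31 * s.p44 + s.p31 * s.p13 * s.p14 + s.p32 * s.p33 * s.p14 + s.p33 * s.p13 * s.p34 + s.p34 * s.p33 * s.p34 = 0
  e127 : -s.p13 * s.p13 - s.p14 * s.p33 + s.p31 * s.p12 * s.p23 + s.p32 * s.p32 * s.p23 + s.p33 * s.p12 * s.p43 + s.p34 * s.p32 * s.p43 + s.p31 * s.p14 * s.p13 + s.p32 * s.p34 * s.p13 + s.p33 * s.p14 * s.p33 + s.p34 * s.p34 * s.p33 = 0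
  e128 : -s.p13 * s.p14 - s.p14 * s.p34 + s.p31 * s.p11 * s.p23 + s.p32 * s.p31 * s.p23 + s.p33 * s.p11 * s.p43 + s.p34 * s.p31 * s.p43 + s.p31 * s.p13 * s.p13 + s.p32 * s.p33 * s.p13 + s.p33 * s.p13 * s.p33 + s.p34 * s.p33 * s.p33 = 0

namespace Sol

variable {K : Type} [Field K]

/-! The matrix in the Hadamard basis (scaled by four). -/

def q11 (s : Sol K) : K := s.p11 + s.p12 + s.p13 + s.p14 + s.p21 + s.p22 + s.p23 + s.p24 + s.p31 +
  s.p32 + s.p33 + s.p34 + s.p41 + s.p42 + s.p43 + s.p44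

def q12 (s : Sol K) : K := s.p11 - s.p12 + s.p13 - s.p14 + s.p21 - s.p22 + s.p23 - s.p24 + s.p31 -
  s.p32 + s.p33 - s.p34 + s.p41 - s.p42 + s.p43 - s.p44

def q13 (s : Sol K) : K := s.p11 + s.p12 - s.p13 - s.p14 + s.p21 + s.p22 - s.p23 - s.p24 + s.p31 +
  s.p32 - s.p33 - s.p34 + s.p41 + s.p42 - s.p43 - s.p44

def q14 (s : Sol K) : K := s.p11 - s.p12 - s.p13 + s.p14 + s.p21 - s.p22 - s.p23 + s.p24 + s.p31 -
  s.p32 - s.p33 + s.p34 + s.p41 - s.p42 - s.p43 + s.p44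

def q21 (s : Sol K) : K := s.p11 + s.p12 + s.p13 + s.p14 - s.p21 - s.p22 - s.p23 - s.p24 + s.p31 +
  s.p32 + s.p33 + s.p34 - s.p41 - s.p42 - s.p43 - s.p44

def q22 (s : Sol K) : K := s.p11 - s.p12 + s.p13 - s.p14 - s.p21 + s.p22 - s.p23 + s.p24 + s.p31 -
  s.p32 + s.p33 - s.p34 - s.p41 + s.p42 - s.p43 + s.p44

def q23 (s : Sol K) : K := s.p11 + s.p12 - s.p13 - s.p14 - s.p21 - s.p22 + s.p23 + s.p24 + s.p31 +
  s.p32 - s.p33 - s.p34 - s.p41 - s.p42 + s.p43 + s.p44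

def q24 (s : Sol K) : K := s.p11 - s.p12 - s.p13 + s.p14 - s.p21 + s.p22 + s.p23 - s.p24 + s.p31 -
  s.p32 - s.p33 + s.p34 - s.p41 + s.p42 + s.p43 - s.p44

def q31 (s : Sol K) : K := s.p11 + s.p12 + s.p13 + s.p14 + s.p21 + s.p22 + s.p23 + s.p24 - s.p31 -
  s.p32 - s.p33 - s.p34 - s.p41 - s.p42 - s.p43 - s.p44

def q32 (s : Sol K) : K := s.p11 - s.p12 + s.p13 - s.p14 + s.p21 - s.p22 + s.p23 - s.p24 - s.p31 +
  s.p32 - s.p33 + s.p34 - s.p41 + s.p42 - s.p43 + s.p44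

def q33 (s : Sol K) : K := s.p11 + s.p12 - s.p13 - s.p14 + s.p21 + s.p22 - s.p23 - s.p24 - s.p31 -
  s.p32 + s.p33 + s.p34 - s.p41 - s.p42 + s.p43 + s.p44

def q34 (s : Sol K) : K := s.p11 - s.p12 - s.p13 + s.p14 + s.p21 - s.p22 - s.p23 + s.p24 - s.p31 +
  s.p32 + s.p33 - s.p34 - s.p41 + s.p42 + s.p43 - s.p44

def q41 (s : Sol K) : K := s.p11 + s.p12 + s.p13 + s.p14 - s.p21 - s.p22 - s.p23 - s.p24 - s.p31 -
  s.p32 - s.p33 - s.p34 + s.p41 + s.p42 + s.p43 + s.p44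

def q42 (s : Sol K) : K := s.p11 - s.p12 + s.p13 - s.p14 - s.p21 + s.p22 - s.p23 + s.p24 - s.p31 +
  s.p32 - s.p33 + s.p34 + s.p41 - s.p42 + s.p43 - s.p44

def q43 (s : Sol K) : K := s.p11 + s.p12 - s.p13 - s.p14 - s.p21 - s.p22 + s.p23 + s.p24 - s.p31 -
  s.p32 + s.p33 + s.p34 + s.p41 + s.p42 - s.p43 - s.p44

def q44 (s : Sol K) : K := s.p11 - s.p12 - s.p13 + s.p14 - s.p21 + s.p22 + s.p23 - s.p24 - s.p31 +
  s.p32 + s.p33 - s.p34 + s.p41 - s.p42 - s.p43 + s.p44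

theorem T4 {a b c d y0 y1 z0 z1 A B C D u0 u1 v0 v1 : K} (ha : a = A + B + C + D)
    (hb : b = A - B + C - D) (hc : c = A + B - C - D) (hd : d = A - B - C + D)
    (hy0 : y0 = u0 + u1) (hy1 : y1 = u0 - u1) (hz0 : z0 = v0 + v1) (hz1 : z1 = v0 - v1) :
    a * y0 * z0 + b * y1 * z0 + c * y0 * z1 + d * y1 * z1 =
      4 * ((A * u0 + B * u1) * v0 + (C * u0 + D * u1) * v1) := by
  subst ha hb hc hd hy0 hy1 hz0 hz1
  ring

theorem n0 (s : Sol K) (h : s.Is) : s.q11 * s.q11 + s.q13 * s.q31 + (2*s.q11 - 8) = 0 := by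
  rw [q11, q13, q31]
  linear_combination 2 * (((((h.e1 + h.e2) + (h.e3 + h.e4)) + ((h.e5 + h.e6) + (h.e7 + h.e8))) +
      (((h.e9 + h.e10) + (h.e11 + h.e12)) + ((h.e13 + h.e14) + (h.e15 + h.e16)))) + ((((h.e17 +
      h.e18) + (h.e19 + h.e20)) + ((h.e21 + h.e22) + (h.e23 + h.e24))) + (((h.e25 + h.e26) + (h.e27
      + h.e28)) + ((h.e29 + h.e30) + (h.e31 + h.e32)))))

theorem n1 (s : Sol K) (h : s.Is) : s.q12 * s.q21 + s.q14 * s.q41 + (-2*s.q11 - 8) = 0 := by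
  rw [q12, q14, q21, q41, q11]
  linear_combination 2 * (((((h.e1 + h.e2) + (h.e3 + h.e4)) + ((-h.e5 - h.e6) + (-h.e7 - h.e8))) +
      (((h.e9 + h.e10) + (h.e11 + h.e12)) + ((-h.e13 - h.e14) + (-h.e15 - h.e16)))) + ((((h.e17 +
      h.e18) + (h.e19 + h.e20)) + ((-h.e21 - h.e22) + (-h.e23 - h.e24))) + (((h.e25 + h.e26) +
      (h.e27 + h.e28)) + ((-h.e29 - h.e30) + (-h.e31 - h.e32)))))

theorem n2 (s : Sol K) (h : s.Is) : s.q11 * s.q12 + s.q13 * s.q32 + (-2*s.q12) = 0 := by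
  rw [q11, q13, q12, q32]
  linear_combination 2 * (((((h.e1 - h.e2) + (h.e3 - h.e4)) + ((h.e5 - h.e6) + (h.e7 - h.e8))) +
      (((h.e9 - h.e10) + (h.e11 - h.e12)) + ((h.e13 - h.e14) + (h.e15 - h.e16)))) + ((((h.e17 -
      h.e18) + (h.e19 - h.e20)) + ((h.e21 - h.e22) + (h.e23 - h.e24))) + (((h.e25 - h.e26) + (h.e27
      - h.e28)) + ((h.e29 - h.e30) + (h.e31 - h.e32)))))

theorem n3 (s : Sol K) (h : s.Is) : s.q12 * s.q22 + s.q14 * s.q42 + (2*s.q12) = 0 := by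
  rw [q12, q14, q22, q42]
  linear_combination 2 * (((((h.e1 - h.e2) + (h.e3 - h.e4)) + ((-h.e5 + h.e6) + (-h.e7 + h.e8))) +
      (((h.e9 - h.e10) + (h.e11 - h.e12)) + ((-h.e13 + h.e14) + (-h.e15 + h.e16)))) + ((((h.e17 -
      h.e18) + (h.e19 - h.e20)) + ((-h.e21 + h.e22) + (-h.e23 + h.e24))) + (((h.e25 - h.e26) +
      (h.e27 - h.e28)) + ((-h.e29 + h.e30) + (-h.e31 + h.e32)))))

theorem n4 (s : Sol K) (h : s.Is) : s.q11 * s.q13 + s.q13 * s.q33 + (2*s.q13) = 0 := by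
  rw [q11, q13, q33]
  linear_combination 2 * (((((h.e1 + h.e2) + (-h.e3 - h.e4)) + ((h.e5 + h.e6) + (-h.e7 - h.e8))) +
      (((h.e9 + h.e10) + (-h.e11 - h.e12)) + ((h.e13 + h.e14) + (-h.e15 - h.e16)))) + ((((h.e17 +
      h.e18) + (-h.e19 - h.e20)) + ((h.e21 + h.e22) + (-h.e23 - h.e24))) + (((h.e25 + h.e26) +
      (-h.e27 - h.e28)) + ((h.e29 + h.e30) + (-h.e31 - h.e32)))))

theorem n5 (s : Sol K) (h : s.Is) : s.q12 * s.q23 + s.q14 * s.q43 + (-2*s.q13) = 0 := by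
  rw [q12, q14, q23, q43, q13]
  linear_combination 2 * (((((h.e1 + h.e2) + (-h.e3 - h.e4)) + ((-h.e5 - h.e6) + (h.e7 + h.e8))) +
      (((h.e9 + h.e10) + (-h.e11 - h.e12)) + ((-h.e13 - h.e14) + (h.e15 + h.e16)))) + ((((h.e17 +
      h.e18) + (-h.e19 - h.e20)) + ((-h.e21 - h.e22) + (h.e23 + h.e24))) + (((h.e25 + h.e26) +
      (-h.e27 - h.e28)) + ((-h.e29 - h.e30) + (h.e31 + h.e32)))))

theorem n6 (s : Sol K) (h : s.Is) : s.q11 * s.q14 + s.q13 * s.q34 + (-2*s.q14) = 0 := by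
  rw [q11, q13, q14, q34]
  linear_combination 2 * (((((h.e1 - h.e2) + (-h.e3 + h.e4)) + ((h.e5 - h.e6) + (-h.e7 + h.e8))) +
      (((h.e9 - h.e10) + (-h.e11 + h.e12)) + ((h.e13 - h.e14) + (-h.e15 + h.e16)))) + ((((h.e17 -
      h.e18) + (-h.e19 + h.e20)) + ((h.e21 - h.e22) + (-h.e23 + h.e24))) + (((h.e25 - h.e26) +
      (-h.e27 + h.e28)) + ((h.e29 - h.e30) + (-h.e31 + h.e32)))))

theorem n7 (s : Sol K) (h : s.Is) : s.q12 * s.q24 + s.q14 * s.q44 + (2*s.q14) = 0 := by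
  rw [q12, q14, q24, q44]
  linear_combination 2 * (((((h.e1 - h.e2) + (-h.e3 + h.e4)) + ((-h.e5 + h.e6) + (h.e7 - h.e8))) +
      (((h.e9 - h.e10) + (-h.e11 + h.e12)) + ((-h.e13 + h.e14) + (h.e15 - h.e16)))) + ((((h.e17 -
      h.e18) + (-h.e19 + h.e20)) + ((-h.e21 + h.e22) + (h.e23 - h.e24))) + (((h.e25 - h.e26) +
      (-h.e27 + h.e28)) + ((-h.e29 + h.e30) + (h.e31 - h.e32)))))

theorem n8 (s : Sol K) (h : s.Is) : s.q21 * s.q11 + s.q23 * s.q31 + (-2*s.q21) = 0 := by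
  rw [q21, q23, q11, q31]
  linear_combination 2 * (((((h.e1 + h.e2) + (h.e3 + h.e4)) + ((h.e5 + h.e6) + (h.e7 + h.e8))) +
      (((-h.e9 - h.e10) + (-h.e11 - h.e12)) + ((-h.e13 - h.e14) + (-h.e15 - h.e16)))) + ((((h.e17 +
      h.e18) + (h.e19 + h.e20)) + ((h.e21 + h.e22) + (h.e23 + h.e24))) + (((-h.e25 - h.e26) +
      (-h.e27 - h.e28)) + ((-h.e29 - h.e30) + (-h.e31 - h.e32)))))

theorem n9 (s : Sol K) (h : s.Is) : s.q22 * s.q21 + s.q24 * s.q41 + (2*s.q21) = 0 := by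
  rw [q22, q24, q21, q41]
  linear_combination 2 * (((((h.e1 + h.e2) + (h.e3 + h.e4)) + ((-h.e5 - h.e6) + (-h.e7 - h.e8))) +
      (((-h.e9 - h.e10) + (-h.e11 - h.e12)) + ((h.e13 + h.e14) + (h.e15 + h.e16)))) + ((((h.e17 +
      h.e18) + (h.e19 + h.e20)) + ((-h.e21 - h.e22) + (-h.e23 - h.e24))) + (((-h.e25 - h.e26) +
      (-h.e27 - h.e28)) + ((h.e29 + h.e30) + (h.e31 + h.e32)))))

theorem n10 (s : Sol K) (h : s.Is) : s.q21 * s.q12 + s.q23 * s.q32 + (2*s.q22 - 8) = 0 := by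
  rw [q21, q23, q12, q32, q22]
  linear_combination 2 * (((((h.e1 - h.e2) + (h.e3 - h.e4)) + ((h.e5 - h.e6) + (h.e7 - h.e8))) +
      (((-h.e9 + h.e10) + (-h.e11 + h.e12)) + ((-h.e13 + h.e14) + (-h.e15 + h.e16)))) + ((((h.e17 -
      h.e18) + (h.e19 - h.e20)) + ((h.e21 - h.e22) + (h.e23 - h.e24))) + (((-h.e25 + h.e26) +
      (-h.e27 + h.e28)) + ((-h.e29 + h.e30) + (-h.e31 + h.e32)))))

theorem n11 (s : Sol K) (h : s.Is) : s.q22 * s.q22 + s.q24 * s.q42 + (-2*s.q22 - 8) = 0 := by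
  rw [q22, q24, q42]
  linear_combination 2 * (((((h.e1 - h.e2) + (h.e3 - h.e4)) + ((-h.e5 + h.e6) + (-h.e7 + h.e8))) +
      (((-h.e9 + h.e10) + (-h.e11 + h.e12)) + ((h.e13 - h.e14) + (h.e15 - h.e16)))) + ((((h.e17 -
      h.e18) + (h.e19 - h.e20)) + ((-h.e21 + h.e22) + (-h.e23 + h.e24))) + (((-h.e25 + h.e26) +
      (-h.e27 + h.e28)) + ((h.e29 - h.e30) + (h.e31 - h.e32)))))

theorem n12 (s : Sol K) (h : s.Is) : s.q21 * s.q13 + s.q23 * s.q33 + (-2*s.q23) = 0 := by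
  rw [q21, q23, q13, q33]
  linear_combination 2 * (((((h.e1 + h.e2) + (-h.e3 - h.e4)) + ((h.e5 + h.e6) + (-h.e7 - h.e8))) +
      (((-h.e9 - h.e10) + (h.e11 + h.e12)) + ((-h.e13 - h.e14) + (h.e15 + h.e16)))) + ((((h.e17 +
      h.e18) + (-h.e19 - h.e20)) + ((h.e21 + h.e22) + (-h.e23 - h.e24))) + (((-h.e25 - h.e26) +
      (h.e27 + h.e28)) + ((-h.e29 - h.e30) + (h.e31 + h.e32)))))

theorem n13 (s : Sol K) (h : s.Is) : s.q22 * s.q23 + s.q24 * s.q43 + (2*s.q23) = 0 := by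
  rw [q22, q24, q23, q43]
  linear_combination 2 * (((((h.e1 + h.e2) + (-h.e3 - h.e4)) + ((-h.e5 - h.e6) + (h.e7 + h.e8))) +
      (((-h.e9 - h.e10) + (h.e11 + h.e12)) + ((h.e13 + h.e14) + (-h.e15 - h.e16)))) + ((((h.e17 +
      h.e18) + (-h.e19 - h.e20)) + ((-h.e21 - h.e22) + (h.e23 + h.e24))) + (((-h.e25 - h.e26) +
      (h.e27 + h.e28)) + ((h.e29 + h.e30) + (-h.e31 - h.e32)))))

theorem n14 (s : Sol K) (h : s.Is) : s.q21 * s.q14 + s.q23 * s.q34 + (2*s.q24) = 0 := by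
  rw [q21, q23, q14, q34, q24]
  linear_combination 2 * (((((h.e1 - h.e2) + (-h.e3 + h.e4)) + ((h.e5 - h.e6) + (-h.e7 + h.e8))) +
      (((-h.e9 + h.e10) + (h.e11 - h.e12)) + ((-h.e13 + h.e14) + (h.e15 - h.e16)))) + ((((h.e17 -
      h.e18) + (-h.e19 + h.e20)) + ((h.e21 - h.e22) + (-h.e23 + h.e24))) + (((-h.e25 + h.e26) +
      (h.e27 - h.e28)) + ((-h.e29 + h.e30) + (h.e31 - h.e32)))))

theorem n15 (s : Sol K) (h : s.Is) : s.q22 * s.q24 + s.q24 * s.q44 + (-2*s.q24) = 0 := by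
  rw [q22, q24, q44]
  linear_combination 2 * (((((h.e1 - h.e2) + (-h.e3 + h.e4)) + ((-h.e5 + h.e6) + (h.e7 - h.e8))) +
      (((-h.e9 + h.e10) + (h.e11 - h.e12)) + ((h.e13 - h.e14) + (-h.e15 + h.e16)))) + ((((h.e17 -
      h.e18) + (-h.e19 + h.e20)) + ((-h.e21 + h.e22) + (h.e23 - h.e24))) + (((-h.e25 + h.e26) +
      (h.e27 - h.e28)) + ((h.e29 - h.e30) + (-h.e31 + h.e32)))))

theorem n16 (s : Sol K) (h : s.Is) : s.q31 * s.q11 + s.q33 * s.q31 + (2*s.q31) = 0 := by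
  rw [q31, q33, q11]
  linear_combination 2 * (((((h.e1 + h.e2) + (h.e3 + h.e4)) + ((h.e5 + h.e6) + (h.e7 + h.e8))) +
      (((h.e9 + h.e10) + (h.e11 + h.e12)) + ((h.e13 + h.e14) + (h.e15 + h.e16)))) + ((((-h.e17 -
      h.e18) + (-h.e19 - h.e20)) + ((-h.e21 - h.e22) + (-h.e23 - h.e24))) + (((-h.e25 - h.e26) +
      (-h.e27 - h.e28)) + ((-h.e29 - h.e30) + (-h.e31 - h.e32)))))

theorem n17 (s : Sol K) (h : s.Is) : s.q32 * s.q21 + s.q34 * s.q41 + (-2*s.q31) = 0 := by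
  rw [q32, q34, q21, q41, q31]
  linear_combination 2 * (((((h.e1 + h.e2) + (h.e3 + h.e4)) + ((-h.e5 - h.e6) + (-h.e7 - h.e8))) +
      (((h.e9 + h.e10) + (h.e11 + h.e12)) + ((-h.e13 - h.e14) + (-h.e15 - h.e16)))) + ((((-h.e17 -
      h.e18) + (-h.e19 - h.e20)) + ((h.e21 + h.e22) + (h.e23 + h.e24))) + (((-h.e25 - h.e26) +
      (-h.e27 - h.e28)) + ((h.e29 + h.e30) + (h.e31 + h.e32)))))

theorem n18 (s : Sol K) (h : s.Is) : s.q31 * s.q12 + s.q33 * s.q32 + (-2*s.q32) = 0 := by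
  rw [q31, q33, q12, q32]
  linear_combination 2 * (((((h.e1 - h.e2) + (h.e3 - h.e4)) + ((h.e5 - h.e6) + (h.e7 - h.e8))) +
      (((h.e9 - h.e10) + (h.e11 - h.e12)) + ((h.e13 - h.e14) + (h.e15 - h.e16)))) + ((((-h.e17 +
      h.e18) + (-h.e19 + h.e20)) + ((-h.e21 + h.e22) + (-h.e23 + h.e24))) + (((-h.e25 + h.e26) +
      (-h.e27 + h.e28)) + ((-h.e29 + h.e30) + (-h.e31 + h.e32)))))

theorem n19 (s : Sol K) (h : s.Is) : s.q32 * s.q22 + s.q34 * s.q42 + (2*s.q32) = 0 := by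
  rw [q32, q34, q22, q42]
  linear_combination 2 * (((((h.e1 - h.e2) + (h.e3 - h.e4)) + ((-h.e5 + h.e6) + (-h.e7 + h.e8))) +
      (((h.e9 - h.e10) + (h.e11 - h.e12)) + ((-h.e13 + h.e14) + (-h.e15 + h.e16)))) + ((((-h.e17 +
      h.e18) + (-h.e19 + h.e20)) + ((h.e21 - h.e22) + (h.e23 - h.e24))) + (((-h.e25 + h.e26) +
      (-h.e27 + h.e28)) + ((h.e29 - h.e30) + (h.e31 - h.e32)))))

theorem n20 (s : Sol K) (h : s.Is) : s.q31 * s.q13 + s.q33 * s.q33 + (2*s.q33 - 8) = 0 := by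
  rw [q31, q33, q13]
  linear_combination 2 * (((((h.e1 + h.e2) + (-h.e3 - h.e4)) + ((h.e5 + h.e6) + (-h.e7 - h.e8))) +
      (((h.e9 + h.e10) + (-h.e11 - h.e12)) + ((h.e13 + h.e14) + (-h.e15 - h.e16)))) + ((((-h.e17 -
      h.e18) + (h.e19 + h.e20)) + ((-h.e21 - h.e22) + (h.e23 + h.e24))) + (((-h.e25 - h.e26) +
      (h.e27 + h.e28)) + ((-h.e29 - h.e30) + (h.e31 + h.e32)))))

theorem n21 (s : Sol K) (h : s.Is) : s.q32 * s.q23 + s.q34 * s.q43 + (-2*s.q33 - 8) = 0 := by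
  rw [q32, q34, q23, q43, q33]
  linear_combination 2 * (((((h.e1 + h.e2) + (-h.e3 - h.e4)) + ((-h.e5 - h.e6) + (h.e7 + h.e8))) +
      (((h.e9 + h.e10) + (-h.e11 - h.e12)) + ((-h.e13 - h.e14) + (h.e15 + h.e16)))) + ((((-h.e17 -
      h.e18) + (h.e19 + h.e20)) + ((h.e21 + h.e22) + (-h.e23 - h.e24))) + (((-h.e25 - h.e26) +
      (h.e27 + h.e28)) + ((h.e29 + h.e30) + (-h.e31 - h.e32)))))

theorem n22 (s : Sol K) (h : s.Is) : s.q31 * s.q14 + s.q33 * s.q34 + (-2*s.q34) = 0 := by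
  rw [q31, q33, q14, q34]
  linear_combination 2 * (((((h.e1 - h.e2) + (-h.e3 + h.e4)) + ((h.e5 - h.e6) + (-h.e7 + h.e8))) +
      (((h.e9 - h.e10) + (-h.e11 + h.e12)) + ((h.e13 - h.e14) + (-h.e15 + h.e16)))) + ((((-h.e17 +
      h.e18) + (h.e19 - h.e20)) + ((-h.e21 + h.e22) + (h.e23 - h.e24))) + (((-h.e25 + h.e26) +
      (h.e27 - h.e28)) + ((-h.e29 + h.e30) + (h.e31 - h.e32)))))

theorem n23 (s : Sol K) (h : s.Is) : s.q32 * s.q24 + s.q34 * s.q44 + (2*s.q34) = 0 := by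
  rw [q32, q34, q24, q44]
  linear_combination 2 * (((((h.e1 - h.e2) + (-h.e3 + h.e4)) + ((-h.e5 + h.e6) + (h.e7 - h.e8))) +
      (((h.e9 - h.e10) + (-h.e11 + h.e12)) + ((-h.e13 + h.e14) + (h.e15 - h.e16)))) + ((((-h.e17 +
      h.e18) + (h.e19 - h.e20)) + ((h.e21 - h.e22) + (-h.e23 + h.e24))) + (((-h.e25 + h.e26) +
      (h.e27 - h.e28)) + ((h.e29 - h.e30) + (-h.e31 + h.e32)))))

theorem n24 (s : Sol K) (h : s.Is) : s.q41 * s.q11 + s.q43 * s.q31 + (-2*s.q41) = 0 := by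
  rw [q41, q43, q11, q31]
  linear_combination 2 * (((((h.e1 + h.e2) + (h.e3 + h.e4)) + ((h.e5 + h.e6) + (h.e7 + h.e8))) +
      (((-h.e9 - h.e10) + (-h.e11 - h.e12)) + ((-h.e13 - h.e14) + (-h.e15 - h.e16)))) + ((((-h.e17 -
      h.e18) + (-h.e19 - h.e20)) + ((-h.e21 - h.e22) + (-h.e23 - h.e24))) + (((h.e25 + h.e26) +
      (h.e27 + h.e28)) + ((h.e29 + h.e30) + (h.e31 + h.e32)))))

theorem n25 (s : Sol K) (h : s.Is) : s.q42 * s.q21 + s.q44 * s.q41 + (2*s.q41) = 0 := by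
  rw [q42, q44, q21, q41]
  linear_combination 2 * (((((h.e1 + h.e2) + (h.e3 + h.e4)) + ((-h.e5 - h.e6) + (-h.e7 - h.e8))) +
      (((-h.e9 - h.e10) + (-h.e11 - h.e12)) + ((h.e13 + h.e14) + (h.e15 + h.e16)))) + ((((-h.e17 -
      h.e18) + (-h.e19 - h.e20)) + ((h.e21 + h.e22) + (h.e23 + h.e24))) + (((h.e25 + h.e26) + (h.e27
      + h.e28)) + ((-h.e29 - h.e30) + (-h.e31 - h.e32)))))

theorem n26 (s : Sol K) (h : s.Is) : s.q41 * s.q12 + s.q43 * s.q32 + (2*s.q42) = 0 := by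
  rw [q41, q43, q12, q32, q42]
  linear_combination 2 * (((((h.e1 - h.e2) + (h.e3 - h.e4)) + ((h.e5 - h.e6) + (h.e7 - h.e8))) +
      (((-h.e9 + h.e10) + (-h.e11 + h.e12)) + ((-h.e13 + h.e14) + (-h.e15 + h.e16)))) + ((((-h.e17 +
      h.e18) + (-h.e19 + h.e20)) + ((-h.e21 + h.e22) + (-h.e23 + h.e24))) + (((h.e25 - h.e26) +
      (h.e27 - h.e28)) + ((h.e29 - h.e30) + (h.e31 - h.e32)))))

theorem n27 (s : Sol K) (h : s.Is) : s.q42 * s.q22 + s.q44 * s.q42 + (-2*s.q42) = 0 := by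
  rw [q42, q44, q22]
  linear_combination 2 * (((((h.e1 - h.e2) + (h.e3 - h.e4)) + ((-h.e5 + h.e6) + (-h.e7 + h.e8))) +
      (((-h.e9 + h.e10) + (-h.e11 + h.e12)) + ((h.e13 - h.e14) + (h.e15 - h.e16)))) + ((((-h.e17 +
      h.e18) + (-h.e19 + h.e20)) + ((h.e21 - h.e22) + (h.e23 - h.e24))) + (((h.e25 - h.e26) + (h.e27
      - h.e28)) + ((-h.e29 + h.e30) + (-h.e31 + h.e32)))))

theorem n28 (s : Sol K) (h : s.Is) : s.q41 * s.q13 + s.q43 * s.q33 + (-2*s.q43) = 0 := by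
  rw [q41, q43, q13, q33]
  linear_combination 2 * (((((h.e1 + h.e2) + (-h.e3 - h.e4)) + ((h.e5 + h.e6) + (-h.e7 - h.e8))) +
      (((-h.e9 - h.e10) + (h.e11 + h.e12)) + ((-h.e13 - h.e14) + (h.e15 + h.e16)))) + ((((-h.e17 -
      h.e18) + (h.e19 + h.e20)) + ((-h.e21 - h.e22) + (h.e23 + h.e24))) + (((h.e25 + h.e26) +
      (-h.e27 - h.e28)) + ((h.e29 + h.e30) + (-h.e31 - h.e32)))))

theorem n29 (s : Sol K) (h : s.Is) : s.q42 * s.q23 + s.q44 * s.q43 + (2*s.q43) = 0 := by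
  rw [q42, q44, q23, q43]
  linear_combination 2 * (((((h.e1 + h.e2) + (-h.e3 - h.e4)) + ((-h.e5 - h.e6) + (h.e7 + h.e8))) +
      (((-h.e9 - h.e10) + (h.e11 + h.e12)) + ((h.e13 + h.e14) + (-h.e15 - h.e16)))) + ((((-h.e17 -
      h.e18) + (h.e19 + h.e20)) + ((h.e21 + h.e22) + (-h.e23 - h.e24))) + (((h.e25 + h.e26) +
      (-h.e27 - h.e28)) + ((-h.e29 - h.e30) + (h.e31 + h.e32)))))

theorem n30 (s : Sol K) (h : s.Is) : s.q41 * s.q14 + s.q43 * s.q34 + (2*s.q44 - 8) = 0 := by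
  rw [q41, q43, q14, q34, q44]
  linear_combination 2 * (((((h.e1 - h.e2) + (-h.e3 + h.e4)) + ((h.e5 - h.e6) + (-h.e7 + h.e8))) +
      (((-h.e9 + h.e10) + (h.e11 - h.e12)) + ((-h.e13 + h.e14) + (h.e15 - h.e16)))) + ((((-h.e17 +
      h.e18) + (h.e19 - h.e20)) + ((-h.e21 + h.e22) + (h.e23 - h.e24))) + (((h.e25 - h.e26) +
      (-h.e27 + h.e28)) + ((h.e29 - h.e30) + (-h.e31 + h.e32)))))

theorem n31 (s : Sol K) (h : s.Is) : s.q42 * s.q24 + s.q44 * s.q44 + (-2*s.q44 - 8) = 0 := by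
  rw [q42, q44, q24]
  linear_combination 2 * (((((h.e1 - h.e2) + (-h.e3 + h.e4)) + ((-h.e5 + h.e6) + (h.e7 - h.e8))) +
      (((-h.e9 + h.e10) + (h.e11 - h.e12)) + ((h.e13 - h.e14) + (-h.e15 + h.e16)))) + ((((-h.e17 +
      h.e18) + (h.e19 - h.e20)) + ((h.e21 - h.e22) + (-h.e23 + h.e24))) + (((h.e25 - h.e26) +
      (-h.e27 + h.e28)) + ((-h.e29 + h.e30) + (h.e31 - h.e32)))))

theorem c0 (s : Sol K) (h : s.Is) : 1 * (s.q21 * s.q22 * s.q12 + s.q22 * s.q42 * s.q12 + s.q23 *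
      s.q22 * s.q32 + s.q24 * s.q42 * s.q32) + (-2*s.q21*s.q24 - 2*s.q22*s.q44) = 0 := by
  have t0 : s.q21 * s.q22 * s.q12 + s.q22 * s.q42 * s.q12 + s.q23 * s.q22 * s.q32 + s.q24 * s.q42 *
      s.q32 = 4 * (((s.p11 - s.p21 + s.p31 - s.p41) * (s.p11 - s.p12 + s.p13 - s.p14 - s.p21 + s.p22
      - s.p23 + s.p24) + (s.p12 - s.p22 + s.p32 - s.p42) * (s.p31 - s.p32 + s.p33 - s.p34 - s.p41 +
      s.p42 - s.p43 + s.p44)) * (s.p11 - s.p12 + s.p13 - s.p14 + s.p21 - s.p22 + s.p23 - s.p24) +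
      ((s.p13 - s.p23 + s.p33 - s.p43) * (s.p11 - s.p12 + s.p13 - s.p14 - s.p21 + s.p22 - s.p23 +
      s.p24) + (s.p14 - s.p24 + s.p34 - s.p44) * (s.p31 - s.p32 + s.p33 - s.p34 - s.p41 + s.p42 -
      s.p43 + s.p44)) * (s.p31 - s.p32 + s.p33 - s.p34 + s.p41 - s.p42 + s.p43 - s.p44)) := T4
      (by rw [q21]; ring) (by rw [q22]; ring) (by rw [q23]; ring) (by rw [q24]; ring)
      (by rw [q22]; ring) (by rw [q42]; ring) (by rw [q12]; ring) (by rw [q32]; ring)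
  rw [t0, q21, q22, q24, q44]
  linear_combination 4 * ((((((h.e33 - h.e34 + h.e35) + (-h.e36 - h.e37 + h.e38)) + ((-h.e39 + h.e40 -
      h.e41) + (h.e42 - h.e43 + h.e44))) + (((h.e45 - h.e46 + h.e47) + (-h.e48 + h.e49 - h.e50)) +
      ((-h.e51 + h.e52 - h.e53) + (h.e54 + h.e55 - h.e56)))) + ((((h.e57 - h.e58 - h.e59) + (h.e60 -
      h.e61 + h.e62)) + ((h.e63 - h.e64 - h.e65) + (h.e66 + h.e67 - h.e68))) + (((h.e69 - h.e70 -
      h.e71) + (h.e72 - h.e73 + h.e74)) + ((h.e75 - h.e76 + h.e77) + (-h.e78 - h.e79 + h.e80))))) +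
      (((((h.e81 - h.e82 + h.e83) + (-h.e84 - h.e85 + h.e86)) + ((-h.e87 + h.e88 - h.e89) + (h.e90 -
      h.e91 + h.e92))) + (((h.e93 - h.e94 + h.e95) + (-h.e96 + h.e97 - h.e98)) + ((-h.e99 + h.e100 -
      h.e101) + (h.e102 + h.e103 - h.e104)))) + ((((h.e105 - h.e106 - h.e107) + (h.e108 - h.e109 +
      h.e110)) + ((h.e111 - h.e112 - h.e113) + (h.e114 + h.e115 - h.e116))) + (((h.e117 - h.e118 -
      h.e119) + (h.e120 - h.e121 + h.e122)) + ((h.e123 - h.e124 + h.e125) + (-h.e126 - h.e127 +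
      h.e128))))))

theorem c1 (s : Sol K) (h : s.Is) : 1 * (s.q21 * s.q24 * s.q22 + s.q22 * s.q44 * s.q22 + s.q23 *
      s.q24 * s.q42 + s.q24 * s.q44 * s.q42) + (2*s.q21*s.q24 + 2*s.q22*s.q44) = 0 := by
  have t0 : s.q21 * s.q24 * s.q22 + s.q22 * s.q44 * s.q22 + s.q23 * s.q24 * s.q42 + s.q24 * s.q44 *
      s.q42 = 4 * (((s.p11 - s.p21 + s.p31 - s.p41) * (s.p11 - s.p12 - s.p13 + s.p14 - s.p21 + s.p22
      + s.p23 - s.p24) + (s.p12 - s.p22 + s.p32 - s.p42) * (s.p31 - s.p32 - s.p33 + s.p34 - s.p41 +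
      s.p42 + s.p43 - s.p44)) * (s.p11 - s.p12 + s.p13 - s.p14 - s.p21 + s.p22 - s.p23 + s.p24) +
      ((s.p13 - s.p23 + s.p33 - s.p43) * (s.p11 - s.p12 - s.p13 + s.p14 - s.p21 + s.p22 + s.p23 -
      s.p24) + (s.p14 - s.p24 + s.p34 - s.p44) * (s.p31 - s.p32 - s.p33 + s.p34 - s.p41 + s.p42 +
      s.p43 - s.p44)) * (s.p31 - s.p32 + s.p33 - s.p34 - s.p41 + s.p42 - s.p43 + s.p44)) := T4
      (by rw [q21]; ring) (by rw [q22]; ring) (by rw [q23]; ring) (by rw [q24]; ring)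
      (by rw [q24]; ring) (by rw [q44]; ring) (by rw [q22]; ring) (by rw [q42]; ring)
  rw [t0, q21, q22, q24, q44]
  linear_combination 4 * ((((((h.e33 - h.e34 + h.e35) + (-h.e36 - h.e37 + h.e38)) + ((-h.e39 + h.e40 -
      h.e41) + (h.e42 - h.e43 + h.e44))) + (((h.e45 - h.e46 + h.e47) + (-h.e48 - h.e49 + h.e50)) +
      ((h.e51 - h.e52 + h.e53) + (-h.e54 - h.e55 + h.e56)))) + ((((-h.e57 + h.e58 + h.e59) + (-h.e60
      + h.e61 - h.e62)) + ((-h.e63 + h.e64 + h.e65) + (-h.e66 - h.e67 + h.e68))) + (((-h.e69 + h.e70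
      + h.e71) + (-h.e72 + h.e73 - h.e74)) + ((-h.e75 + h.e76 - h.e77) + (h.e78 + h.e79 - h.e80)))))
      + (((((h.e81 - h.e82 + h.e83) + (-h.e84 - h.e85 + h.e86)) + ((-h.e87 + h.e88 - h.e89) + (h.e90
      - h.e91 + h.e92))) + (((h.e93 - h.e94 + h.e95) + (-h.e96 - h.e97 + h.e98)) + ((h.e99 - h.e100
      + h.e101) + (-h.e102 - h.e103 + h.e104)))) + ((((-h.e105 + h.e106 + h.e107) + (-h.e108 +
      h.e109 - h.e110)) + ((-h.e111 + h.e112 + h.e113) + (-h.e114 - h.e115 + h.e116))) + (((-h.e117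
      + h.e118 + h.e119) + (-h.e120 + h.e121 - h.e122)) + ((-h.e123 + h.e124 - h.e125) + (h.e126 +
      h.e127 - h.e128))))))

theorem c2 (s : Sol K) (h : s.Is) : 1 * (s.q11 * s.q23 * s.q23 + s.q12 * s.q43 * s.q23 + s.q13 *
      s.q23 * s.q43 + s.q14 * s.q43 * s.q43) + (2*s.q11*s.q23 + 2*s.q24*s.q31) = 0 := by
  have t0 : s.q11 * s.q23 * s.q23 + s.q12 * s.q43 * s.q23 + s.q13 * s.q23 * s.q43 + s.q14 * s.q43 *
      s.q43 = 4 * (((s.p11 + s.p21 + s.p31 + s.p41) * (s.p11 + s.p12 - s.p13 - s.p14 - s.p21 - s.p22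
      + s.p23 + s.p24) + (s.p12 + s.p22 + s.p32 + s.p42) * (s.p31 + s.p32 - s.p33 - s.p34 - s.p41 -
      s.p42 + s.p43 + s.p44)) * (s.p11 + s.p12 - s.p13 - s.p14 - s.p21 - s.p22 + s.p23 + s.p24) +
      ((s.p13 + s.p23 + s.p33 + s.p43) * (s.p11 + s.p12 - s.p13 - s.p14 - s.p21 - s.p22 + s.p23 +
      s.p24) + (s.p14 + s.p24 + s.p34 + s.p44) * (s.p31 + s.p32 - s.p33 - s.p34 - s.p41 - s.p42 +
      s.p43 + s.p44)) * (s.p31 + s.p32 - s.p33 - s.p34 - s.p41 - s.p42 + s.p43 + s.p44)) := T4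
      (by rw [q11]; ring) (by rw [q12]; ring) (by rw [q13]; ring) (by rw [q14]; ring)
      (by rw [q23]; ring) (by rw [q43]; ring) (by rw [q23]; ring) (by rw [q43]; ring)
  rw [t0, q11, q23, q24, q31]
  linear_combination 4 * ((((((-h.e33 - h.e34 + h.e35) + (h.e36 - h.e37 - h.e38)) + ((h.e39 + h.e40 +
      h.e41) + (h.e42 - h.e43 - h.e44))) + (((h.e45 + h.e46 - h.e47) + (-h.e48 + h.e49 + h.e50)) +
      ((h.e51 + h.e52 + h.e53) + (h.e54 + h.e55 + h.e56)))) + ((((-h.e57 - h.e58 - h.e59) + (-h.e60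
      - h.e61 - h.e62)) + ((-h.e63 - h.e64 - h.e65) + (-h.e66 - h.e67 - h.e68))) + (((-h.e69 - h.e70
      - h.e71) + (-h.e72 + h.e73 + h.e74)) + ((h.e75 + h.e76 + h.e77) + (h.e78 + h.e79 + h.e80)))))
      + (((((-h.e81 - h.e82 + h.e83) + (h.e84 - h.e85 - h.e86)) + ((h.e87 + h.e88 + h.e89) + (h.e90
      - h.e91 - h.e92))) + (((h.e93 + h.e94 - h.e95) + (-h.e96 + h.e97 + h.e98)) + ((h.e99 + h.e100
      + h.e101) + (h.e102 + h.e103 + h.e104)))) + ((((-h.e105 - h.e106 - h.e107) + (-h.e108 - h.e109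
      - h.e110)) + ((-h.e111 - h.e112 - h.e113) + (-h.e114 - h.e115 - h.e116))) + (((-h.e117 -
      h.e118 - h.e119) + (-h.e120 + h.e121 + h.e122)) + ((h.e123 + h.e124 + h.e125) + (h.e126 +
      h.e127 + h.e128))))))

theorem c3 (s : Sol K) (h : s.Is) : 1 * (s.q21 * s.q13 * s.q23 + s.q22 * s.q33 * s.q23 + s.q23 *
      s.q13 * s.q43 + s.q24 * s.q33 * s.q43) + (2*s.q13*s.q21 + 2*s.q14*s.q41) = 0 := by
  have t0 : s.q21 * s.q13 * s.q23 + s.q22 * s.q33 * s.q23 + s.q23 * s.q13 * s.q43 + s.q24 * s.q33 *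
      s.q43 = 4 * (((s.p11 - s.p21 + s.p31 - s.p41) * (s.p11 + s.p12 - s.p13 - s.p14 + s.p21 + s.p22
      - s.p23 - s.p24) + (s.p12 - s.p22 + s.p32 - s.p42) * (s.p31 + s.p32 - s.p33 - s.p34 + s.p41 +
      s.p42 - s.p43 - s.p44)) * (s.p11 + s.p12 - s.p13 - s.p14 - s.p21 - s.p22 + s.p23 + s.p24) +
      ((s.p13 - s.p23 + s.p33 - s.p43) * (s.p11 + s.p12 - s.p13 - s.p14 + s.p21 + s.p22 - s.p23 -
      s.p24) + (s.p14 - s.p24 + s.p34 - s.p44) * (s.p31 + s.p32 - s.p33 - s.p34 + s.p41 + s.p42 -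
      s.p43 - s.p44)) * (s.p31 + s.p32 - s.p33 - s.p34 - s.p41 - s.p42 + s.p43 + s.p44)) := T4
      (by rw [q21]; ring) (by rw [q22]; ring) (by rw [q23]; ring) (by rw [q24]; ring)
      (by rw [q13]; ring) (by rw [q33]; ring) (by rw [q23]; ring) (by rw [q43]; ring)
  rw [t0, q13, q14, q21, q41]
  linear_combination 4 * ((((((-h.e33 - h.e34 + h.e35) + (h.e36 - h.e37 - h.e38)) + ((h.e39 + h.e40 -
      h.e41) + (-h.e42 + h.e43 + h.e44))) + (((-h.e45 - h.e46 + h.e47) + (h.e48 + h.e49 + h.e50)) +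
      ((h.e51 + h.e52 - h.e53) + (-h.e54 - h.e55 - h.e56)))) + ((((-h.e57 - h.e58 - h.e59) + (-h.e60
      + h.e61 + h.e62)) + ((h.e63 + h.e64 + h.e65) + (h.e66 + h.e67 + h.e68))) + (((-h.e69 - h.e70 -
      h.e71) + (-h.e72 - h.e73 - h.e74)) + ((-h.e75 - h.e76 + h.e77) + (h.e78 + h.e79 + h.e80))))) +
      (((((-h.e81 - h.e82 + h.e83) + (h.e84 - h.e85 - h.e86)) + ((h.e87 + h.e88 - h.e89) + (-h.e90 +
      h.e91 + h.e92))) + (((-h.e93 - h.e94 + h.e95) + (h.e96 + h.e97 + h.e98)) + ((h.e99 + h.e100 -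
      h.e101) + (-h.e102 - h.e103 - h.e104)))) + ((((-h.e105 - h.e106 - h.e107) + (-h.e108 + h.e109
      + h.e110)) + ((h.e111 + h.e112 + h.e113) + (h.e114 + h.e115 + h.e116))) + (((-h.e117 - h.e118
      - h.e119) + (-h.e120 - h.e121 - h.e122)) + ((-h.e123 - h.e124 + h.e125) + (h.e126 + h.e127 +
      h.e128))))))

theorem c7 (s : Sol K) (h : s.Is) : 1 * (s.q11 * s.q21 * s.q13 + s.q12 * s.q41 * s.q13 + s.q13 *
      s.q21 * s.q33 + s.q14 * s.q41 * s.q33) + (-2*s.q11*s.q23 - 2*s.q24*s.q31) = 0 := by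
  have t0 : s.q11 * s.q21 * s.q13 + s.q12 * s.q41 * s.q13 + s.q13 * s.q21 * s.q33 + s.q14 * s.q41 *
      s.q33 = 4 * (((s.p11 + s.p21 + s.p31 + s.p41) * (s.p11 + s.p12 + s.p13 + s.p14 - s.p21 - s.p22
      - s.p23 - s.p24) + (s.p12 + s.p22 + s.p32 + s.p42) * (s.p31 + s.p32 + s.p33 + s.p34 - s.p41 -
      s.p42 - s.p43 - s.p44)) * (s.p11 + s.p12 - s.p13 - s.p14 + s.p21 + s.p22 - s.p23 - s.p24) +
      ((s.p13 + s.p23 + s.p33 + s.p43) * (s.p11 + s.p12 + s.p13 + s.p14 - s.p21 - s.p22 - s.p23 -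
      s.p24) + (s.p14 + s.p24 + s.p34 + s.p44) * (s.p31 + s.p32 + s.p33 + s.p34 - s.p41 - s.p42 -
      s.p43 - s.p44)) * (s.p31 + s.p32 - s.p33 - s.p34 + s.p41 + s.p42 - s.p43 - s.p44)) := T4
      (by rw [q11]; ring) (by rw [q12]; ring) (by rw [q13]; ring) (by rw [q14]; ring)
      (by rw [q21]; ring) (by rw [q41]; ring) (by rw [q13]; ring) (by rw [q33]; ring)
  rw [t0, q11, q23, q24, q31]
  linear_combination 4 * ((((((-h.e33 - h.e34 + h.e35) + (h.e36 - h.e37 - h.e38)) + ((h.e39 + h.e40 +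
      h.e41) + (h.e42 - h.e43 - h.e44))) + (((h.e45 + h.e46 - h.e47) + (-h.e48 - h.e49 - h.e50)) +
      ((-h.e51 - h.e52 - h.e53) + (-h.e54 - h.e55 - h.e56)))) + ((((h.e57 + h.e58 + h.e59) + (h.e60
      + h.e61 + h.e62)) + ((h.e63 + h.e64 + h.e65) + (h.e66 + h.e67 + h.e68))) + (((h.e69 + h.e70 +
      h.e71) + (h.e72 - h.e73 - h.e74)) + ((-h.e75 - h.e76 - h.e77) + (-h.e78 - h.e79 - h.e80))))) +
      (((((-h.e81 - h.e82 + h.e83) + (h.e84 - h.e85 - h.e86)) + ((h.e87 + h.e88 + h.e89) + (h.e90 -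
      h.e91 - h.e92))) + (((h.e93 + h.e94 - h.e95) + (-h.e96 - h.e97 - h.e98)) + ((-h.e99 - h.e100 -
      h.e101) + (-h.e102 - h.e103 - h.e104)))) + ((((h.e105 + h.e106 + h.e107) + (h.e108 + h.e109 +
      h.e110)) + ((h.e111 + h.e112 + h.e113) + (h.e114 + h.e115 + h.e116))) + (((h.e117 + h.e118 +
      h.e119) + (h.e120 - h.e121 - h.e122)) + ((-h.e123 - h.e124 - h.e125) + (-h.e126 - h.e127 -
      h.e128))))))

theorem c8 (s : Sol K) (h : s.Is) : 2 * (s.q21 * s.q24 * s.q23 + s.q22 * s.q44 * s.q23 + s.q23 *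
      s.q24 * s.q43 + s.q24 * s.q44 * s.q43) + (-2) * (s.q21 * s.q23 * s.q24 + s.q22 * s.q43 * s.q24
      + s.q23 * s.q23 * s.q44 + s.q24 * s.q43 * s.q44) + (-4*s.q22*s.q23 + 4*s.q23*s.q23 -
      4*s.q24*s.q42 + 4*s.q24*s.q43) = 0 := by
  have t0 : s.q21 * s.q24 * s.q23 + s.q22 * s.q44 * s.q23 + s.q23 * s.q24 * s.q43 + s.q24 * s.q44 *
      s.q43 = 4 * (((s.p11 - s.p21 + s.p31 - s.p41) * (s.p11 - s.p12 - s.p13 + s.p14 - s.p21 + s.p22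
      + s.p23 - s.p24) + (s.p12 - s.p22 + s.p32 - s.p42) * (s.p31 - s.p32 - s.p33 + s.p34 - s.p41 +
      s.p42 + s.p43 - s.p44)) * (s.p11 + s.p12 - s.p13 - s.p14 - s.p21 - s.p22 + s.p23 + s.p24) +
      ((s.p13 - s.p23 + s.p33 - s.p43) * (s.p11 - s.p12 - s.p13 + s.p14 - s.p21 + s.p22 + s.p23 -
      s.p24) + (s.p14 - s.p24 + s.p34 - s.p44) * (s.p31 - s.p32 - s.p33 + s.p34 - s.p41 + s.p42 +
      s.p43 - s.p44)) * (s.p31 + s.p32 - s.p33 - s.p34 - s.p41 - s.p42 + s.p43 + s.p44)) := T4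
      (by rw [q21]; ring) (by rw [q22]; ring) (by rw [q23]; ring) (by rw [q24]; ring)
      (by rw [q24]; ring) (by rw [q44]; ring) (by rw [q23]; ring) (by rw [q43]; ring)
  have t1 : s.q21 * s.q23 * s.q24 + s.q22 * s.q43 * s.q24 + s.q23 * s.q23 * s.q44 + s.q24 * s.q43 *
      s.q44 = 4 * (((s.p11 - s.p21 + s.p31 - s.p41) * (s.p11 + s.p12 - s.p13 - s.p14 - s.p21 - s.p22
      + s.p23 + s.p24) + (s.p12 - s.p22 + s.p32 - s.p42) * (s.p31 + s.p32 - s.p33 - s.p34 - s.p41 -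
      s.p42 + s.p43 + s.p44)) * (s.p11 - s.p12 - s.p13 + s.p14 - s.p21 + s.p22 + s.p23 - s.p24) +
      ((s.p13 - s.p23 + s.p33 - s.p43) * (s.p11 + s.p12 - s.p13 - s.p14 - s.p21 - s.p22 + s.p23 +
      s.p24) + (s.p14 - s.p24 + s.p34 - s.p44) * (s.p31 + s.p32 - s.p33 - s.p34 - s.p41 - s.p42 +
      s.p43 + s.p44)) * (s.p31 - s.p32 - s.p33 + s.p34 - s.p41 + s.p42 + s.p43 - s.p44)) := T4
      (by rw [q21]; ring) (by rw [q22]; ring) (by rw [q23]; ring) (by rw [q24]; ring)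
      (by rw [q23]; ring) (by rw [q43]; ring) (by rw [q24]; ring) (by rw [q44]; ring)
  rw [t0, t1, q22, q23, q24, q42, q43]
  linear_combination 16 * (((((h.e34 - h.e36 - h.e37) + (h.e39 - h.e42 + h.e44)) + ((h.e45 - h.e47 -
      h.e50) + (h.e51 + h.e54 - h.e55))) + (((h.e58 - h.e59 - h.e62) + (h.e63 + h.e66 - h.e67)) +
      ((-h.e70 + h.e71 - h.e74) + (h.e75 + h.e78 - h.e79)))) + ((((h.e82 - h.e84 - h.e85) + (h.e87 -
      h.e90 + h.e92)) + ((h.e93 - h.e95 - h.e98) + (h.e99 + h.e102 - h.e103))) + (((h.e106 - h.e107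
      - h.e110) + (h.e111 + h.e114 - h.e115)) + ((-h.e118 + h.e119 - h.e122) + (h.e123 + h.e126 -
      h.e127)))))

theorem c9 (s : Sol K) (h : s.Is) : 1 * (s.q21 * s.q11 * s.q12 + s.q22 * s.q31 * s.q12 + s.q23 *
      s.q11 * s.q32 + s.q24 * s.q31 * s.q32) + (-1) * (s.q21 * s.q12 * s.q11 + s.q22 * s.q32 * s.q11
      + s.q23 * s.q12 * s.q31 + s.q24 * s.q32 * s.q31) + (-2*s.q11*s.q22 + 2*s.q11*s.q23 -
      2*s.q12*s.q42 + 2*s.q12*s.q43) = 0 := by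
  have t0 : s.q21 * s.q11 * s.q12 + s.q22 * s.q31 * s.q12 + s.q23 * s.q11 * s.q32 + s.q24 * s.q31 *
      s.q32 = 4 * (((s.p11 - s.p21 + s.p31 - s.p41) * (s.p11 + s.p12 + s.p13 + s.p14 + s.p21 + s.p22
      + s.p23 + s.p24) + (s.p12 - s.p22 + s.p32 - s.p42) * (s.p31 + s.p32 + s.p33 + s.p34 + s.p41 +
      s.p42 + s.p43 + s.p44)) * (s.p11 - s.p12 + s.p13 - s.p14 + s.p21 - s.p22 + s.p23 - s.p24) +
      ((s.p13 - s.p23 + s.p33 - s.p43) * (s.p11 + s.p12 + s.p13 + s.p14 + s.p21 + s.p22 + s.p23 +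
      s.p24) + (s.p14 - s.p24 + s.p34 - s.p44) * (s.p31 + s.p32 + s.p33 + s.p34 + s.p41 + s.p42 +
      s.p43 + s.p44)) * (s.p31 - s.p32 + s.p33 - s.p34 + s.p41 - s.p42 + s.p43 - s.p44)) := T4
      (by rw [q21]; ring) (by rw [q22]; ring) (by rw [q23]; ring) (by rw [q24]; ring)
      (by rw [q11]; ring) (by rw [q31]; ring) (by rw [q12]; ring) (by rw [q32]; ring)
  have t1 : s.q21 * s.q12 * s.q11 + s.q22 * s.q32 * s.q11 + s.q23 * s.q12 * s.q31 + s.q24 * s.q32 *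
      s.q31 = 4 * (((s.p11 - s.p21 + s.p31 - s.p41) * (s.p11 - s.p12 + s.p13 - s.p14 + s.p21 - s.p22
      + s.p23 - s.p24) + (s.p12 - s.p22 + s.p32 - s.p42) * (s.p31 - s.p32 + s.p33 - s.p34 + s.p41 -
      s.p42 + s.p43 - s.p44)) * (s.p11 + s.p12 + s.p13 + s.p14 + s.p21 + s.p22 + s.p23 + s.p24) +
      ((s.p13 - s.p23 + s.p33 - s.p43) * (s.p11 - s.p12 + s.p13 - s.p14 + s.p21 - s.p22 + s.p23 -
      s.p24) + (s.p14 - s.p24 + s.p34 - s.p44) * (s.p31 - s.p32 + s.p33 - s.p34 + s.p41 - s.p42 +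
      s.p43 - s.p44)) * (s.p31 + s.p32 + s.p33 + s.p34 + s.p41 + s.p42 + s.p43 + s.p44)) := T4
      (by rw [q21]; ring) (by rw [q22]; ring) (by rw [q23]; ring) (by rw [q24]; ring)
      (by rw [q12]; ring) (by rw [q32]; ring) (by rw [q11]; ring) (by rw [q31]; ring)
  rw [t0, t1, q11, q12, q22, q23, q42, q43]
  linear_combination 8 * (((((h.e34 + h.e36 - h.e37) + (-h.e39 + h.e42 + h.e44)) + ((-h.e45 - h.e47 +
      h.e50) + (-h.e51 - h.e54 + h.e55))) + (((h.e58 - h.e59 - h.e62) + (h.e63 + h.e66 - h.e67)) +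
      ((-h.e70 + h.e71 + h.e74) + (-h.e75 - h.e78 + h.e79)))) + ((((h.e82 + h.e84 - h.e85) + (-h.e87
      + h.e90 + h.e92)) + ((-h.e93 - h.e95 + h.e98) + (-h.e99 - h.e102 + h.e103))) + (((h.e106 -
      h.e107 - h.e110) + (h.e111 + h.e114 - h.e115)) + ((-h.e118 + h.e119 + h.e122) + (-h.e123 -
      h.e126 + h.e127)))))

theorem c14 (s : Sol K) (h : s.Is) : 1 * (s.q41 * s.q22 * s.q14 + s.q42 * s.q42 * s.q14 + s.q43 *
      s.q22 * s.q34 + s.q44 * s.q42 * s.q34) + (-1) * (s.q41 * s.q24 * s.q24 + s.q42 * s.q44 * s.q24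
      + s.q43 * s.q24 * s.q44 + s.q44 * s.q44 * s.q44) + (4*s.q24*s.q43 + 4*s.q44*s.q44) = 0 := by
  have t0 : s.q41 * s.q22 * s.q14 + s.q42 * s.q42 * s.q14 + s.q43 * s.q22 * s.q34 + s.q44 * s.q42 *
      s.q34 = 4 * (((s.p11 - s.p21 - s.p31 + s.p41) * (s.p11 - s.p12 + s.p13 - s.p14 - s.p21 + s.p22
      - s.p23 + s.p24) + (s.p12 - s.p22 - s.p32 + s.p42) * (s.p31 - s.p32 + s.p33 - s.p34 - s.p41 +
      s.p42 - s.p43 + s.p44)) * (s.p11 - s.p12 - s.p13 + s.p14 + s.p21 - s.p22 - s.p23 + s.p24) +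
      ((s.p13 - s.p23 - s.p33 + s.p43) * (s.p11 - s.p12 + s.p13 - s.p14 - s.p21 + s.p22 - s.p23 +
      s.p24) + (s.p14 - s.p24 - s.p34 + s.p44) * (s.p31 - s.p32 + s.p33 - s.p34 - s.p41 + s.p42 -
      s.p43 + s.p44)) * (s.p31 - s.p32 - s.p33 + s.p34 + s.p41 - s.p42 - s.p43 + s.p44)) := T4
      (by rw [q41]; ring) (by rw [q42]; ring) (by rw [q43]; ring) (by rw [q44]; ring)
      (by rw [q22]; ring) (by rw [q42]; ring) (by rw [q14]; ring) (by rw [q34]; ring)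
  have t1 : s.q41 * s.q24 * s.q24 + s.q42 * s.q44 * s.q24 + s.q43 * s.q24 * s.q44 + s.q44 * s.q44 *
      s.q44 = 4 * (((s.p11 - s.p21 - s.p31 + s.p41) * (s.p11 - s.p12 - s.p13 + s.p14 - s.p21 + s.p22
      + s.p23 - s.p24) + (s.p12 - s.p22 - s.p32 + s.p42) * (s.p31 - s.p32 - s.p33 + s.p34 - s.p41 +
      s.p42 + s.p43 - s.p44)) * (s.p11 - s.p12 - s.p13 + s.p14 - s.p21 + s.p22 + s.p23 - s.p24) +
      ((s.p13 - s.p23 - s.p33 + s.p43) * (s.p11 - s.p12 - s.p13 + s.p14 - s.p21 + s.p22 + s.p23 -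
      s.p24) + (s.p14 - s.p24 - s.p34 + s.p44) * (s.p31 - s.p32 - s.p33 + s.p34 - s.p41 + s.p42 +
      s.p43 - s.p44)) * (s.p31 - s.p32 - s.p33 + s.p34 - s.p41 + s.p42 + s.p43 - s.p44)) := T4
      (by rw [q41]; ring) (by rw [q42]; ring) (by rw [q43]; ring) (by rw [q44]; ring)
      (by rw [q24]; ring) (by rw [q44]; ring) (by rw [q24]; ring) (by rw [q44]; ring)
  rw [t0, t1, q24, q43, q44]
  linear_combination 8 * ((((((h.e49 - h.e50) + (-h.e51 + h.e52)) + ((-h.e53 + h.e54) + (h.e55 -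
      h.e56))) + (((-h.e57 + h.e58) + (h.e59 - h.e60)) + ((h.e61 - h.e62) + (-h.e63 + h.e64)))) +
      ((((-h.e65 + h.e66) + (h.e67 - h.e68)) + ((h.e69 - h.e70) + (-h.e71 + h.e72))) + (((h.e73 -
      h.e74) + (-h.e75 + h.e76)) + ((-h.e77 + h.e78) + (h.e79 - h.e80))))) + (((((-h.e97 + h.e98) +
      (h.e99 - h.e100)) + ((h.e101 - h.e102) + (-h.e103 + h.e104))) + (((h.e105 - h.e106) + (-h.e107
      + h.e108)) + ((-h.e109 + h.e110) + (h.e111 - h.e112)))) + ((((h.e113 - h.e114) + (-h.e115 +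
      h.e116)) + ((-h.e117 + h.e118) + (h.e119 - h.e120))) + (((-h.e121 + h.e122) + (h.e123 -
      h.e124)) + ((h.e125 - h.e126) + (-h.e127 + h.e128))))))

theorem c15 (s : Sol K) (h : s.Is) : 1 * (s.q21 * s.q22 * s.q13 + s.q22 * s.q42 * s.q13 + s.q23 *
      s.q22 * s.q33 + s.q24 * s.q42 * s.q33) + (-1) * (s.q21 * s.q24 * s.q23 + s.q22 * s.q44 * s.q23
      + s.q23 * s.q24 * s.q43 + s.q24 * s.q44 * s.q43) + (4*s.q22*s.q23 + 4*s.q24*s.q42) = 0 := by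
  have t0 : s.q21 * s.q22 * s.q13 + s.q22 * s.q42 * s.q13 + s.q23 * s.q22 * s.q33 + s.q24 * s.q42 *
      s.q33 = 4 * (((s.p11 - s.p21 + s.p31 - s.p41) * (s.p11 - s.p12 + s.p13 - s.p14 - s.p21 + s.p22
      - s.p23 + s.p24) + (s.p12 - s.p22 + s.p32 - s.p42) * (s.p31 - s.p32 + s.p33 - s.p34 - s.p41 +
      s.p42 - s.p43 + s.p44)) * (s.p11 + s.p12 - s.p13 - s.p14 + s.p21 + s.p22 - s.p23 - s.p24) +
      ((s.p13 - s.p23 + s.p33 - s.p43) * (s.p11 - s.p12 + s.p13 - s.p14 - s.p21 + s.p22 - s.p23 +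
      s.p24) + (s.p14 - s.p24 + s.p34 - s.p44) * (s.p31 - s.p32 + s.p33 - s.p34 - s.p41 + s.p42 -
      s.p43 + s.p44)) * (s.p31 + s.p32 - s.p33 - s.p34 + s.p41 + s.p42 - s.p43 - s.p44)) := T4
      (by rw [q21]; ring) (by rw [q22]; ring) (by rw [q23]; ring) (by rw [q24]; ring)
      (by rw [q22]; ring) (by rw [q42]; ring) (by rw [q13]; ring) (by rw [q33]; ring)
  have t1 : s.q21 * s.q24 * s.q23 + s.q22 * s.q44 * s.q23 + s.q23 * s.q24 * s.q43 + s.q24 * s.q44 *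
      s.q43 = 4 * (((s.p11 - s.p21 + s.p31 - s.p41) * (s.p11 - s.p12 - s.p13 + s.p14 - s.p21 + s.p22
      + s.p23 - s.p24) + (s.p12 - s.p22 + s.p32 - s.p42) * (s.p31 - s.p32 - s.p33 + s.p34 - s.p41 +
      s.p42 + s.p43 - s.p44)) * (s.p11 + s.p12 - s.p13 - s.p14 - s.p21 - s.p22 + s.p23 + s.p24) +
      ((s.p13 - s.p23 + s.p33 - s.p43) * (s.p11 - s.p12 - s.p13 + s.p14 - s.p21 + s.p22 + s.p23 -
      s.p24) + (s.p14 - s.p24 + s.p34 - s.p44) * (s.p31 - s.p32 - s.p33 + s.p34 - s.p41 + s.p42 +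
      s.p43 - s.p44)) * (s.p31 + s.p32 - s.p33 - s.p34 - s.p41 - s.p42 + s.p43 + s.p44)) := T4
      (by rw [q21]; ring) (by rw [q22]; ring) (by rw [q23]; ring) (by rw [q24]; ring)
      (by rw [q24]; ring) (by rw [q44]; ring) (by rw [q23]; ring) (by rw [q43]; ring)
  rw [t0, t1, q22, q23, q24, q42]
  linear_combination 8 * ((((((-h.e49 + h.e50) + (-h.e51 + h.e52)) + ((h.e53 - h.e54) + (h.e55 -
      h.e56))) + (((h.e57 - h.e58) + (h.e59 - h.e60)) + ((-h.e61 + h.e62) + (-h.e63 + h.e64)))) +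
      ((((h.e65 - h.e66) + (h.e67 - h.e68)) + ((-h.e69 + h.e70) + (-h.e71 + h.e72))) + (((-h.e73 +
      h.e74) + (-h.e75 + h.e76)) + ((h.e77 - h.e78) + (h.e79 - h.e80))))) + (((((-h.e97 + h.e98) +
      (-h.e99 + h.e100)) + ((h.e101 - h.e102) + (h.e103 - h.e104))) + (((h.e105 - h.e106) + (h.e107
      - h.e108)) + ((-h.e109 + h.e110) + (-h.e111 + h.e112)))) + ((((h.e113 - h.e114) + (h.e115 -
      h.e116)) + ((-h.e117 + h.e118) + (-h.e119 + h.e120))) + (((-h.e121 + h.e122) + (-h.e123 +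
      h.e124)) + ((h.e125 - h.e126) + (h.e127 - h.e128))))))

theorem c16 (s : Sol K) (h : s.Is) : (-1) * (s.q31 * s.q22 * s.q13 + s.q32 * s.q42 * s.q13 + s.q33 *
      s.q22 * s.q33 + s.q34 * s.q42 * s.q33) + 1 * (s.q31 * s.q24 * s.q23 + s.q32 * s.q44 * s.q23 +
      s.q33 * s.q24 * s.q43 + s.q34 * s.q44 * s.q43) + (4*s.q12*s.q43 + 4*s.q32*s.q44) = 0 := by
  have t0 : s.q31 * s.q22 * s.q13 + s.q32 * s.q42 * s.q13 + s.q33 * s.q22 * s.q33 + s.q34 * s.q42 *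
      s.q33 = 4 * (((s.p11 + s.p21 - s.p31 - s.p41) * (s.p11 - s.p12 + s.p13 - s.p14 - s.p21 + s.p22
      - s.p23 + s.p24) + (s.p12 + s.p22 - s.p32 - s.p42) * (s.p31 - s.p32 + s.p33 - s.p34 - s.p41 +
      s.p42 - s.p43 + s.p44)) * (s.p11 + s.p12 - s.p13 - s.p14 + s.p21 + s.p22 - s.p23 - s.p24) +
      ((s.p13 + s.p23 - s.p33 - s.p43) * (s.p11 - s.p12 + s.p13 - s.p14 - s.p21 + s.p22 - s.p23 +
      s.p24) + (s.p14 + s.p24 - s.p34 - s.p44) * (s.p31 - s.p32 + s.p33 - s.p34 - s.p41 + s.p42 -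
      s.p43 + s.p44)) * (s.p31 + s.p32 - s.p33 - s.p34 + s.p41 + s.p42 - s.p43 - s.p44)) := T4
      (by rw [q31]; ring) (by rw [q32]; ring) (by rw [q33]; ring) (by rw [q34]; ring)
      (by rw [q22]; ring) (by rw [q42]; ring) (by rw [q13]; ring) (by rw [q33]; ring)
  have t1 : s.q31 * s.q24 * s.q23 + s.q32 * s.q44 * s.q23 + s.q33 * s.q24 * s.q43 + s.q34 * s.q44 *
      s.q43 = 4 * (((s.p11 + s.p21 - s.p31 - s.p41) * (s.p11 - s.p12 - s.p13 + s.p14 - s.p21 + s.p22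
      + s.p23 - s.p24) + (s.p12 + s.p22 - s.p32 - s.p42) * (s.p31 - s.p32 - s.p33 + s.p34 - s.p41 +
      s.p42 + s.p43 - s.p44)) * (s.p11 + s.p12 - s.p13 - s.p14 - s.p21 - s.p22 + s.p23 + s.p24) +
      ((s.p13 + s.p23 - s.p33 - s.p43) * (s.p11 - s.p12 - s.p13 + s.p14 - s.p21 + s.p22 + s.p23 -
      s.p24) + (s.p14 + s.p24 - s.p34 - s.p44) * (s.p31 - s.p32 - s.p33 + s.p34 - s.p41 + s.p42 +
      s.p43 - s.p44)) * (s.p31 + s.p32 - s.p33 - s.p34 - s.p41 - s.p42 + s.p43 + s.p44)) := T4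
      (by rw [q31]; ring) (by rw [q32]; ring) (by rw [q33]; ring) (by rw [q34]; ring)
      (by rw [q24]; ring) (by rw [q44]; ring) (by rw [q23]; ring) (by rw [q43]; ring)
  rw [t0, t1, q12, q32, q43, q44]
  linear_combination 8 * ((((((-h.e49 + h.e50) + (-h.e51 + h.e52)) + ((-h.e53 + h.e54) + (-h.e55 +
      h.e56))) + (((h.e57 - h.e58) + (h.e59 - h.e60)) + ((h.e61 - h.e62) + (h.e63 - h.e64)))) +
      ((((h.e65 - h.e66) + (h.e67 - h.e68)) + ((h.e69 - h.e70) + (h.e71 - h.e72))) + (((-h.e73 +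
      h.e74) + (-h.e75 + h.e76)) + ((-h.e77 + h.e78) + (-h.e79 + h.e80))))) + (((((h.e97 - h.e98) +
      (h.e99 - h.e100)) + ((h.e101 - h.e102) + (h.e103 - h.e104))) + (((-h.e105 + h.e106) + (-h.e107
      + h.e108)) + ((-h.e109 + h.e110) + (-h.e111 + h.e112)))) + ((((-h.e113 + h.e114) + (-h.e115 +
      h.e116)) + ((-h.e117 + h.e118) + (-h.e119 + h.e120))) + (((h.e121 - h.e122) + (h.e123 -
      h.e124)) + ((h.e125 - h.e126) + (h.e127 - h.e128))))))

theorem c19 (s : Sol K) (h : s.Is) : (-1) * (s.q11 * s.q22 * s.q11 + s.q12 * s.q42 * s.q11 + s.q13 *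
      s.q22 * s.q31 + s.q14 * s.q42 * s.q31) + 1 * (s.q11 * s.q24 * s.q21 + s.q12 * s.q44 * s.q21 +
      s.q13 * s.q24 * s.q41 + s.q14 * s.q44 * s.q41) + (-4*s.q12*s.q21 - 4*s.q22*s.q32) = 0 := by
  have t0 : s.q11 * s.q22 * s.q11 + s.q12 * s.q42 * s.q11 + s.q13 * s.q22 * s.q31 + s.q14 * s.q42 *
      s.q31 = 4 * (((s.p11 + s.p21 + s.p31 + s.p41) * (s.p11 - s.p12 + s.p13 - s.p14 - s.p21 + s.p22
      - s.p23 + s.p24) + (s.p12 + s.p22 + s.p32 + s.p42) * (s.p31 - s.p32 + s.p33 - s.p34 - s.p41 +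
      s.p42 - s.p43 + s.p44)) * (s.p11 + s.p12 + s.p13 + s.p14 + s.p21 + s.p22 + s.p23 + s.p24) +
      ((s.p13 + s.p23 + s.p33 + s.p43) * (s.p11 - s.p12 + s.p13 - s.p14 - s.p21 + s.p22 - s.p23 +
      s.p24) + (s.p14 + s.p24 + s.p34 + s.p44) * (s.p31 - s.p32 + s.p33 - s.p34 - s.p41 + s.p42 -
      s.p43 + s.p44)) * (s.p31 + s.p32 + s.p33 + s.p34 + s.p41 + s.p42 + s.p43 + s.p44)) := T4
      (by rw [q11]; ring) (by rw [q12]; ring) (by rw [q13]; ring) (by rw [q14]; ring)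
      (by rw [q22]; ring) (by rw [q42]; ring) (by rw [q11]; ring) (by rw [q31]; ring)
  have t1 : s.q11 * s.q24 * s.q21 + s.q12 * s.q44 * s.q21 + s.q13 * s.q24 * s.q41 + s.q14 * s.q44 *
      s.q41 = 4 * (((s.p11 + s.p21 + s.p31 + s.p41) * (s.p11 - s.p12 - s.p13 + s.p14 - s.p21 + s.p22
      + s.p23 - s.p24) + (s.p12 + s.p22 + s.p32 + s.p42) * (s.p31 - s.p32 - s.p33 + s.p34 - s.p41 +
      s.p42 + s.p43 - s.p44)) * (s.p11 + s.p12 + s.p13 + s.p14 - s.p21 - s.p22 - s.p23 - s.p24) +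
      ((s.p13 + s.p23 + s.p33 + s.p43) * (s.p11 - s.p12 - s.p13 + s.p14 - s.p21 + s.p22 + s.p23 -
      s.p24) + (s.p14 + s.p24 + s.p34 + s.p44) * (s.p31 - s.p32 - s.p33 + s.p34 - s.p41 + s.p42 +
      s.p43 - s.p44)) * (s.p31 + s.p32 + s.p33 + s.p34 - s.p41 - s.p42 - s.p43 - s.p44)) := T4
      (by rw [q11]; ring) (by rw [q12]; ring) (by rw [q13]; ring) (by rw [q14]; ring)
      (by rw [q24]; ring) (by rw [q44]; ring) (by rw [q21]; ring) (by rw [q41]; ring)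
  rw [t0, t1, q12, q21, q22, q32]
  linear_combination 8 * ((((((-h.e49 + h.e50) + (-h.e51 + h.e52)) + ((-h.e53 + h.e54) + (-h.e55 +
      h.e56))) + (((-h.e57 + h.e58) + (-h.e59 + h.e60)) + ((-h.e61 + h.e62) + (-h.e63 + h.e64)))) +
      ((((h.e65 - h.e66) + (h.e67 - h.e68)) + ((h.e69 - h.e70) + (h.e71 - h.e72))) + (((h.e73 -
      h.e74) + (h.e75 - h.e76)) + ((h.e77 - h.e78) + (h.e79 - h.e80))))) + (((((-h.e97 + h.e98) +
      (-h.e99 + h.e100)) + ((-h.e101 + h.e102) + (-h.e103 + h.e104))) + (((-h.e105 + h.e106) +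
      (-h.e107 + h.e108)) + ((-h.e109 + h.e110) + (-h.e111 + h.e112)))) + ((((h.e113 - h.e114) +
      (h.e115 - h.e116)) + ((h.e117 - h.e118) + (h.e119 - h.e120))) + (((h.e121 - h.e122) + (h.e123
      - h.e124)) + ((h.e125 - h.e126) + (h.e127 - h.e128))))))

theorem c24 (s : Sol K) (h : s.Is) : 1 * (s.q11 * s.q21 * s.q12 + s.q12 * s.q41 * s.q12 + s.q13 *
      s.q21 * s.q32 + s.q14 * s.q41 * s.q32) + (-1) * (s.q11 * s.q23 * s.q22 + s.q12 * s.q43 * s.q22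
      + s.q13 * s.q23 * s.q42 + s.q14 * s.q43 * s.q42) + (4*s.q13*s.q21 + 4*s.q22*s.q33) = 0 := by
  have t0 : s.q11 * s.q21 * s.q12 + s.q12 * s.q41 * s.q12 + s.q13 * s.q21 * s.q32 + s.q14 * s.q41 *
      s.q32 = 4 * (((s.p11 + s.p21 + s.p31 + s.p41) * (s.p11 + s.p12 + s.p13 + s.p14 - s.p21 - s.p22
      - s.p23 - s.p24) + (s.p12 + s.p22 + s.p32 + s.p42) * (s.p31 + s.p32 + s.p33 + s.p34 - s.p41 -
      s.p42 - s.p43 - s.p44)) * (s.p11 - s.p12 + s.p13 - s.p14 + s.p21 - s.p22 + s.p23 - s.p24) +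
      ((s.p13 + s.p23 + s.p33 + s.p43) * (s.p11 + s.p12 + s.p13 + s.p14 - s.p21 - s.p22 - s.p23 -
      s.p24) + (s.p14 + s.p24 + s.p34 + s.p44) * (s.p31 + s.p32 + s.p33 + s.p34 - s.p41 - s.p42 -
      s.p43 - s.p44)) * (s.p31 - s.p32 + s.p33 - s.p34 + s.p41 - s.p42 + s.p43 - s.p44)) := T4
      (by rw [q11]; ring) (by rw [q12]; ring) (by rw [q13]; ring) (by rw [q14]; ring)
      (by rw [q21]; ring) (by rw [q41]; ring) (by rw [q12]; ring) (by rw [q32]; ring)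
  have t1 : s.q11 * s.q23 * s.q22 + s.q12 * s.q43 * s.q22 + s.q13 * s.q23 * s.q42 + s.q14 * s.q43 *
      s.q42 = 4 * (((s.p11 + s.p21 + s.p31 + s.p41) * (s.p11 + s.p12 - s.p13 - s.p14 - s.p21 - s.p22
      + s.p23 + s.p24) + (s.p12 + s.p22 + s.p32 + s.p42) * (s.p31 + s.p32 - s.p33 - s.p34 - s.p41 -
      s.p42 + s.p43 + s.p44)) * (s.p11 - s.p12 + s.p13 - s.p14 - s.p21 + s.p22 - s.p23 + s.p24) +
      ((s.p13 + s.p23 + s.p33 + s.p43) * (s.p11 + s.p12 - s.p13 - s.p14 - s.p21 - s.p22 + s.p23 +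
      s.p24) + (s.p14 + s.p24 + s.p34 + s.p44) * (s.p31 + s.p32 - s.p33 - s.p34 - s.p41 - s.p42 +
      s.p43 + s.p44)) * (s.p31 - s.p32 + s.p33 - s.p34 - s.p41 + s.p42 - s.p43 + s.p44)) := T4
      (by rw [q11]; ring) (by rw [q12]; ring) (by rw [q13]; ring) (by rw [q14]; ring)
      (by rw [q23]; ring) (by rw [q43]; ring) (by rw [q22]; ring) (by rw [q42]; ring)
  rw [t0, t1, q13, q21, q22, q33]
  linear_combination 8 * ((((((h.e49 + h.e50) + (-h.e51 - h.e52)) + ((h.e53 + h.e54) + (-h.e55 -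
      h.e56))) + (((h.e57 + h.e58) + (-h.e59 - h.e60)) + ((h.e61 + h.e62) + (-h.e63 - h.e64)))) +
      ((((-h.e65 - h.e66) + (h.e67 + h.e68)) + ((-h.e69 - h.e70) + (h.e71 + h.e72))) + (((-h.e73 -
      h.e74) + (h.e75 + h.e76)) + ((-h.e77 - h.e78) + (h.e79 + h.e80))))) + (((((h.e97 + h.e98) +
      (-h.e99 - h.e100)) + ((h.e101 + h.e102) + (-h.e103 - h.e104))) + (((h.e105 + h.e106) +
      (-h.e107 - h.e108)) + ((h.e109 + h.e110) + (-h.e111 - h.e112)))) + ((((-h.e113 - h.e114) +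
      (h.e115 + h.e116)) + ((-h.e117 - h.e118) + (h.e119 + h.e120))) + (((-h.e121 - h.e122) +
      (h.e123 + h.e124)) + ((-h.e125 - h.e126) + (h.e127 + h.e128))))))

end Sol
/-- The main case: the trace of the odd block is one half. -/
theorem half_case {K : Type} [Field K] [CharZero K] (q12 q13 q14 q21 q23 q24 q31 q32 q33 q34 q41 q42 q43 q44 : K)
    (n0 : q13*q31 + q33*q33 + (1/2)*q33 - (1/2) = 0)
    (n1 : q12*q21 + q14*q41 + (1/2)*q33 - (1/4) = 0)
    (n2 : -q12*q33 + q13*q32 - q12 = 0)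
    (n3 : -q12*q44 + q14*q42 + q12 = 0)
    (n5 : q12*q23 + q14*q43 - (1/2)*q13 = 0)
    (n6 : q13*q34 - q14*q33 - q14 = 0)
    (n7 : q12*q24 + q14*q44 + (1/2)*q14 = 0)
    (n8 : -q21*q33 + q23*q31 - q21 = 0)
    (n9 : -q21*q44 + q24*q41 + q21 = 0)
    (n10 : q12*q21 + q23*q32 - (1/2)*q44 - (1/4) = 0)
    (n11 : q24*q42 + q44*q44 - (1/2)*q44 - (1/2) = 0)
    (n12 : q13*q21 + q23*q33 - (1/2)*q23 = 0)
    (n13 : -q23*q44 + q24*q43 + q23 = 0)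
    (n14 : q14*q21 + q23*q34 + (1/2)*q24 = 0)
    (n17 : q21*q32 + q34*q41 - (1/2)*q31 = 0)
    (n18 : q12*q31 + q32*q33 - (1/2)*q32 = 0)
    (n19 : -q32*q44 + q34*q42 + q32 = 0)
    (n21 : q23*q32 + q34*q43 - (1/2)*q33 - (1/2) = 0)
    (n22 : q14*q31 + q33*q34 - (1/2)*q34 = 0)
    (n23 : q24*q32 + q34*q44 + (1/2)*q34 = 0)
    (n24 : q31*q43 - q33*q41 - q41 = 0)
    (n25 : q21*q42 + q41*q44 + (1/2)*q41 = 0)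
    (n26 : q12*q41 + q32*q43 + (1/2)*q42 = 0)
    (n28 : q13*q41 + q33*q43 - (1/2)*q43 = 0)
    (n29 : q23*q42 + q43*q44 + (1/2)*q43 = 0)
    (n30 : q14*q41 + q34*q43 + (1/2)*q44 - (1/2) = 0)
    (c0 : -q12*q21*q44 - q12*q42*q44 - q23*q32*q44 + q24*q32*q42 + (1/2)*q12*q21 + (1/2)*q12*q42 -
      (1/2)*q21*q24 + (1/2)*q23*q32 + (1/2)*q44*q44 - (1/4)*q44 = 0)
    (c1 : -q21*q24*q44 + q23*q24*q42 + q24*q42*q44 + q44*q44*q44 + q21*q24 - (3/2)*q44*q44 + (1/2)*q44 =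
      0)
    (c2 : q12*q23*q43 + q13*q23*q43 + q14*q43*q43 - q23*q23*q33 - (1/2)*q23*q23 - (1/2)*q23*q33 +
      (1/2)*q24*q31 - (1/4)*q23 = 0)
    (c3 : q13*q21*q23 + q13*q23*q43 - q23*q33*q44 + q24*q33*q43 + (1/2)*q13*q21 + (1/2)*q14*q41 +
      (1/2)*q23*q33 = 0)
    (c7 : q12*q13*q41 + q14*q33*q41 - (1/2)*q13*q21 + (1/2)*q23*q33 - (1/2)*q24*q31 + (1/4)*q23 = 0)
    (c8 : -2*q23*q23*q44 + 2*q23*q24*q43 - 2*q23*q44*q44 + 2*q24*q43*q44 + q23*q23 + 2*q23*q44 - q24*q42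
      - (1/2)*q23 = 0)
    (c9 : -q12*q23*q31 - q12*q31*q44 - q23*q32*q33 - q32*q33*q44 + (1/2)*q12*q31 - (1/2)*q12*q42 +
      (1/2)*q12*q43 - (1/2)*q23*q32 - (1/2)*q23*q33 + (1/2)*q32*q33 - (1/2)*q32*q44 - (1/2)*q33*q44
      - (1/4)*q23 + (1/4)*q32 + (1/4)*q33 - (1/4)*q44 + (1/8) = 0)
    (c14 : -q14*q41*q44 + q14*q42*q42 - q24*q24*q41 - q24*q42*q44 - q24*q43*q44 + q34*q42*q44 -
      q34*q43*q44 - q44*q44*q44 + (1/2)*q14*q41 + q24*q43 + (1/2)*q34*q43 + q44*q44 = 0)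
    (c15 : -q13*q21*q44 - q13*q42*q44 - q21*q23*q24 - q23*q24*q43 - q23*q33*q44 + q23*q44*q44 +
      q24*q33*q42 - q24*q43*q44 + (1/2)*q13*q21 + (1/2)*q13*q42 + (1/2)*q23*q33 - (3/2)*q23*q44 +
      q24*q42 + (1/2)*q23 = 0)
    (c16 : q13*q31*q44 - q13*q32*q42 + q23*q24*q31 + q23*q32*q44 + q24*q33*q43 + q33*q33*q44 -
      q33*q34*q42 + q34*q43*q44 + q12*q43 - (1/2)*q13*q31 + q32*q44 - (1/2)*q33*q33 = 0)
    (c19 : q12*q21*q44 + q12*q33*q42 + q13*q24*q41 + q13*q31*q44 - q14*q31*q42 + q14*q41*q44 -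
      q21*q24*q33 + q33*q33*q44 - q12*q21 + (1/2)*q12*q42 - (1/2)*q13*q31 - (1/2)*q21*q24 + q32*q44
      - (1/2)*q33*q33 + q33*q44 - (1/2)*q32 - (1/2)*q33 + (1/4)*q44 - (1/8) = 0)
    (c24 : q12*q12*q41 - q12*q21*q33 + q12*q43*q44 + q13*q21*q32 - q13*q23*q42 + q14*q32*q41 -
      q14*q42*q43 - q23*q33*q44 - (1/2)*q12*q21 - (1/2)*q12*q43 + q13*q21 + (1/2)*q23*q33 -
      (1/2)*q23*q44 - q33*q44 + (1/4)*q23 + (1/2)*q33 = 0) : False := by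
  have l0 : q12*q34 - q14*q32 = 0 := by
    linear_combination (2/3) * q12 * n23 + (2/3) * q34 * n3 - (2/3) * q32 * n7 - (2/3) * q14 * n19
  have l1 : q13*q24 + 3*q14*q23 = 0 := by
    linear_combination 2 * q13 * n14 - 2 * q23 * n6 - 2 * q14 * n12
  have l2 : q12*q43 + (1/3)*q13*q42 = 0 := by
    linear_combination -(2/3) * q42 * n5 + (2/3) * q12 * n29 + (2/3) * q43 * n3
  have l3 : q21*q34 + (1/3)*q24*q31 = 0 := by
    linear_combination (2/3) * q34 * n9 - (2/3) * q24 * n17 + (2/3) * q21 * n23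
  have l4 : q21*q43 - q23*q41 = 0 := by
    linear_combination -(2/3) * q43 * n8 + (2/3) * q23 * n24 + (2/3) * q41 * n12 - (2/3) * q21 * n28
  have l5 : q31*q42 + 3*q32*q41 = 0 := by
    linear_combination -2 * q42 * n17 + 2 * q32 * n25 + 2 * q41 * n19
  have l6 : q13*q44 + 3*q14*q43 - q13 = 0 := by
    linear_combination -2 * q43 * n6 + 2 * q13 * n30 - 2 * q14 * n28
  have l7 : q14*q21 - (1/3)*q24*q33 + (1/6)*q24 = 0 := by
    linear_combination -(2/3) * q24 * n1 + (2/3) * q21 * n7 + (2/3) * q14 * n9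
  have l8 : q12*q41 - (1/3)*q33*q42 + (1/6)*q42 = 0 := by
    linear_combination -(2/3) * q42 * n1 + (2/3) * q12 * n25 + (2/3) * q41 * n3
  have l9 : q31*q44 + 3*q34*q41 - q31 = 0 := by
    linear_combination -2 * q41 * n22 + 2 * q31 * n30 - 2 * q34 * n24
  have l10 : q33*q44 + 3*q34*q43 - q33 + q44 - 1 = 0 := by
    linear_combination -2 * q32 * n13 + 2 * q43 * n23 - 2 * q44 * n21 + 2 * n21
  have N0_0 : q23*q23 + q24*q42 + (1/2)*q23 = 0 := by
    linear_combination 2 * q44 * n13 + 2 * q23 * n13 - c8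
  have N0_1 : -q13*q43 + q14*q41 - q23*q33 - q24*q31 - 2*q24*q42 = 0 := by
    linear_combination 2 * q43 * n5 - 2 * c2 - 2 * q23 * n12 + 2 * c3 - n12 - 2 * q33 * n13 - 4 * q44 *
      n13 - 4 * q23 * n13 + 2 * c8
  have N0_2 : q12*q42 + q21*q24 - 3*q24*q43 + q34*q42 - 4*q44*q44 + 5*q44 - (3/4) = 0 := by
    linear_combination -4 * q44 * n11 + 2 * q42 * n23 - 2 * q44 * n21 + 2 * q42 * n3 - 2 * q44 * n1 - 2
      * c14 - 2 * c0 + n21 - 2 * q24 * n9 + 2 * c1 - 2 * q24 * n29 + n1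
  have N0_3 : -(1/2)*q12*q21 - (1/4)*q12*q42 + (1/2)*q12*q43 + (1/4)*q21*q24 + (1/4)*q24*q43 + (3/4)*q32*q44 + q44 - (5/16) = 0 := by
    linear_combination (1/4) * n19 - (1/2) * q44 * n21 - (1/2) * q24 * n28 + (1/2) * c19 + (1/2) * c16 -
      (1/2) * q24 * n8 - (1/2) * q44 * n1 + (1/2) * q42 * n22 + (1/2) * q42 * n2 - q44 * n0 + (1/2)
      * n0
  have N0_4 : -9*q12*q21 + q13*q21 - 2*q23*q23 - 2*q23*q44 - (5/2)*q32*q44 - 5*q33*q44 - (1/2)*q34*q42 - (3/2)*q33 = 0 := by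
    linear_combination -10 * n10 + n12 + (25/2) * n21 - 4 * q23 * n13 + 2 * c8 - 8 * q44 * n13 + 2 * n11
      - 4 * l10 - n19 - 2 * q44 * n11 + c1 - q24 * n9 + 3 * q24 * n29 + q24 * n8 - q31 * n3 + 2 *
      q23 * n18 + 2 * c9 - q33 * n19 + q44 * n18 + 2 * q44 * n0 - q42 * n2 - c0 - c19 - c14 + q42 *
      n3 + q24 * n28 + q42 * n23 - c16 - n0 + (1/2) * n1 - 4 * q23 * n11
  have N1_0 : q23*q32 + 2*q23*q44 + q33*q44 + 2*q34*q42 - (3/2)*q23 - q33 = 0 := by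
    linear_combination -12 * q21 * n5 - 3 * q32 * N0_0 + 3 * q23 * n10 + 3 * q42 * n23 - n12 + 4 * q21 *
      l6 - 5 * q44 * n12 + 2 * q23 * n11 - q33 * N0_0 + 5 * q33 * n11 - q23 * N0_4 + (5/2) * q23 *
      n19 + q23 * n12 - 2 * q23 * N0_0 - 9 * q21 * n3 + q44 * N0_4 - N0_4 - (5/2) * q44 * n19 + 12 *
      q42 * l7 - (1/2) * N0_0 - 3 * q42 * n14
  have N1_1 : (1/14)*q13*q21 - (5/21)*q23*q23 + (8/21)*q23*q32 + (1/14)*q24*q42 + (37/42)*q24*q43 + q34*q42 - (17/14)*q34*q43 = 0 := by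
    linear_combination -(41/84) * n12 + (47/42) * n10 - (17/42) * N0_4 + (83/84) * n13 - (17/42) * l10 -
      (1/56) * n11 - (1/7) * q43 * n3 - (2/7) * q44 * N0_3 + (1/42) * c0 - (1/21) * q44 * N0_2 -
      (103/84) * q44 * n19 + (2/7) * N0_3 + (3/2) * q23 * n10 - (3/2) * q32 * N0_0 - (39/7) * q21 *
      n5 + (13/7) * q21 * l6 + (17/42) * q44 * N0_4 - (1/14) * q44 * n11 + (4/21) * q44 * N0_0 -
      (31/28) * q44 * n10 + (1/14) * c15 + (2/7) * q23 * n13 + (1/14) * q42 * l6 + (85/42) * q33 *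
      n11 - (1/14) * q42 * n5 + (1/14) * q23 * N0_2 - (25/84) * q42 * n14 + (69/14) * q42 * l7 -
      (389/84) * q21 * n3 + (43/42) * q23 * n11 - (5/42) * c1 + (5/84) * N0_2 + (31/21) * q42 * n23
      - (46/21) * q44 * n12 - (55/84) * N0_0 - (19/42) * q23 * N0_4 + (19/42) * q23 * n12 - (19/21)
      * q23 * N0_0 - (19/42) * q33 * N0_0
  have N1_2 : -(13/4)*q12*q43 - (15/4)*q24*q42 + q24*q43 + (23/16)*q32*q44 + (17/16)*q34*q42 + (17/16)*q44 - (11/32) = 0 := by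
    linear_combination (57/16) * n11 - (15/4) * N0_3 + (7/16) * N0_2 - (45/4) * n10 + (35/8) * n21 +
      (3/8) * q23 * n12 - (3/8) * q33 * N0_0 - (123/16) * N0_0 - (15/4) * q21 * n5 - (3/8) * q23 *
      N0_4 - (3/4) * q23 * N0_0 + (3/4) * q33 * n13 - (27/16) * n12 + (15/4) * q43 * l7 + 6 * q44 *
      N0_0 + (81/16) * n13 - (35/4) * q34 * n29 + (3/8) * q42 * n23 + (21/8) * q44 * n10 - (9/4) *
      c0 - (3/2) * q44 * N0_2 - (3/4) * c1 - (21/4) * q44 * n11 - (39/8) * q24 * n29 - (15/8) * q23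
      * n10 + (15/8) * q32 * N0_0 + (113/16) * q23 * n19 + (9/4) * q23 * l2 - (9/4) * q12 * n29 -
      (9/2) * q23 * N0_3 + 6 * q23 * n13 + 3 * q44 * N0_3 + (3/2) * q23 * N0_2 + (51/8) * q23 * n11
      + (9/2) * q44 * n21 - (3/4) * q21 * n2 - (3/4) * q12 * l8 - (1/8) * q33 * N0_2 - (1/8) * q24 *
      n8 + (3/4) * c24 - (1/4) * q14 * l5 + (1/4) * q42 * n22 + (11/8) * q44 * l10 - (3/8) * q42 *
      n5 - (1/8) * q44 * n0 + (1/8) * c16 + (1/16) * n0 + (1/8) * q42 * n2 + (21/16) * q44 * n19 -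
      (9/8) * N0_4 + (3/8) * q42 * l6 + (3/8) * q44 * N0_4 + (3/8) * c15
  have N1_3 : -2*q12*q31 + (16301/1544)*q12*q42 - (24087/386)*q12*q43 - q13*q43 - (9189/772)*q23*q32 + (5993/3088)*q23*q33 - (31371/772)*q24*q42 + q32*q32 + q33*q33 + (52279/3088)*q34*q42 - (18411/6176)*q33 = 0 := by
    linear_combination -(33671/386) * N0_3 + (59187/6176) * N0_2 + (75621/3088) * n10 + (1535/6176) *
      n12 - (72347/3088) * N0_4 - (89955/772) * N0_0 - 2 * n18 - (170483/6176) * n19 + (124351/1544)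
      * n13 + (284965/6176) * n11 - (709131/3088) * q21 * n3 + (25959/386) * q14 * n25 -
      (193557/3088) * q44 * n1 - (25187/772) * n1 - 3 * q32 * N0_2 - (122213/3088) * q44 * n10 - 6 *
      q32 * n13 + (501459/3088) * q42 * l7 + (23619/386) * q33 * n11 - 12 * q32 * N0_3 + 6 * q12 *
      n26 + (18951/772) * q32 * N0_0 - (140421/1544) * q44 * n11 + (63589/3088) * q33 * n13 - 2 *
      q13 * n29 - 2 * q44 * N0_1 - 2 * q24 * l9 + (33381/6176) * q43 * n3 + (14553/1544) * c24 -
      (8377/1544) * q21 * n2 - (23817/1544) * q12 * l8 - 42 * q32 * n1 + 6 * q24 * n17 - (25127/772)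
      * q23 * n10 - (82427/1544) * q23 * n1 + (28505/1544) * q41 * l1 - (43703/1544) * q24 * n28 -
      (3404/193) * q32 * n11 + (7939/3088) * q44 * n0 - (7939/3088) * c19 - (7939/6176) * n0 -
      (41469/3088) * q42 * n22 - (11027/3088) * q33 * N0_2 + (16765/1544) * q14 * l5 + (51019/1544)
      * q42 * n23 + q32 * n19 + 2 * q33 * n1 + 2 * q12 * n28 - 2 * c7 - 4 * q33 * N0_3 + 17 * q33 *
      n19 - 4 * q32 * N0_4 - 2 * q24 * n8 - (4431/386) * q23 * N0_0 - (272565/3088) * q24 * n29 +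
      (5975/772) * q23 * n12 - 2 * c3 - 2 * q23 * N0_1 - (4431/772) * q23 * N0_4 + (18911/193) * q44
      * N0_0 - (35031/1544) * q23 * n19 - (17043/1544) * c1 - (61689/1544) * c0 - (19683/772) * q44
      * N0_2 - (52923/772) * q23 * N0_3 + (3825/193) * q23 * N0_2 + (15300/193) * q23 * n13 +
      (52923/1544) * q23 * l2 + (22323/386) * q44 * N0_3 + (38335/3088) * q13 * n9 + (8277/3088) *
      c15 + (24831/6176) * q44 * l2 + (8277/6176) * q42 * l6 + (329747/3088) * q23 * n11 -
      (114123/3088) * q12 * n29 - (7519/772) * q33 * N0_0 + (11653/772) * q44 * N0_4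
  have h : (1 : K) = 0 := by linear_combination -(9343627305092/2122466804763) * q33 * N0_2 -
      (45144788304350/2122466804763) * q44 * n11 - (73032402624296824/1228908279957777) * q23 * N1_0
      + (78092973272107012/1228908279957777) * q23 * l10 - (37838940708253012/409636093319259) * q23
      * n21 + (181723032297622/707488934921) * q34 * n29 + (286816225981550/6367400414289) * q44 *
      N0_0 - (349819221196791257/819272186638518) * n13 - (20959048066790/2122466804763) * q24 * n8
      + (14350223569210/2122466804763) * q44 * n0 - (14350223569210/2122466804763) * c16 +
      (170255640416006/2122466804763) * n19 - (7175111784605/2122466804763) * n0 -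
      (989753549898799909/4915633119831108) * q23 * n19 + (1431692900599105/2122466804763) * n21 -
      (248804053748646785/1228908279957777) * q42 * n23 + (7892947561540000/409636093319259) * q23 *
      N0_0 + (925214619895784/136545364439753) * q23 * n12 + (11050126586156000/136545364439753) *
      q23 * N1_1 - (168700205697537397/1228908279957777) * q24 * n29 -
      (250733935911006113/2457816559915554) * q44 * N1_0 - (116602348750498655/1228908279957777) *
      q44 * n13 - (51029768240153266/409636093319259) * q23 * n13 -
      (12376716887583695/819272186638518) * q33 * N0_0 - (2924351107840621/819272186638518) * q33 *
      n11 - (7222246104571/707488934921) * N0_4 - (105328332720880/707488934921) * N0_3 -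
      (140220145321025/6367400414289) * N0_2 - (49332267122072/2122466804763) * n12 +
      (1180538909764438/2122466804763) * N1_1 + (89841105038616/707488934921) * q44 * N0_3 -
      (179906445862274/6367400414289) * c0 + (48976868740048/2122466804763) * q44 * N1_2 -
      (807748497992/34794537783) * N1_2 + (22236040474612/6367400414289) * q44 * N0_2 +
      (350812341705617/2122466804763) * q44 * n19 - (10773753210070/707488934921) * q44 * n12 +
      (150832544940980/707488934921) * q44 * N1_1 + (2271793456606/2122466804763) * q42 * n2 +
      (185245723534042/6367400414289) * q44 * n10 + (224378526811498/6367400414289) * c1 +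
      (19847336284108/2122466804763) * n1 + (199196739277225513/1228908279957777) * q32 * N0_0 +
      (21928520585842/155302449129) * N0_0 - (11769757212000/707488934921) * q23 * N0_1 -
      (8883468269688/707488934921) * c3 + (11769757212000/707488934921) * q23 * n1 +
      (15540575101003243/409636093319259) * q23 * n10 - (22355264526751243/819272186638518) * q23 *
      N0_2 + (44710529053502486/409636093319259) * q23 * N0_3 - (22884666791047220/409636093319259)
      * q23 * N1_2 + (24413165847232/2122466804763) * q12 * n29 - (3332280093386390/6367400414289) *
      n10 - (828722297126270/2122466804763) * q33 * n10 + (781491923376302/2122466804763) * q32 *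
      n12 - (785221692237536/2122466804763) * q21 * n2 - (180510610506766/707488934921) * q43 * n23
      - (95387710562168/707488934921) * q32 * N1_0 - (28158921968038/2122466804763) * q33 * n19 +
      (18097683749990/707488934921) * q33 * n21 - (75517372884674/2122466804763) * q33 * N1_0 +
      (54635430096224/2122466804763) * q33 * l10 - (15487227682264/707488934921) * q33 * N0_3 -
      (2382650412656/707488934921) * q33 * N1_2 - (126568364614390/2122466804763) * q33 * n13 -
      (13044267759152/2122466804763) * q44 * N0_1 + (13044267759152/2122466804763) * q44 * n1 +
      (13044267759152/707488934921) * q23 * l2 - (13044267759152/2122466804763) * q13 * n29 -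
      (6522133879576/2122466804763) * N0_1 - (13044267759152/2122466804763) * q24 * l9 -
      (6522133879576/707488934921) * q32 * N0_2 + (13044267759152/707488934921) * q24 * n17 -
      (26088535518304/707488934921) * q32 * N0_3 - (9128087626144/707488934921) * q32 * N1_2 -
      (130721167123868/707488934921) * q32 * n10 - (13075211040524/707488934921) * q32 * N0_4 -
      (16622017025816/707488934921) * q32 * l2 - (1392129519230/707488934921) * q33 * N0_4 +
      (59897858461588/707488934921) * q33 * N1_1 + (146857429663180/707488934921) * q32 * n21 +
      (200458542586428/707488934921) * q32 * N1_1 - (134801361522088913/546181457759012) * N1_0 +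
      (96556514906054/2122466804763) * q32 * l10 - (1745492177564939/6367400414289) * n11 +
      (2886288942312/707488934921) * q23 * N1_3 + (5772577884624/707488934921) * q12 * n8 -
      (2886288942312/707488934921) * q33 * n12 + (560174371910212/6367400414289) * q44 * l10
  exact one_ne_zero h
theorem core {K : Type} [Field K] [CharZero K] (q11 q12 q13 q14 q21 q22 q23 q24 q31 q32 q33 q34 q41 q42 q43 q44 : K)
    (n0 : q11*q11 + q13*q31 + (1/2)*q11 - (1/2) = 0)
    (n1 : q12*q21 + q14*q41 - (1/2)*q11 - (1/2) = 0)
    (n2 : q11*q12 + q13*q32 - (1/2)*q12 = 0)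
    (n3 : q12*q22 + q14*q42 + (1/2)*q12 = 0)
    (n4 : q11*q13 + q13*q33 + (1/2)*q13 = 0)
    (n5 : q12*q23 + q14*q43 - (1/2)*q13 = 0)
    (n6 : q11*q14 + q13*q34 - (1/2)*q14 = 0)
    (n7 : q12*q24 + q14*q44 + (1/2)*q14 = 0)
    (n8 : q11*q21 + q23*q31 - (1/2)*q21 = 0)
    (n9 : q21*q22 + q24*q41 + (1/2)*q21 = 0)
    (n10 : q12*q21 + q23*q32 + (1/2)*q22 - (1/2) = 0)
    (n11 : q22*q22 + q24*q42 - (1/2)*q22 - (1/2) = 0)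
    (n12 : q13*q21 + q23*q33 - (1/2)*q23 = 0)
    (n13 : q22*q23 + q24*q43 + (1/2)*q23 = 0)
    (n14 : q14*q21 + q23*q34 + (1/2)*q24 = 0)
    (n15 : q22*q24 + q24*q44 - (1/2)*q24 = 0)
    (n16 : q11*q31 + q31*q33 + (1/2)*q31 = 0)
    (n17 : q21*q32 + q34*q41 - (1/2)*q31 = 0)
    (n18 : q12*q31 + q32*q33 - (1/2)*q32 = 0)
    (n19 : q22*q32 + q34*q42 + (1/2)*q32 = 0)
    (n20 : q13*q31 + q33*q33 + (1/2)*q33 - (1/2) = 0)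
    (n21 : q23*q32 + q34*q43 - (1/2)*q33 - (1/2) = 0)
    (n22 : q14*q31 + q33*q34 - (1/2)*q34 = 0)
    (n23 : q24*q32 + q34*q44 + (1/2)*q34 = 0)
    (n24 : q11*q41 + q31*q43 - (1/2)*q41 = 0)
    (n25 : q21*q42 + q41*q44 + (1/2)*q41 = 0)
    (n26 : q12*q41 + q32*q43 + (1/2)*q42 = 0)
    (n27 : q22*q42 + q42*q44 - (1/2)*q42 = 0)
    (n28 : q13*q41 + q33*q43 - (1/2)*q43 = 0)
    (n29 : q23*q42 + q43*q44 + (1/2)*q43 = 0)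
    (n30 : q14*q41 + q34*q43 + (1/2)*q44 - (1/2) = 0)
    (n31 : q24*q42 + q44*q44 - (1/2)*q44 - (1/2) = 0)
    (c0 : q12*q21*q22 + q12*q22*q42 + q22*q23*q32 + q24*q32*q42 - (1/2)*q21*q24 - (1/2)*q22*q44 = 0)
    (c1 : q21*q22*q24 + q22*q22*q44 + q23*q24*q42 + q24*q42*q44 + (1/2)*q21*q24 + (1/2)*q22*q44 = 0)
    (c2 : q11*q23*q23 + q12*q23*q43 + q13*q23*q43 + q14*q43*q43 + (1/2)*q11*q23 + (1/2)*q24*q31 = 0)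
    (c3 : q13*q21*q23 + q13*q23*q43 + q22*q23*q33 + q24*q33*q43 + (1/2)*q13*q21 + (1/2)*q14*q41 = 0)
    (c7 : q11*q13*q21 + q12*q13*q41 + q13*q21*q33 + q14*q33*q41 - (1/2)*q11*q23 - (1/2)*q24*q31 = 0)
    (c8 : 2*q22*q23*q44 - 2*q22*q24*q43 - 2*q23*q23*q44 + 2*q23*q24*q43 - q22*q23 + q23*q23 - q24*q42 +
      q24*q43 = 0)
    (c9 : -q11*q22*q32 + q11*q23*q32 + q12*q22*q31 - q12*q23*q31 - (1/2)*q11*q22 + (1/2)*q11*q23 -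
      (1/2)*q12*q42 + (1/2)*q12*q43 = 0)
    (c14 : q14*q22*q41 + q14*q42*q42 + q22*q34*q43 - q24*q24*q41 - q24*q42*q44 - q24*q43*q44 +
      q34*q42*q44 - q44*q44*q44 + q24*q43 + q44*q44 = 0)
    (c15 : q13*q21*q22 + q13*q22*q42 - q21*q23*q24 + q22*q23*q33 - q22*q23*q44 - q23*q24*q43 +
      q24*q33*q42 - q24*q43*q44 + q22*q23 + q24*q42 = 0)
    (c16 : -q13*q22*q31 - q13*q32*q42 - q22*q33*q33 + q23*q24*q31 + q23*q32*q44 + q24*q33*q43 -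
      q33*q34*q42 + q34*q43*q44 + q12*q43 + q32*q44 = 0)
    (c19 : -q11*q11*q22 - q11*q12*q42 + q11*q21*q24 + q12*q21*q44 - q13*q22*q31 + q13*q24*q41 -
      q14*q31*q42 + q14*q41*q44 - q12*q21 - q22*q32 = 0)
    (c24 : q11*q12*q21 - q11*q22*q23 + q12*q12*q41 - q12*q22*q43 + q13*q21*q32 - q13*q23*q42 +
      q14*q32*q41 - q14*q42*q43 + q13*q21 + q22*q33 = 0) : False := by
  have tr : q11 + q22 + q33 + q44 = 0 := by
    linear_combination 2 * ((-n1 + n10) + (-n21 + n30))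
  by_cases ht : q22 + q44 - 1 / 2 = 0
  · have h22 : q22 = 1 / 2 - q44 := by linear_combination ht
    have h11 : q11 = -1 / 2 - q33 := by linear_combination tr - ht
    subst h22 h11
    exact half_case q12 q13 q14 q21 q23 q24 q31 q32 q33 q34 q41 q42 q43 q44
      (by linear_combination n0)
      (by linear_combination n1)
      (by linear_combination n2)
      (by linear_combination n3)
      (by linear_combination n5)
      (by linear_combination n6)
      (by linear_combination n7)
      (by linear_combination n8)
      (by linear_combination n9)
      (by linear_combination n10)
      (by linear_combination n11)
      (by linear_combination n12)
      (by linear_combination n13)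
      (by linear_combination n14)
      (by linear_combination n17)
      (by linear_combination n18)
      (by linear_combination n19)
      (by linear_combination n21)
      (by linear_combination n22)
      (by linear_combination n23)
      (by linear_combination n24)
      (by linear_combination n25)
      (by linear_combination n26)
      (by linear_combination n28)
      (by linear_combination n29)
      (by linear_combination n30)
      (by linear_combination c0)
      (by linear_combination c1)
      (by linear_combination c2)
      (by linear_combination c3)
      (by linear_combination c7)
      (by linear_combination c8)
      (by linear_combination c9)
      (by linear_combination c14)
      (by linear_combination c15)
      (by linear_combination c16)
      (by linear_combination c19)
      (by linear_combination c24)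
  · have hu : q11 + q33 + 1 / 2 ≠ 0 := fun h => ht (by linear_combination tr - h)
    have z24 : q24 = 0 := by
      refine (mul_eq_zero.mp (?_ : (q22 + q44 - 1 / 2) * (q24) = 0)).resolve_left ht
      linear_combination 1 * n15
    have z42 : q42 = 0 := by
      refine (mul_eq_zero.mp (?_ : (q22 + q44 - 1 / 2) * (q42) = 0)).resolve_left ht
      linear_combination 1 * n27
    have z13 : q13 = 0 := by
      refine (mul_eq_zero.mp (?_ : (q11 + q33 + 1 / 2) * (q13) = 0)).resolve_left hu
      linear_combination 1 * n4
    have z31 : q31 = 0 := by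
      refine (mul_eq_zero.mp (?_ : (q11 + q33 + 1 / 2) * (q31) = 0)).resolve_left hu
      linear_combination 1 * n16
    have d22 : q22 - q44 = 0 := by
      refine (mul_eq_zero.mp (?_ : (q22 + q44 - 1 / 2) * (q22 - q44) = 0)).resolve_left ht
      linear_combination 1 * (n11 - n31)
    have d11 : q11 - q33 = 0 := by
      refine (mul_eq_zero.mp (?_ : (q11 + q33 + 1 / 2) * (q11 - q33) = 0)).resolve_left hu
      linear_combination 1 * (n0 - n20) - ((q11+q33+q22+q44)*0)
    have h22 : q22 = q44 := by linear_combination d22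
    have h33 : q33 = -q44 := by linear_combination (1 / 2) * tr - (1 / 2) * d11 - (1 / 2) * d22
    have h11 : q11 = -q44 := by linear_combination (1 / 2) * tr + (1 / 2) * d11 - (1 / 2) * d22
    subst z24 z42 z13 z31 h22 h33 h11
    have hc : (q22 - 1) * (2 * q22 + 1) = 0 := by linear_combination 2 * n31
    rcases mul_eq_zero.mp hc with hc | hc
    · have h44 : q22 = 1 := by linear_combination hc
      subst h44
      exact absurd (show (3 / 2 : K) = 0 by linear_combination c1) (by norm_num)
    · have h44 : q22 = -1 / 2 := by linear_combination (1 / 2) * hc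
      subst h44
      exact absurd (show (-1 / 2 : K) = 0 by linear_combination c0 + (1 / 2) * n10) (by norm_num)
theorem no_sol {K : Type} [Field K] [CharZero K] (s : Sol K) (h : s.Is) : False := by
  refine core (s.q11 / 4) (s.q12 / 4) (s.q13 / 4) (s.q14 / 4) (s.q21 / 4) (s.q22 / 4) (s.q23 / 4) (s.q24 / 4) (s.q31 / 4) (s.q32 / 4) (s.q33 / 4) (s.q34 / 4) (s.q41 / 4) (s.q42 / 4) (s.q43 / 4) (s.q44 / 4)
    (by linear_combination (1 / 16) * s.n0 h)
    (by linear_combination (1 / 16) * s.n1 h)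
    (by linear_combination (1 / 16) * s.n2 h)
    (by linear_combination (1 / 16) * s.n3 h)
    (by linear_combination (1 / 16) * s.n4 h)
    (by linear_combination (1 / 16) * s.n5 h)
    (by linear_combination (1 / 16) * s.n6 h)
    (by linear_combination (1 / 16) * s.n7 h)
    (by linear_combination (1 / 16) * s.n8 h)
    (by linear_combination (1 / 16) * s.n9 h)
    (by linear_combination (1 / 16) * s.n10 h)
    (by linear_combination (1 / 16) * s.n11 h)
    (by linear_combination (1 / 16) * s.n12 h)
    (by linear_combination (1 / 16) * s.n13 h)
    (by linear_combination (1 / 16) * s.n14 h)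
    (by linear_combination (1 / 16) * s.n15 h)
    (by linear_combination (1 / 16) * s.n16 h)
    (by linear_combination (1 / 16) * s.n17 h)
    (by linear_combination (1 / 16) * s.n18 h)
    (by linear_combination (1 / 16) * s.n19 h)
    (by linear_combination (1 / 16) * s.n20 h)
    (by linear_combination (1 / 16) * s.n21 h)
    (by linear_combination (1 / 16) * s.n22 h)
    (by linear_combination (1 / 16) * s.n23 h)
    (by linear_combination (1 / 16) * s.n24 h)
    (by linear_combination (1 / 16) * s.n25 h)
    (by linear_combination (1 / 16) * s.n26 h)
    (by linear_combination (1 / 16) * s.n27 h)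
    (by linear_combination (1 / 16) * s.n28 h)
    (by linear_combination (1 / 16) * s.n29 h)
    (by linear_combination (1 / 16) * s.n30 h)
    (by linear_combination (1 / 16) * s.n31 h)
    (by linear_combination (1 / 64) * s.c0 h)
    (by linear_combination (1 / 64) * s.c1 h)
    (by linear_combination (1 / 64) * s.c2 h)
    (by linear_combination (1 / 64) * s.c3 h)
    (by linear_combination (1 / 64) * s.c7 h)
    (by linear_combination (1 / 64) * s.c8 h)
    (by linear_combination (1 / 64) * s.c9 h)
    (by linear_combination (1 / 64) * s.c14 h)
    (by linear_combination (1 / 64) * s.c15 h)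
    (by linear_combination (1 / 64) * s.c16 h)
    (by linear_combination (1 / 64) * s.c19 h)
    (by linear_combination (1 / 64) * s.c24 h)

set_option maxRecDepth 20000 in
theorem no_zero (K : Type) [Field K] [CharZero K] (x : Fin 16 → K)
    (h : ∀ i : Fin 128, MvPolynomial.aeval x (f i) = 0) : False := by
  refine no_sol (⟨x 12, x 13, x 14, x 15, x 8, x 9, x 10, x 11, x 4, x 5, x 6, x 7, x 0, x 1, x 2, x 3⟩ : Sol K) ?_
  have hL0 : MvPolynomial.aeval x (L 0) = x 0 := MvPolynomial.aeval_X x _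
  have hL1 : MvPolynomial.aeval x (L 1) = x 1 := MvPolynomial.aeval_X x _
  have hL2 : MvPolynomial.aeval x (L 2) = x 2 := MvPolynomial.aeval_X x _
  have hL3 : MvPolynomial.aeval x (L 3) = x 3 := MvPolynomial.aeval_X x _
  have hL4 : MvPolynomial.aeval x (L 4) = x 4 := MvPolynomial.aeval_X x _
  have hL5 : MvPolynomial.aeval x (L 5) = x 5 := MvPolynomial.aeval_X x _
  have hL6 : MvPolynomial.aeval x (L 6) = x 6 := MvPolynomial.aeval_X x _
  have hL7 : MvPolynomial.aeval x (L 7) = x 7 := MvPolynomial.aeval_X x _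
  have hM0 : MvPolynomial.aeval x (M 0) = x 8 := MvPolynomial.aeval_X x _
  have hM1 : MvPolynomial.aeval x (M 1) = x 9 := MvPolynomial.aeval_X x _
  have hM2 : MvPolynomial.aeval x (M 2) = x 10 := MvPolynomial.aeval_X x _
  have hM3 : MvPolynomial.aeval x (M 3) = x 11 := MvPolynomial.aeval_X x _
  have hM4 : MvPolynomial.aeval x (M 4) = x 12 := MvPolynomial.aeval_X x _
  have hM5 : MvPolynomial.aeval x (M 5) = x 13 := MvPolynomial.aeval_X x _
  have hM6 : MvPolynomial.aeval x (M 6) = x 14 := MvPolynomial.aeval_X x _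
  have hM7 : MvPolynomial.aeval x (M 7) = x 15 := MvPolynomial.aeval_X x _
  constructor
  all_goals simp only [← hL0, ← hL1, ← hL2, ← hL3, ← hL4, ← hL5, ← hL6, ← hL7, ← hM0, ← hM1, ← hM2,
    ← hM3, ← hM4, ← hM5, ← hM6, ← hM7, ← map_add, ← map_sub, ← map_mul, ← map_neg,
    ← map_one (MvPolynomial.aeval (R := ℚ) x)]
  exacts [h 0, h 1, h 2, h 3, h 4, h 5, h 6, h 7, h 8, h 9, h 10, h 11, h 12, h 13, h 14, h 15, h
    16, h 17, h 18, h 19, h 20, h 21, h 22, h 23, h 24, h 25, h 26, h 27, h 28, h 29, h 30, h 31,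
    h 32, h 33, h 34, h 35, h 36, h 37, h 38, h 39, h 40, h 41, h 42, h 43, h 44, h 45, h 46, h
    47, h 48, h 49, h 50, h 51, h 52, h 53, h 54, h 55, h 56, h 57, h 58, h 59, h 60, h 61, h 62,
    h 63, h 64, h 65, h 66, h 67, h 68, h 69, h 70, h 71, h 72, h 73, h 74, h 75, h 76, h 77, h
    78, h 79, h 80, h 81, h 82, h 83, h 84, h 85, h 86, h 87, h 88, h 89, h 90, h 91, h 92, h 93,
    h 94, h 95, h 96, h 97, h 98, h 99, h 100, h 101, h 102, h 103, h 104, h 105, h 106, h 107, h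
    108, h 109, h 110, h 111, h 112, h 113, h 114, h 115, h 116, h 117, h 118, h 119, h 120, h
    121, h 122, h 123, h 124, h 125, h 126, h 127]

theorem stmt14 :
    Ideal.span (Set.range f) = (⊤ : Ideal (MvPolynomial (Fin 16) ℚ)) ∧
      ∀ (K : Type) [Field K] [CharZero K],
        ¬∃ x : Fin 16 → K, ∀ i : Fin 128, MvPolynomial.aeval x (f i) = 0 := by
  refine ⟨?_, fun K _ _ ⟨x, hx⟩ => no_zero K x hx⟩
  by_contra hne
  obtain ⟨m, hm, hle⟩ := Ideal.exists_le_maximal _ hne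
  let _ : Field (MvPolynomial (Fin 16) ℚ ⧸ m) := Ideal.Quotient.field m
  have _ : CharZero (MvPolynomial (Fin 16) ℚ ⧸ m) :=
    charZero_of_injective_algebraMap (algebraMap ℚ (MvPolynomial (Fin 16) ℚ ⧸ m)).injective
  let φ : MvPolynomial (Fin 16) ℚ →ₐ[ℚ] (MvPolynomial (Fin 16) ℚ ⧸ m) :=
    RingHom.toRatAlgHom (Ideal.Quotient.mk m)
  refine no_zero (MvPolynomial (Fin 16) ℚ ⧸ m) (fun i => φ (MvPolynomial.X i)) fun i => ?_
  have h1 : φ = MvPolynomial.aeval (fun i => φ (MvPolynomial.X i)) :=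
    MvPolynomial.aeval_unique φ
  have h2 : φ (f i) = 0 :=
    Ideal.Quotient.eq_zero_iff_mem.mpr (hle (Ideal.subset_span ⟨i, rfl⟩))
  exact (DFunLike.congr_fun h1 (f i)).symm.trans h2
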